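/- Hölder estimates for the pressure and its time derivative (Lemma 6.4): Let x : [0,T]×Ω → ℝⁿ be smooth with invertible Jacobian satisfying the coordinate condition with constant c₁, V = D_t x, and let p : [0,T]×Ω → ℝ be smooth with p(t,·) = 0 on ∂Ω solving Δp = −(∂_i V^j)(∂_j V^i) for each t; write ṗ = D_t p, ẋ = D_t x, ẍ = D_t² x. Then for each r ≥ 1 and each t there is a constant K depending only on n, r, c₁ and an upper bound for ‖x(t,·)‖_{3,∞} + ‖ẋ(t,·)‖_{2,∞} + ‖ẍ(t,·)‖_{1,∞} such that ‖p(t,·)‖_{r,∞} ≤ K (‖ẋ(t,·)‖_{r,∞} + ‖x(t,·)‖_{r+1,∞}) and ‖ṗ(t,·)‖_{r,∞} ≤ K (‖ẍ(t,·)‖_{r,∞} + ‖ẋ(t,·)‖_{r+1,∞} + ‖x(t,·)‖_{r+2,∞}). -/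

import Mathlib

open scoped BigOperators
open Set Matrix

noncomputable section

abbrev E' (n : ℕ) := EuclideanSpace ℝ (Fin n)

def Ball (n : ℕ) : Set (E' n) := Metric.closedBall 0 1

def Sphere' (n : ℕ) : Set (E' n) := Metric.sphere 0 1

variable {n : ℕ} {F : Type*} [NormedAddCommGroup F] [NormedSpace ℝ F]

/-- Partial derivative `∂u/∂y^a`. -/
def pd (a : Fin n) (u : E' n → ℝ) (y : E' n) : ℝ :=
  fderiv ℝ u y (EuclideanSpace.single a 1)

/-- Jacobian matrix `∂x^i/∂y^a`. -/
def jacM (x : E' n → E' n) (y : E' n) : Matrix (Fin n) (Fin n) ℝ :=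
  Matrix.of fun i a => pd a (fun z => x z i) y

/-- Metric `g_{ab} = Σ_i (∂x^i/∂y^a)(∂x^i/∂y^b)`. -/
def gMet (x : E' n → E' n) (y : E' n) : Matrix (Fin n) (Fin n) ℝ :=
  (jacM x y)ᵀ * jacM x y

def kappa (x : E' n → E' n) (y : E' n) : ℝ := (jacM x y).det

/-- Eulerian derivative `∂_i u = (∂y^a/∂x^i) ∂_a u`. -/
def epd (x : E' n → E' n) (i : Fin n) (u : E' n → ℝ) (y : E' n) : ℝ :=
  ∑ a, (jacM x y)⁻¹ a i * pd a u y

/-- Laplace–Beltrami operator `Δq = κ⁻¹ ∂_a (κ g^{ab} ∂_b q)`. -/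
def lapl (x : E' n → E' n) (q : E' n → ℝ) (y : E' n) : ℝ :=
  (kappa x y)⁻¹ *
    ∑ a, pd a (fun z => kappa x z * ∑ b, (gMet x z)⁻¹ a b * pd b q z) y

/-- Lagrangian divergence `div W = κ⁻¹ ∂_a (κ W^a)`. -/
def divL (x : E' n → E' n) (W : E' n → Fin n → ℝ) (y : E' n) : ℝ :=
  (kappa x y)⁻¹ * ∑ a, pd a (fun z => kappa x z * W z a) y

/-- Eulerian divergence `div u = ∂_k u^k`. -/
def divE (x : E' n → E' n) (u : E' n → Fin n → ℝ) (y : E' n) : ℝ :=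
  ∑ k, epd x k (fun z => u z k) y

/-- Eulerian curl `curl u_{ij} = ∂_i u_j − ∂_j u_i`. -/
def curlE (x : E' n → E' n) (u : E' n → Fin n → ℝ) (i j : Fin n) (y : E' n) : ℝ :=
  epd x i (fun z => u z j) y - epd x j (fun z => u z i) y

/-- Exterior unit (with respect to `g`) normal derivative on the unit sphere. -/
def gradN (x : E' n → E' n) (p : E' n → ℝ) (y : E' n) : ℝ :=
  (∑ a, ∑ b, (gMet x y)⁻¹ a b * y b * pd a p y) /
    Real.sqrt (∑ a, ∑ b, (gMet x y)⁻¹ a b * y a * y b)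

/-- Coordinate condition `|∂x/∂y|² + |∂y/∂x|² ≤ c₁²`. -/
def coordCond (x : E' n → E' n) (c₁ : ℝ) (y : E' n) : Prop :=
  (∑ i, ∑ a, (jacM x y i a) ^ 2) + (∑ i, ∑ a, ((jacM x y)⁻¹ i a) ^ 2) ≤ c₁ ^ 2

/-- Physical condition `∇_N p ≤ −c₀` on the boundary. -/
def physCond (x : E' n → E' n) (p : E' n → ℝ) (c₀ : ℝ) : Prop :=
  ∀ y ∈ Sphere' n, gradN x p y ≤ -c₀

/-- Material (time) derivative at fixed `y`. -/
def Dt (u : ℝ → E' n → F) : ℝ → E' n → F := fun t y => deriv (fun s => u s y) t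

/-- Iterated time derivative. -/
def Dts (k : ℕ) (u : ℝ → E' n → F) : ℝ → E' n → F := Dt^[k] u

/-- Joint space-time smoothness. -/
def SmoothST (u : ℝ → E' n → F) : Prop :=
  ContDiff ℝ (⊤ : ℕ∞) fun p : ℝ × E' n => u p.1 p.2

/-- `L²` Sobolev norm of order `r` on the unit ball. -/
def sobNorm (r : ℕ) (u : E' n → F) : ℝ :=
  ∑ j ∈ Finset.range (r + 1), (∫ y in Ball n, ‖iteratedFDeriv ℝ j u y‖ ^ 2) ^ ((1:ℝ)/2)

/-- `C^k` supremum norm on the unit ball. -/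
def ckNorm (k : ℕ) (u : E' n → F) : ℝ :=
  ∑ j ∈ Finset.range (k + 1), ⨆ y ∈ Ball n, ‖iteratedFDeriv ℝ j u y‖

/-- Hölder norm of order `a` on the set `s`. -/
def holderNormOn (s : Set (E' n)) (a : ℝ) (u : E' n → F) : ℝ :=
  if a ≤ 0 then ⨆ y ∈ s, ‖u y‖
  else
    (⨆ z ∈ s, ⨆ w ∈ s,
        ‖iteratedFDeriv ℝ (⌈a⌉₊ - 1) u z - iteratedFDeriv ℝ (⌈a⌉₊ - 1) u w‖ /
          ‖z - w‖ ^ (a - ((⌈a⌉₊ : ℝ) - 1))) +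
      ⨆ y ∈ s, ‖u y‖

/-- Hölder norm of order `a` on the unit ball. -/
def holderNorm (a : ℝ) (u : E' n → F) : ℝ := holderNormOn (Ball n) a u

/-- Space-time norm `|||u|||_{a,k}`. -/
def stNorm (T : ℝ) (a : ℝ) (k : ℕ) (u : ℝ → E' n → F) : ℝ :=
  ⨆ t ∈ Icc (0:ℝ) T, ∑ j ∈ Finset.range (k + 1), holderNorm a fun y => Dts j u t y

/-- The defining property of the pressure `p = Ψ(x)`:
`Δp = −(∂_i V^k)(∂_k V^i)` in `Ω`, `p = 0` on `∂Ω`. -/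
def IsPressure (x v : E' n → E' n) (p : E' n → ℝ) : Prop :=
  ContDiff ℝ (⊤ : ℕ∞) p ∧ (∀ y ∈ Sphere' n, p y = 0) ∧
    ∀ y ∈ Ball n,
      lapl x p y = -∑ i, ∑ k, epd x i (fun z => v z k) y * epd x k (fun z => v z i) y

/-- The pressure, selected by choice. -/
def pressureFn (x v : E' n → E' n) : E' n → ℝ := Classical.epsilon (IsPressure x v)

/-- The Euler map `Φ(x)_i = D_t² x_i + ∂_i p`. -/
def eulerMap (x : ℝ → E' n → E' n) : ℝ → E' n → Fin n → ℝ := fun t y i =>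
  Dts 2 x t y i + epd (x t) i (pressureFn (x t) (Dt x t)) y

/-- First variational derivative `Φ'(x)δx`. -/
def eulerMap' (x δx : ℝ → E' n → E' n) : ℝ → E' n → Fin n → ℝ := fun t y i =>
  deriv (fun r : ℝ => eulerMap (fun s z => x s z + r • δx s z) t y i) 0

/-- Second variational derivative `Φ''(x)(δx, εx)`. -/
def eulerMap'' (x δx εx : ℝ → E' n → E' n) : ℝ → E' n → Fin n → ℝ := fun t y i =>
  deriv (fun r : ℝ =>
    deriv (fun s : ℝ => eulerMap (fun τ z => x τ z + r • δx τ z + s • εx τ z) t y i) 0) 0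

/-- Modified linearized operator `L₁ δx = Φ'(x)δx − δx^k ∂_k Φ^i + δx^i div Φ`. -/
def modLin (x δx : ℝ → E' n → E' n) : ℝ → E' n → Fin n → ℝ := fun t y i =>
  eulerMap' x δx t y i
    - (∑ k, δx t y k * epd (x t) k (fun z => eulerMap x t z i) y)
    + δx t y i * ∑ k, epd (x t) k (fun z => eulerMap x t z k) y


open scoped ContDiff in
/-- Smoothness of a function in a neighbourhood of every point of the closed unit ball. -/
def Sm (u : E' n → ℝ) : Prop := ∀ y ∈ Ball n, ContDiffAt ℝ ∞ u y

lemma ContDiff.sm {u : E' n → ℝ} (h : ContDiff ℝ (⊤ : ℕ∞) u) : Sm u :=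
  fun _ _ => h.contDiffAt

lemma Sm.differentiableAt {u : E' n → ℝ} (h : Sm u) {y : E' n} (hy : y ∈ Ball n) :
    DifferentiableAt ℝ u y := (h y hy).differentiableAt (by simp)

lemma Sm.continuousOn {u : E' n → ℝ} (h : Sm u) : ContinuousOn u (Ball n) :=
  fun y hy => (h y hy).continuousAt.continuousWithinAt

lemma Sm.pd {u : E' n → ℝ} (h : Sm u) (a : Fin n) : Sm (pd a u) := fun y hy =>
  ((h y hy).fderiv_right (m := (⊤ : ℕ∞)) (by simp)).clm_apply contDiffAt_const

lemma ContDiff.pd {u : E' n → ℝ} (h : ContDiff ℝ (⊤ : ℕ∞) u) (a : Fin n) :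
    ContDiff ℝ (⊤ : ℕ∞) (pd a u) :=
  (h.fderiv_right (m := (⊤ : ℕ∞)) (by simp)).clm_apply contDiff_const

lemma Sm.add {u v : E' n → ℝ} (hu : Sm u) (hv : Sm v) : Sm (fun y => u y + v y) :=
  fun y hy => (hu y hy).add (hv y hy)

lemma Sm.sub {u v : E' n → ℝ} (hu : Sm u) (hv : Sm v) : Sm (fun y => u y - v y) :=
  fun y hy => (hu y hy).sub (hv y hy)

lemma Sm.neg {u : E' n → ℝ} (hu : Sm u) : Sm (fun y => - u y) :=
  fun y hy => (hu y hy).neg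

lemma Sm.mul {u v : E' n → ℝ} (hu : Sm u) (hv : Sm v) : Sm (fun y => u y * v y) :=
  fun y hy => (hu y hy).mul (hv y hy)

lemma Sm.sum {ι : Type*} {s : Finset ι} {u : ι → E' n → ℝ} (h : ∀ i ∈ s, Sm (u i)) :
    Sm (fun y => ∑ i ∈ s, u i y) :=
  fun y hy => ContDiffAt.sum fun i hi => h i hi y hy

lemma Sm.prod {ι : Type*} {s : Finset ι} {u : ι → E' n → ℝ} (h : ∀ i ∈ s, Sm (u i)) :
    Sm (fun y => ∏ i ∈ s, u i y) :=
  fun y hy => contDiffAt_prod fun i hi => h i hi y hy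

lemma Sm.inv {u : E' n → ℝ} (hu : Sm u) (h0 : ∀ y ∈ Ball n, u y ≠ 0) :
    Sm (fun y => (u y)⁻¹) :=
  fun y hy => (hu y hy).inv (h0 y hy)

lemma sm_const (c : ℝ) : Sm (fun _ : E' n => c) := fun _ _ => contDiffAt_const

lemma contDiff_coord (a : Fin n) : ContDiff ℝ (⊤ : ℕ∞) (fun y : E' n => y a) :=
  (EuclideanSpace.proj (𝕜 := ℝ) a).contDiff

lemma sm_coord (a : Fin n) : Sm (fun y : E' n => y a) := (contDiff_coord a).sm

lemma pd_add {u v : E' n → ℝ} {y : E' n} (hu : DifferentiableAt ℝ u y)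
    (hv : DifferentiableAt ℝ v y) (a : Fin n) :
    pd a (fun z => u z + v z) y = pd a u y + pd a v y := by
  simp [pd, fderiv_fun_add hu hv]

lemma pd_sub {u v : E' n → ℝ} {y : E' n} (hu : DifferentiableAt ℝ u y)
    (hv : DifferentiableAt ℝ v y) (a : Fin n) :
    pd a (fun z => u z - v z) y = pd a u y - pd a v y := by
  simp [pd, fderiv_fun_sub hu hv]

lemma pd_neg {u : E' n → ℝ} {y : E' n} (a : Fin n) :
    pd a (fun z => - u z) y = - pd a u y := by
  simp [pd, fderiv_fun_neg]

lemma pd_mul {u v : E' n → ℝ} {y : E' n} (hu : DifferentiableAt ℝ u y)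
    (hv : DifferentiableAt ℝ v y) (a : Fin n) :
    pd a (fun z => u z * v z) y = pd a u y * v y + u y * pd a v y := by
  simp [pd, fderiv_fun_mul hu hv]; ring

lemma pd_sum {ι : Type*} {s : Finset ι} {u : ι → E' n → ℝ} {y : E' n}
    (h : ∀ i ∈ s, DifferentiableAt ℝ (u i) y) (a : Fin n) :
    pd a (fun z => ∑ i ∈ s, u i z) y = ∑ i ∈ s, pd a (u i) y := by
  simp [pd, fderiv_fun_sum h]

lemma pd_const (c : ℝ) (y : E' n) (a : Fin n) : pd a (fun _ => c) y = 0 := by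
  simp [pd]

lemma pd_coord (a b : Fin n) (y : E' n) :
    pd a (fun z : E' n => z b) y = if a = b then 1 else 0 := by
  have : fderiv ℝ (fun z : E' n => z b) y = EuclideanSpace.proj (𝕜 := ℝ) b :=
    (EuclideanSpace.proj (𝕜 := ℝ) b).fderiv
  simp [pd, this, eq_comm]

lemma pd_inv {u : E' n → ℝ} {y : E' n} (hu : DifferentiableAt ℝ u y) (h0 : u y ≠ 0)
    (a : Fin n) :
    pd a (fun z => (u z)⁻¹) y = - ((u y)⁻¹ * (u y)⁻¹ * pd a u y) := by
  have : HasFDerivAt (fun z => (u z)⁻¹) (-((u y ^ 2)⁻¹) • fderiv ℝ u y) y :=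
    (hasDerivAt_inv h0).comp_hasFDerivAt y hu.hasFDerivAt
  simp only [pd, this.fderiv]
  simp only [_root_.smul_apply, smul_eq_mul]
  field_simp

lemma pd_comm {u : E' n → ℝ} {y : E' n} (hu : ContDiffAt ℝ (⊤ : ℕ∞) u y) (a b : Fin n) :
    pd a (pd b u) y = pd b (pd a u) y := by
  have hd : DifferentiableAt ℝ (fderiv ℝ u) y :=
    (hu.fderiv_right (m := (⊤ : ℕ∞)) (by simp)).differentiableAt (by simp)
  have key : ∀ a b : Fin n, pd a (pd b u) y =
      fderiv ℝ (fderiv ℝ u) y (EuclideanSpace.single a 1) (EuclideanSpace.single b 1) := by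
    intro a b
    change fderiv ℝ (fun z => fderiv ℝ u z (EuclideanSpace.single b 1)) y _ = _
    rw [fderiv_clm_apply hd (differentiableAt_const _)]
    simp
  rw [key, key]
  exact (hu.isSymmSndFDerivAt (by
    rw [minSmoothness_of_isRCLikeNormedField]
    exact WithTop.coe_le_coe.2 (le_top : (2 : ℕ∞) ≤ ⊤))) _ _

lemma ball_convex : Convex ℝ (Ball n) := convex_closedBall _ _

lemma ball_isCompact : IsCompact (Ball n) := isCompact_closedBall _ _

lemma zero_mem_ball : (0 : E' n) ∈ Ball n := by simp [Ball]

lemma ball_uniqueDiffOn : UniqueDiffOn ℝ (Ball n) :=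
  uniqueDiffOn_convex ball_convex
    ⟨0, by rw [Ball, interior_closedBall _ one_ne_zero]; simp⟩

lemma pd_congr_ball {u v : E' n → ℝ} (hu : Sm u) (hv : Sm v) (h : EqOn u v (Ball n))
    (a : Fin n) : EqOn (pd a u) (pd a v) (Ball n) := by
  intro y hy
  have h1 := (hu.differentiableAt hy).fderivWithin (ball_uniqueDiffOn y hy)
  have h2 := (hv.differentiableAt hy).fderivWithin (ball_uniqueDiffOn y hy)
  rw [pd, pd, ← h1, ← h2, fderivWithin_congr h (h hy)]

lemma fderiv_eq_sum_pd (u : E' n → ℝ) (y v : E' n) :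
    fderiv ℝ u y v = ∑ a, v a * pd a u y := by
  conv_lhs => rw [← (EuclideanSpace.basisFun (Fin n) ℝ).sum_repr v]
  simp [pd]

/-- `Wt k H u`: for all `j < k`, the partial derivatives of order `j` of `u` are bounded by `H j`
on the unit ball. -/
def Wt : ℕ → (ℕ → ℝ) → (E' n → ℝ) → Prop
  | 0, _, _ => True
  | k + 1, H, u => (∀ y ∈ Ball n, |u y| ≤ H 0) ∧ ∀ a, Wt k (fun j => H (j + 1)) (pd a u)

lemma Wt.mono {k : ℕ} : ∀ {H H' : ℕ → ℝ} {u : E' n → ℝ}, Wt k H u → (∀ j < k, H j ≤ H' j) →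
    Wt k H' u := by
  induction k with
  | zero => intros; trivial
  | succ k ih =>
    intro H H' u h hH
    exact ⟨fun y hy => (h.1 y hy).trans (hH 0 (by omega)),
      fun a => ih (h.2 a) fun j hj => hH (j + 1) (by omega)⟩

lemma Wt.of_le {k : ℕ} : ∀ {l : ℕ} {H : ℕ → ℝ} {u : E' n → ℝ}, Wt k H u → l ≤ k → Wt l H u := by
  induction k with
  | zero => intro l H u _ hl; obtain rfl : l = 0 := by omega
            trivial
  | succ k ih =>
    intro l H u h hl
    cases l with
    | zero => trivial
    | succ l => exact ⟨h.1, fun a => ih (h.2 a) (by omega)⟩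

lemma Wt.congr {k : ℕ} : ∀ {H : ℕ → ℝ} {u v : E' n → ℝ}, Wt k H u → Sm u → Sm v →
    EqOn u v (Ball n) → Wt k H v := by
  induction k with
  | zero => intros; trivial
  | succ k ih =>
    intro H u v h hu hv huv
    exact ⟨fun y hy => huv hy ▸ h.1 y hy,
      fun a => ih (h.2 a) (hu.pd a) (hv.pd a) (pd_congr_ball hu hv huv a)⟩

lemma Wt.add {k : ℕ} : ∀ {P Q : ℕ → ℝ} {u v : E' n → ℝ}, Wt k P u → Wt k Q v → Sm u → Sm v →
    Wt k (fun j => P j + Q j) (fun y => u y + v y) := by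
  induction k with
  | zero => intros; trivial
  | succ k ih =>
    intro P Q u v hu hv su sv
    refine ⟨fun y hy => (abs_add_le _ _).trans (add_le_add (hu.1 y hy) (hv.1 y hy)), fun a => ?_⟩
    refine (ih (hu.2 a) (hv.2 a) (su.pd a) (sv.pd a)).congr
      ((su.pd a).add (sv.pd a)) ((su.add sv).pd a) fun y hy => ?_
    exact (pd_add (su.differentiableAt hy) (sv.differentiableAt hy) a).symm

lemma Wt.neg {k : ℕ} : ∀ {P : ℕ → ℝ} {u : E' n → ℝ}, Wt k P u → Sm u →
    Wt k P (fun y => - u y) := by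
  induction k with
  | zero => intros; trivial
  | succ k ih =>
    intro P u hu su
    refine ⟨fun y hy => by rw [abs_neg]; exact hu.1 y hy, fun a => ?_⟩
    exact (ih (hu.2 a) (su.pd a)).congr (su.pd a).neg (su.neg.pd a) fun y hy => (pd_neg a).symm

lemma Wt.mul {k : ℕ} : ∀ {P Q R : ℕ → ℝ} {u v : E' n → ℝ}, Wt k P u → Wt k Q v → Sm u → Sm v →
    (∀ i, 0 ≤ P i) → (∀ i, 0 ≤ Q i) → (∀ i j, i + j < k → P i * Q j ≤ R (i + j)) →
    Wt k (fun j => 2 ^ k * R j) (fun y => u y * v y) := by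
  induction k with
  | zero => intros; trivial
  | succ k ih =>
    intro P Q R u v hu hv su sv hP hQ hR
    have h0 : P 0 * Q 0 ≤ R 0 := hR 0 0 (by omega)
    have h1 : (1 : ℝ) ≤ 2 ^ (k + 1) := one_le_pow₀ (by norm_num)
    refine ⟨fun y hy => ?_, fun a => ?_⟩
    · rw [abs_mul]
      calc |u y| * |v y| ≤ P 0 * Q 0 :=
            mul_le_mul (hu.1 y hy) (hv.1 y hy) (abs_nonneg _) (hP 0)
        _ ≤ R 0 := h0
        _ ≤ 2 ^ (k + 1) * R 0 := le_mul_of_one_le_left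
            ((mul_nonneg (hP 0) (hQ 0)).trans h0) h1
    · have e1 := ih (R := fun j => R (j + 1)) (hu.2 a) (hv.of_le (Nat.le_succ k)) (su.pd a) sv
        (fun i => hP _) hQ (fun i j hij => by
          have := hR (i + 1) j (by omega)
          rwa [show i + 1 + j = i + j + 1 by ring] at this)
      have e2 := ih (R := fun j => R (j + 1)) (hu.of_le (Nat.le_succ k)) (hv.2 a) su (sv.pd a)
        hP (fun i => hQ _) (fun i j hij => by
          have := hR i (j + 1) (by omega)
          rwa [← add_assoc] at this)
      refine ((e1.add e2 ((su.pd a).mul sv) (su.mul (sv.pd a))).congr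
        (((su.pd a).mul sv).add (su.mul (sv.pd a))) ((su.mul sv).pd a) fun y hy => ?_).mono
        fun j _ => by rw [pow_succ]; linarith
      exact (pd_mul (su.differentiableAt hy) (sv.differentiableAt hy) a).symm

/-- A family of functions whose derivatives of order `j < k` are `O(H j)`, uniformly. -/
def Bdd {ι : Type} (k : ℕ) (H : ι → ℕ → ℝ) (u : ι → E' n → ℝ) : Prop :=
  (∀ ω, Sm (u ω)) ∧ ∃ C, 0 ≤ C ∧ ∀ ω, Wt k (fun j => C * H ω j) (u ω)

/-- Compatibility of weights under multiplication, for orders `< k`. -/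
def Modl {ι : Type} (k : ℕ) (W H : ι → ℕ → ℝ) : Prop :=
  ∃ C, 0 ≤ C ∧ ∀ ω i j, i + j < k → W ω i * H ω j ≤ C * H ω (i + j)

section families

variable {ι : Type} {k : ℕ} {W H H' : ι → ℕ → ℝ} {u v : ι → E' n → ℝ}

lemma Bdd.mono (h : Bdd k H u) (hH : ∃ C, 0 ≤ C ∧ ∀ ω, ∀ j < k, H ω j ≤ C * H' ω j) :
    Bdd k H' u := by
  obtain ⟨C, hC, hu⟩ := h.2
  obtain ⟨D, hD, hH⟩ := hH
  exact ⟨h.1, C * D, mul_nonneg hC hD, fun ω => (hu ω).mono fun j hj => by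
    rw [mul_assoc]; exact mul_le_mul_of_nonneg_left (hH ω j hj) hC⟩

lemma Bdd.mono_one (h : Bdd k H u) (hH : ∀ ω, ∀ j < k, H ω j ≤ H' ω j) : Bdd k H' u :=
  h.mono ⟨1, zero_le_one, fun ω j hj => by rw [one_mul]; exact hH ω j hj⟩

lemma Bdd.of_le {l : ℕ} (h : Bdd k H u) (hl : l ≤ k) : Bdd l H u := by
  obtain ⟨C, hC, hu⟩ := h.2
  exact ⟨h.1, C, hC, fun ω => (hu ω).of_le hl⟩

lemma Bdd.congr (h : Bdd k H u) (hv : ∀ ω, Sm (v ω)) (huv : ∀ ω, EqOn (u ω) (v ω) (Ball n)) :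
    Bdd k H v := by
  obtain ⟨C, hC, hu⟩ := h.2
  exact ⟨hv, C, hC, fun ω => (hu ω).congr (h.1 ω) (hv ω) (huv ω)⟩

lemma Bdd.add (hu : Bdd k H u) (hv : Bdd k H v) : Bdd k H (fun ω y => u ω y + v ω y) := by
  obtain ⟨su, C, hC, hu⟩ := hu
  obtain ⟨sv, D, hD, hv⟩ := hv
  exact ⟨fun ω => (su ω).add (sv ω), C + D, add_nonneg hC hD, fun ω =>
    ((hu ω).add (hv ω) (su ω) (sv ω)).mono fun j _ => by rw [add_mul]⟩

lemma Bdd.neg (hu : Bdd k H u) : Bdd k H (fun ω y => - u ω y) := by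
  obtain ⟨su, C, hC, hu⟩ := hu
  exact ⟨fun ω => (su ω).neg, C, hC, fun ω => (hu ω).neg (su ω)⟩

lemma Bdd.sub (hu : Bdd k H u) (hv : Bdd k H v) : Bdd k H (fun ω y => u ω y - v ω y) := by
  simpa only [sub_eq_add_neg] using hu.add hv.neg

lemma wt_zero_fun {H : ℕ → ℝ} (hH : ∀ j, 0 ≤ H j) : Wt k H (fun _ : E' n => (0 : ℝ)) := by
  induction k generalizing H with
  | zero => trivial
  | succ k ih =>
    refine ⟨fun y _ => by simpa using hH 0, fun a => ?_⟩
    exact (ih fun j => hH (j + 1)).congr (sm_const 0) ((sm_const 0).pd a)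
      fun y _ => (pd_const 0 y a).symm

lemma bdd_const (hH : ∀ ω j, 1 ≤ H ω j) (c : ℝ) :
    Bdd k H (fun _ => fun _ : E' n => c) := by
  refine ⟨fun _ => sm_const c, |c|, abs_nonneg c, fun ω => ?_⟩
  have h0 : ∀ j, 0 ≤ |c| * H ω j := fun j =>
    mul_nonneg (abs_nonneg c) (zero_le_one.trans (hH ω j))
  cases k with
  | zero => trivial
  | succ k =>
    refine ⟨fun y _ => le_mul_of_one_le_right (abs_nonneg c) (hH ω 0), fun a => ?_⟩
    exact (wt_zero_fun fun j => h0 (j + 1)).congr (sm_const 0) ((sm_const c).pd a)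
      fun y _ => (pd_const c y a).symm

lemma Bdd.sum {α : Type*} {s : Finset α} {u : α → ι → E' n → ℝ}
    (h : ∀ i ∈ s, Bdd k H (u i)) : Bdd k H (fun ω y => ∑ i ∈ s, u i ω y) := by
  classical
  induction s using Finset.induction_on with
  | empty =>
    simp only [Finset.sum_empty]
    exact ⟨fun _ => sm_const 0, 0, le_rfl, fun ω => wt_zero_fun (fun j => by simp)⟩
  | insert i s hi ih =>
    simp only [Finset.sum_insert hi]
    exact (h i (Finset.mem_insert_self _ _)).add
      (ih fun j hj => h j (Finset.mem_insert_of_mem hj))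

lemma Bdd.mul (hu : Bdd k W u) (hv : Bdd k H v) (hW : ∀ ω j, 0 ≤ W ω j)
    (hH : ∀ ω j, 0 ≤ H ω j) (hm : Modl k W H) : Bdd k H (fun ω y => u ω y * v ω y) := by
  obtain ⟨su, C, hC, hu⟩ := hu
  obtain ⟨sv, D, hD, hv⟩ := hv
  obtain ⟨A, hA, hm⟩ := hm
  refine ⟨fun ω => (su ω).mul (sv ω), 2 ^ k * (C * D * A), by positivity, fun ω => ?_⟩
  refine (Wt.mul (R := fun j => C * D * A * H ω j) (hu ω) (hv ω) (su ω) (sv ω)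
    (fun i => mul_nonneg hC (hW ω i)) (fun i => mul_nonneg hD (hH ω i))
    fun i j hij => ?_).mono fun j _ => le_of_eq (by ring)
  have := mul_le_mul_of_nonneg_left (hm ω i j hij) (mul_nonneg hC hD)
  linarith

lemma Bdd.pd (h : Bdd (k + 1) H u) (a : Fin n) :
    Bdd k (fun ω j => H ω (j + 1)) (fun ω => pd a (u ω)) := by
  obtain ⟨su, C, hC, hu⟩ := h
  exact ⟨fun ω => (su ω).pd a, C, hC, fun ω => (hu ω).2 a⟩

lemma Bdd.succ (h0 : Bdd 1 H u) (hH : ∀ ω j, 0 ≤ H ω j)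
    (h : ∀ a, Bdd k (fun ω j => H ω (j + 1)) (fun ω => _root_.pd a (u ω))) :
    Bdd (k + 1) H u := by
  obtain ⟨su, C, hC, hu⟩ := h0
  choose D hD hd using fun a => (h a).2
  have hle : ∀ a, D a ≤ ∑ b, D b := fun a =>
    Finset.single_le_sum (fun b _ => hD b) (Finset.mem_univ a)
  have hS : 0 ≤ ∑ b, D b := Finset.sum_nonneg fun b _ => hD b
  refine ⟨su, C + ∑ b, D b, add_nonneg hC hS, fun ω => ⟨fun y hy => ?_, fun a => ?_⟩⟩
  · exact ((hu ω).1 y hy).trans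
      (mul_le_mul_of_nonneg_right (le_add_of_nonneg_right hS) (hH ω 0))
  · exact (hd a ω).mono fun j _ =>
      mul_le_mul_of_nonneg_right ((hle a).trans (le_add_of_nonneg_left hC)) (hH ω _)

lemma bdd_one_of_le (su : ∀ ω, Sm (u ω)) {C : ℝ} (hC : 0 ≤ C)
    (h : ∀ ω, ∀ y ∈ Ball n, |u ω y| ≤ C * H ω 0) : Bdd 1 H u :=
  ⟨su, C, hC, fun ω => ⟨h ω, fun _ => trivial⟩⟩

lemma Bdd.bound (h : Bdd (k + 1) H u) :
    ∃ C, 0 ≤ C ∧ ∀ ω, ∀ y ∈ Ball n, |u ω y| ≤ C * H ω 0 := by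
  obtain ⟨-, C, hC, hu⟩ := h
  exact ⟨C, hC, fun ω => (hu ω).1⟩

lemma Bdd.comp {κ : Type} (h : Bdd k H u) (f : κ → ι) :
    Bdd k (fun ω => H (f ω)) (fun ω => u (f ω)) := by
  obtain ⟨su, C, hC, hu⟩ := h
  exact ⟨fun ω => su _, C, hC, fun ω => hu _⟩

/-- A family of submultiplicative weights. -/
structure GoodW (W : ι → ℕ → ℝ) : Prop where
  one_le : ∀ ω j, 1 ≤ W ω j
  mono : ∀ ω, Monotone (W ω)
  modl : ∀ k, Modl k W W

lemma GoodW.nonneg (hW : GoodW W) (ω : ι) (j : ℕ) : 0 ≤ W ω j :=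
  zero_le_one.trans (hW.one_le ω j)

/-- Families which are `O(W)` to all orders. -/
def Tame (W : ι → ℕ → ℝ) (u : ι → E' n → ℝ) : Prop := ∀ k, Bdd k W u

lemma Tame.sm (h : Tame W u) (ω : ι) : Sm (u ω) := (h 0).1 ω

lemma Tame.add (hu : Tame W u) (hv : Tame W v) : Tame W (fun ω y => u ω y + v ω y) :=
  fun k => (hu k).add (hv k)

lemma Tame.neg (hu : Tame W u) : Tame W (fun ω y => - u ω y) := fun k => (hu k).neg

lemma Tame.sub (hu : Tame W u) (hv : Tame W v) : Tame W (fun ω y => u ω y - v ω y) :=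
  fun k => (hu k).sub (hv k)

lemma Tame.sum {α : Type*} {s : Finset α} {u : α → ι → E' n → ℝ}
    (h : ∀ i ∈ s, Tame W (u i)) : Tame W (fun ω y => ∑ i ∈ s, u i ω y) :=
  fun k => Bdd.sum fun i hi => h i hi k

lemma Tame.mul (hW : GoodW W) (hu : Tame W u) (hv : Tame W v) :
    Tame W (fun ω y => u ω y * v ω y) :=
  fun k => (hu k).mul (hv k) hW.nonneg hW.nonneg (hW.modl k)

lemma Tame.const (hW : GoodW W) (c : ℝ) : Tame W (fun _ => fun _ : E' n => c) :=
  fun _ => bdd_const hW.one_le c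

lemma Tame.coord (hW : GoodW W) (a : Fin n) : Tame W (fun _ => fun y : E' n => y a) := by
  intro k
  refine Bdd.of_le (k := k + 1) ?_ (Nat.le_succ k)
  refine Bdd.succ (bdd_one_of_le (fun _ => sm_coord a) zero_le_one fun ω y hy => ?_) hW.nonneg
    fun b => ?_
  · have h1 : |y a| ≤ ‖y‖ := by simpa using PiLp.norm_apply_le y a
    have h2 : ‖y‖ ≤ 1 := by simpa [Ball] using hy
    have := hW.one_le ω 0
    linarith
  · refine (bdd_const (fun ω j => hW.one_le ω (j + 1)) (if b = a then 1 else 0)).congr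
      (fun _ => (sm_coord a).pd b) fun ω y _ => (pd_coord b a y).symm

lemma Tame.congr (h : Tame W u) (hv : ∀ ω, Sm (v ω)) (huv : ∀ ω, EqOn (u ω) (v ω) (Ball n)) :
    Tame W v := fun k => (h k).congr hv huv

end families

open Filter Topology in
/-- First and second order conditions at a local maximum on the line. -/
lemma IsLocalMax.hasDerivAt_second_order {g g' : ℝ → ℝ} {c : ℝ}
    (hg : ∀ᶠ s in 𝓝 (0 : ℝ), HasDerivAt g (g' s) s) (hg' : HasDerivAt g' c 0)
    (hmax : IsLocalMax g 0) : g' 0 = 0 ∧ c ≤ 0 := by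
  have h0 : g' 0 = 0 := hmax.hasDerivAt_eq_zero hg.self_of_nhds
  refine ⟨h0, not_lt.1 fun hc => ?_⟩
  have hd : deriv g =ᶠ[𝓝 0] g' := hg.mono fun s hs => hs.deriv
  have hmin : IsLocalMin g 0 := by
    refine isLocalMin_of_deriv_deriv_pos ?_ ?_ hg.self_of_nhds.continuousAt
    · rw [hd.deriv_eq, hg'.deriv]; exact hc
    · rw [hd.self_of_nhds, h0]
  have hconst : ∀ᶠ s in 𝓝 (0 : ℝ), g s = g 0 := by
    filter_upwards [hmax, hmin] with s h1 h2 using le_antisymm h1 h2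
  have hz : g' =ᶠ[𝓝 0] fun _ => (0 : ℝ) := by
    filter_upwards [hconst.eventually_nhds, hd] with s hs hds
    have : g =ᶠ[𝓝 s] fun _ => g 0 := hs
    rw [← hds, this.deriv_eq, deriv_const]
  have : c = 0 := by
    rw [← hg'.deriv, hz.deriv_eq, deriv_const]
  exact absurd this (ne_of_gt hc)

/-- The second derivative of `u` as a bilinear form. -/
def D2 (u : E' n → ℝ) (y v w : E' n) : ℝ := fderiv ℝ (fderiv ℝ u) y v w

section line

variable {u : E' n → ℝ}

lemma ContDiff.hasDerivAt_line (hu : ContDiff ℝ (⊤ : ℕ∞) u) (y v : E' n) (s : ℝ) :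
    HasDerivAt (fun s : ℝ => u (y + s • v)) (fderiv ℝ u (y + s • v) v) s := by
  have h1 : HasDerivAt (fun s : ℝ => y + s • v) v s := by
    simpa using ((hasDerivAt_id s).smul_const v).const_add y
  exact ((hu.differentiable (by simp)) (y + s • v)).hasFDerivAt.comp_hasDerivAt s h1

lemma ContDiff.hasDerivAt_line_fderiv (hu : ContDiff ℝ (⊤ : ℕ∞) u) (y v : E' n) :
    HasDerivAt (fun s : ℝ => fderiv ℝ u (y + s • v) v) (D2 u y v v) 0 := by
  have h1 : HasDerivAt (fun s : ℝ => y + s • v) v 0 := by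
    simpa using ((hasDerivAt_id (0 : ℝ)).smul_const v).const_add y
  have h2 : HasFDerivAt (fderiv ℝ u) (fderiv ℝ (fderiv ℝ u) y) (y + (0 : ℝ) • v) := by
    rw [zero_smul, add_zero]
    exact ((hu.fderiv_right (m := (⊤ : ℕ∞)) (by simp)).differentiable (by simp) y).hasFDerivAt
  have h3 : HasDerivAt (fun s : ℝ => fderiv ℝ u (y + s • v)) (fderiv ℝ (fderiv ℝ u) y v) 0 :=
    h2.comp_hasDerivAt (0 : ℝ) h1
  exact (ContinuousLinearMap.apply ℝ ℝ v).hasFDerivAt.comp_hasDerivAt (0 : ℝ) h3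

open Filter Topology in
lemma ContDiff.line_test (hu : ContDiff ℝ (⊤ : ℕ∞) u) {y v : E' n} {w w' : ℝ → ℝ}
    {c : ℝ}
    (hw : ∀ s, HasDerivAt w (w' s) s) (hw' : HasDerivAt w' c 0)
    (hmax : IsLocalMax (fun s : ℝ => u (y + s • v) - w s) 0) :
    fderiv ℝ u y v = w' 0 ∧ D2 u y v v ≤ c := by
  have := IsLocalMax.hasDerivAt_second_order
    (Eventually.of_forall fun s => (hu.hasDerivAt_line y v s).sub (hw s))
    ((hu.hasDerivAt_line_fderiv y v).sub hw') hmax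
  simp only [zero_smul, add_zero] at this
  exact ⟨by linarith [this.1], by linarith [this.2]⟩

lemma sum_D2_apply {α : Type*} [Fintype α] (y : E' n) (w : α → ℝ) (s : α → E' n) (v : E' n) :
    ∑ i, w i * D2 u y (s i) v = D2 u y (∑ i, w i • s i) v := by
  simp [D2]

lemma ContDiff.D2_symm (hu : ContDiff ℝ (⊤ : ℕ∞) u) (y v w : E' n) :
    D2 u y v w = D2 u y w v := by
  refine (hu.contDiffAt.isSymmSndFDerivAt ?_) _ _
  rw [minSmoothness_of_isRCLikeNormedField]
  exact WithTop.coe_le_coe.2 (le_top : (2 : ℕ∞) ≤ ⊤)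

end line

/-- The operator `Σ_i D²u(s_i, s_i) + Du(b)`. -/
def Lv (s : Fin n → E' n → E' n) (b : E' n → E' n) (u : E' n → ℝ) (y : E' n) : ℝ :=
  ∑ i, D2 u y (s i y) (s i y) + fderiv ℝ u y (b y)

lemma Lv_neg (s : Fin n → E' n → E' n) (b : E' n → E' n) (u : E' n → ℝ) (y : E' n) :
    Lv s b (fun z => - u z) y = - Lv s b u y := by
  have h : fderiv ℝ (fun z => - u z) = fun z => - fderiv ℝ u z := by
    ext1 z; exact fderiv_fun_neg
  simp only [Lv, D2, h, fderiv_fun_neg, _root_.neg_apply, Finset.sum_neg_distrib]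
  ring

lemma mem_ball_iff {y : E' n} : y ∈ Ball n ↔ ‖y‖ ≤ 1 := by simp [Ball]

lemma mem_sphere_iff {y : E' n} : y ∈ Sphere' n ↔ ‖y‖ = 1 := by simp [Sphere']

open Filter Topology in
lemma eventually_mem_ball {y : E' n} (h : ‖y‖ < 1) : ∀ᶠ z in 𝓝 y, z ∈ Ball n := by
  have : {z : E' n | ‖z‖ < 1} ∈ 𝓝 y := (isOpen_lt continuous_norm continuous_const).mem_nhds h
  filter_upwards [this] with z hz using mem_ball_iff.2 (le_of_lt hz)

open Filter Topology in
lemma tendsto_line (y v : E' n) : Tendsto (fun s : ℝ => y + s • v) (𝓝 0) (𝓝 y) := by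
  have : Continuous fun s : ℝ => y + s • v := by fun_prop
  simpa using this.tendsto 0

open Filter Topology in
/-- One-sided sup bound via an exponential barrier. -/
lemma sup_bound_of_Lv {lam B : ℝ} (hl : 0 < lam) (hB : 0 ≤ B) (hn : 0 < n) :
    ∃ C, 0 ≤ C ∧ ∀ (s : Fin n → E' n → E' n) (b : E' n → E' n) (u : E' n → ℝ) (N : ℝ), 0 ≤ N →
      (∀ y ∈ Ball n, ∀ ξ : E' n, lam * ‖ξ‖ ^ 2 ≤ ∑ i, inner ℝ (s i y) ξ ^ 2) →
      (∀ y ∈ Ball n, ‖b y‖ ≤ B) → ContDiff ℝ (⊤ : ℕ∞) u → (∀ y ∈ Sphere' n, u y = 0) →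
      (∀ y ∈ Ball n, - N ≤ Lv s b u y) → ∀ y ∈ Ball n, u y ≤ C * N := by
  set μ : ℝ := (B + 1) / lam with hμ
  have hμ0 : 0 < μ := by positivity
  have hμl : μ * lam = B + 1 := by rw [hμ]; field_simp
  refine ⟨Real.exp μ / μ * Real.exp μ, by positivity, ?_⟩
  intro s b u N hN hell hb hu hbd hL z hz
  set e : E' n := EuclideanSpace.single ⟨0, hn⟩ 1 with he
  have hen : ‖e‖ = 1 := by simp [he]
  have hyb : ∀ y ∈ Ball n, |inner ℝ e y| ≤ 1 := fun y hy => by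
    have := abs_real_inner_le_norm e y
    rw [hen, one_mul] at this
    exact this.trans (mem_ball_iff.1 hy)
  suffices H : ∀ A, Real.exp μ / μ * N < A → u z ≤ A * Real.exp μ by
    have : u z / Real.exp μ ≤ Real.exp μ / μ * N :=
      le_of_forall_gt_imp_ge_of_dense fun A hA => by
        rw [div_le_iff₀ (Real.exp_pos _)]; exact H A hA
    rw [div_le_iff₀ (Real.exp_pos _)] at this
    linarith
  intro A hA
  have hA0 : 0 < A := lt_of_le_of_lt (by positivity) hA
  set w : E' n → ℝ := fun y => A * (Real.exp μ - Real.exp (μ * inner ℝ e y)) with hw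
  have hcw : Continuous w := by fun_prop
  have hw0 : ∀ y ∈ Ball n, 0 ≤ w y := fun y hy => by
    have h1 : μ * inner ℝ e y ≤ μ := by
      have := (abs_le.1 (hyb y hy)).2
      nlinarith
    have := Real.exp_le_exp.2 h1
    exact mul_nonneg hA0.le (by linarith)
  have hwz : w z ≤ A * Real.exp μ :=
    mul_le_mul_of_nonneg_left (by linarith [Real.exp_pos (μ * inner ℝ e z)]) hA0.le
  suffices H : u z - w z ≤ 0 by linarith
  obtain ⟨y, hy, hmax⟩ := ball_isCompact.exists_isMaxOn ⟨z, hz⟩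
    ((hu.continuous.sub hcw).continuousOn (s := Ball n))
  refine (hmax hz).trans ?_
  change u y - w y ≤ 0
  rcases (mem_ball_iff.1 hy).lt_or_eq with hlt | heq
  swap
  · rw [hbd y (mem_sphere_iff.2 heq)]; linarith [hw0 y hy]
  exfalso
  have hloc : ∀ v : E' n, IsLocalMax (fun t : ℝ => u (y + t • v) - w (y + t • v)) 0 := by
    intro v
    filter_upwards [(tendsto_line y v).eventually (eventually_mem_ball hlt)] with t ht
    simpa using hmax ht
  set E : ℝ := Real.exp (μ * inner ℝ e y) with hE
  have hE0 : 0 < E := Real.exp_pos _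
  have key : ∀ v : E' n, fderiv ℝ u y v = - (A * (μ * inner ℝ e v * E)) ∧
      D2 u y v v ≤ - (A * (μ ^ 2 * inner ℝ e v ^ 2 * E)) := by
    intro v
    have hlin : ∀ t : ℝ, HasDerivAt (fun t : ℝ => μ * inner ℝ e (y + t • v)) (μ * inner ℝ e v) t := by
      intro t
      simp only [inner_add_right, inner_smul_right]
      simpa using (((hasDerivAt_id t).mul_const (inner ℝ e v)).const_add (inner ℝ e y)).const_mul μ
    have h1 : ∀ t : ℝ, HasDerivAt (fun t : ℝ => w (y + t • v))
        (A * (-(Real.exp (μ * inner ℝ e (y + t • v)) * (μ * inner ℝ e v)))) t := fun t =>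
      ((hlin t).exp.const_sub _).const_mul A
    have h2 : HasDerivAt (fun t : ℝ => A * (-(Real.exp (μ * inner ℝ e (y + t • v)) * (μ * inner ℝ e v))))
        (A * (-(Real.exp (μ * inner ℝ e (y + (0 : ℝ) • v)) * (μ * inner ℝ e v) * (μ * inner ℝ e v)))) 0 :=
      (((hlin 0).exp.mul_const _).neg).const_mul A
    have := hu.line_test h1 h2 (hloc v)
    simp only [zero_smul, add_zero] at this
    refine ⟨this.1.trans (by ring), this.2.trans (le_of_eq (by ring))⟩
  have hsum : ∑ i, D2 u y (s i y) (s i y) ≤ - (A * (μ ^ 2 * E * lam)) := by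
    calc ∑ i, D2 u y (s i y) (s i y)
        ≤ ∑ i, - (A * (μ ^ 2 * inner ℝ e (s i y) ^ 2 * E)) :=
          Finset.sum_le_sum fun i _ => (key _).2
      _ = - (A * (μ ^ 2 * E)) * ∑ i, inner ℝ (s i y) e ^ 2 := by
          rw [Finset.mul_sum]
          refine Finset.sum_congr rfl fun i _ => ?_
          rw [real_inner_comm]; ring
      _ ≤ - (A * (μ ^ 2 * E)) * lam := by
          have := hell y hy e
          rw [hen] at this
          have h2 : 0 ≤ A * (μ ^ 2 * E) := by positivity
          nlinarith
      _ = _ := by ring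
  have hbt : fderiv ℝ u y (b y) ≤ A * (μ * B * E) := by
    rw [(key _).1]
    have h1 : - inner ℝ e (b y) ≤ B := by
      have := abs_real_inner_le_norm e (b y)
      rw [hen, one_mul] at this
      exact ((neg_le_abs _).trans this).trans (hb y hy)
    have h2 : 0 ≤ A * (μ * E) := by positivity
    nlinarith
  have hE1 : Real.exp (-μ) ≤ E := by
    refine Real.exp_le_exp.2 ?_
    have := (abs_le.1 (hyb y hy)).1
    nlinarith
  have htot : Lv s b u y ≤ - (A * μ * E) := by
    have : A * (μ ^ 2 * E * lam) = A * μ * E * (B + 1) := by rw [← hμl]; ring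
    rw [Lv]; nlinarith
  have hfin : N < A * μ * E := by
    have h1 : N < A * μ * Real.exp (-μ) := by
      rw [Real.exp_neg, ← div_eq_mul_inv, lt_div_iff₀ (Real.exp_pos _)]
      have := mul_lt_mul_of_pos_right hA hμ0
      have h2 : Real.exp μ / μ * N * μ = N * Real.exp μ := by field_simp
      linarith
    exact h1.trans_le (mul_le_mul_of_nonneg_left hE1 (by positivity))
  linarith [hL y hy]

open Filter Topology in
/-- Boundary barrier: `u` is controlled by the distance to the sphere. -/
lemma boundary_bound_of_Lv {lam B : ℝ} (hl : 0 < lam) {δ N U A : ℝ} (hδ : 0 < δ)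
    (hδ4 : δ ≤ 1 / 4) (hδB : B ≤ lam / (4 * δ)) (hN : 0 ≤ N) (hAU : U ≤ A * δ / 2)
    (hAN : N < A * lam / (4 * δ))
    {s : Fin n → E' n → E' n} {b : E' n → E' n} {u : E' n → ℝ}
    (hell : ∀ y ∈ Ball n, ∀ ξ : E' n, lam * ‖ξ‖ ^ 2 ≤ ∑ i, inner ℝ (s i y) ξ ^ 2)
    (hb : ∀ y ∈ Ball n, ‖b y‖ ≤ B) (hu : ContDiff ℝ (⊤ : ℕ∞) u) (hbd : ∀ y ∈ Sphere' n, u y = 0)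
    (hL : ∀ y ∈ Ball n, - N ≤ Lv s b u y) (hU : ∀ y ∈ Ball n, u y ≤ U) :
    ∀ y ∈ Ball n, u y ≤ A * (1 - ‖y‖) := by
  intro z hz
  have hA0 : 0 < A := by
    have h1 : 0 < A * lam / (4 * δ) := lt_of_le_of_lt hN hAN
    have h2 : A = A * lam / (4 * δ) * (4 * δ) / lam := by field_simp
    rw [h2]; positivity
  set ρ : E' n → ℝ := fun y => (1 - ‖y‖ ^ 2) / 2 with hρ
  have hρz : ρ z ≤ 1 - ‖z‖ := by
    have := mem_ball_iff.1 hz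
    simp only [hρ]; nlinarith
  have hρ0 : ∀ y ∈ Ball n, 0 ≤ ρ y := fun y hy => by
    have := mem_ball_iff.1 hy
    have := norm_nonneg y
    simp only [hρ]; nlinarith
  by_cases hzδ : δ < ρ z
  · have := hU z hz
    nlinarith
  push Not at hzδ
  set w : E' n → ℝ := fun y => A * (ρ y - ρ y ^ 2 / (2 * δ)) with hw
  have hwz : w z ≤ A * (1 - ‖z‖) := by
    refine mul_le_mul_of_nonneg_left ?_ hA0.le
    have : 0 ≤ ρ z ^ 2 / (2 * δ) := by positivity
    linarith
  have hcρ : Continuous ρ := by fun_prop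
  have hcw : Continuous w := by fun_prop
  set R : Set (E' n) := Ball n ∩ {y | ρ y ≤ δ} with hR
  have hRc : IsCompact R := ball_isCompact.inter_right (isClosed_le hcρ continuous_const)
  obtain ⟨y, ⟨hy, hyδ⟩, hmax⟩ := hRc.exists_isMaxOn ⟨z, hz, hzδ⟩
    ((hu.continuous.sub hcw).continuousOn (s := R))
  suffices H : u y - w y ≤ 0 by
    have h1 : u z - w z ≤ u y - w y := hmax ⟨hz, hzδ⟩
    linarith
  rcases (mem_ball_iff.1 hy).lt_or_eq with hlt | heq
  swap
  · rw [hbd y (mem_sphere_iff.2 heq)]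
    have : ρ y = 0 := by simp [hρ, heq]
    simp [hw, this]
  rcases (show ρ y ≤ δ from hyδ).lt_or_eq with hltδ | heqδ
  swap
  · have : w y = A * δ / 2 := by
      simp only [hw, heqδ]; field_simp; ring
    linarith [hU y hy]
  exfalso
  have hloc : ∀ v : E' n, IsLocalMax (fun t : ℝ => u (y + t • v) - w (y + t • v)) 0 := by
    intro v
    have h2 : ∀ᶠ x in 𝓝 y, ρ x < δ := hcρ.continuousAt.eventually_lt continuousAt_const hltδ
    filter_upwards [(tendsto_line y v).eventually (eventually_mem_ball hlt),
      (tendsto_line y v).eventually h2] with t ht ht2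
    simpa using hmax ⟨ht, le_of_lt ht2⟩
  have hρy := hρ0 y hy
  set θ : ℝ := 1 - ρ y / δ with hθ
  have hθ0 : 0 ≤ θ := by
    have : ρ y / δ ≤ 1 := (div_le_one hδ).2 hltδ.le
    linarith
  have hθ1 : θ ≤ 1 := by
    have : 0 ≤ ρ y / δ := by positivity
    linarith
  have key : ∀ v : E' n, fderiv ℝ u y v = - (A * θ * inner ℝ y v) ∧
      D2 u y v v ≤ A * (-(θ * ‖v‖ ^ 2) - inner ℝ y v ^ 2 / δ) := by
    intro v
    have hρl : ∀ t : ℝ, ρ (y + t • v) = (1 - (‖y‖ ^ 2 + 2 * t * inner ℝ y v + t ^ 2 * ‖v‖ ^ 2)) / 2 := by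
      intro t
      simp only [hρ, norm_add_sq_real, inner_smul_right, norm_smul, mul_pow, Real.norm_eq_abs,
        sq_abs]
      ring
    have hρd : ∀ t : ℝ, HasDerivAt (fun t : ℝ => ρ (y + t • v)) (-(inner ℝ y v + t * ‖v‖ ^ 2)) t := by
      intro t
      simp only [hρl]
      have h1 := (((hasDerivAt_id t).const_mul 2).mul_const (inner ℝ y v)).const_add (‖y‖ ^ 2)
      have h2 := (((hasDerivAt_id t).pow 2).mul_const (‖v‖ ^ 2))
      refine (((h1.add h2).const_sub 1).div_const 2).congr_deriv ?_
      simp; ring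
    have h1 : ∀ t : ℝ, HasDerivAt (fun t : ℝ => w (y + t • v))
        (A * (-(inner ℝ y v + t * ‖v‖ ^ 2) * (1 - ρ (y + t • v) / δ))) t := by
      intro t
      refine (((hρd t).sub (((hρd t).pow 2).div_const (2 * δ))).const_mul A).congr_deriv ?_
      field_simp; simp; ring
    have h2 : HasDerivAt (fun t : ℝ => A * (-(inner ℝ y v + t * ‖v‖ ^ 2) * (1 - ρ (y + t • v) / δ)))
        (A * (-(θ * ‖v‖ ^ 2) - inner ℝ y v ^ 2 / δ)) 0 := by
      have h3 : HasDerivAt (fun t : ℝ => -(inner ℝ y v + t * ‖v‖ ^ 2)) (-‖v‖ ^ 2) 0 := by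
        refine ((((hasDerivAt_id (0 : ℝ)).mul_const (‖v‖ ^ 2)).const_add
          (inner ℝ y v)).fun_neg).congr_deriv (by simp)
      refine ((h3.mul (((hρd 0).div_const δ).const_sub 1)).const_mul A).congr_deriv ?_
      simp only [zero_smul, add_zero, zero_mul, hθ]
      ring
    have := hu.line_test h1 h2 (hloc v)
    simp only [zero_smul, add_zero, zero_mul] at this
    exact ⟨this.1.trans (by simp only [hθ]; ring), this.2⟩
  have hyhalf : 1 / 2 ≤ ‖y‖ ^ 2 := by
    have : ρ y ≤ 1 / 4 := hltδ.le.trans hδ4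
    simp only [hρ] at this; linarith
  have hsum : ∑ i, D2 u y (s i y) (s i y) ≤ - (A / δ * (lam / 2)) := by
    calc ∑ i, D2 u y (s i y) (s i y)
        ≤ ∑ i, - (A / δ) * inner ℝ (s i y) y ^ 2 := by
          refine Finset.sum_le_sum fun i _ => (key _).2.trans ?_
          rw [real_inner_comm (s i y) y]
          have : 0 ≤ A * (θ * ‖s i y‖ ^ 2) := by positivity
          have h2 : A * (inner ℝ (s i y) y ^ 2 / δ) = A / δ * inner ℝ (s i y) y ^ 2 := by ring
          nlinarith
      _ = - (A / δ) * ∑ i, inner ℝ (s i y) y ^ 2 := by rw [Finset.mul_sum]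
      _ ≤ - (A / δ * (lam / 2)) := by
          have h1 := hell y hy y
          have h2 : 0 < A / δ := by positivity
          have h3 : lam / 2 ≤ ∑ i, inner ℝ (s i y) y ^ 2 := by nlinarith
          nlinarith
  have hbt : fderiv ℝ u y (b y) ≤ A * B := by
    rw [(key _).1]
    have h1 : - inner ℝ y (b y) ≤ B := by
      have h2 := abs_real_inner_le_norm y (b y)
      have h3 : ‖y‖ * ‖b y‖ ≤ 1 * B := mul_le_mul hlt.le (hb y hy) (norm_nonneg _) zero_le_one
      linarith [neg_le_abs (inner ℝ y (b y))]
    have hB : 0 ≤ B := (norm_nonneg _).trans (hb y hy)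
    have h2 : θ * (- inner ℝ y (b y)) ≤ B := by
      nlinarith
    nlinarith
  have htot : Lv s b u y ≤ - (A * lam / (4 * δ)) := by
    have h1 : A * B ≤ A * (lam / (4 * δ)) := mul_le_mul_of_nonneg_left hδB hA0.le
    have h2 : A / δ * (lam / 2) = 2 * (A * (lam / (4 * δ))) := by field_simp; ring
    have h3 : A * lam / (4 * δ) = A * (lam / (4 * δ)) := by ring
    rw [Lv]; linarith
  linarith [hL y hy]

open Filter Topology in
/-- First and second order conditions for `u(y) - u(z) - A (|y - z| - |y - z|² / (4δ))` at an
interior maximum off the diagonal. -/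
lemma pair_test_of_contDiff {u : E' n → ℝ} (hu : ContDiff ℝ (⊤ : ℕ∞) u) {A δ : ℝ} {y z : E' n}
    (hyz : y - z ≠ 0)
    (hmax : IsLocalMax (fun p : E' n × E' n =>
      u p.1 - u p.2 - A * (‖p.1 - p.2‖ - ‖p.1 - p.2‖ ^ 2 / (4 * δ))) (y, z)) (ξ η : E' n) :
    fderiv ℝ u y ξ - fderiv ℝ u z η = A * (inner ℝ (y - z) (ξ - η) / ‖y - z‖
        - inner ℝ (y - z) (ξ - η) / (2 * δ)) ∧
    D2 u y ξ ξ - D2 u z η η ≤ A * ((‖ξ - η‖ ^ 2 - (inner ℝ (y - z) (ξ - η) / ‖y - z‖) ^ 2) / ‖y - z‖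
        - ‖ξ - η‖ ^ 2 / (2 * δ)) := by
  set h := y - z with hh
  set k := ξ - η with hk
  have hn : 0 < ‖h‖ := norm_pos_iff.2 hyz
  set q : ℝ → ℝ := fun t => ‖h‖ ^ 2 + 2 * t * inner ℝ h k + t ^ 2 * ‖k‖ ^ 2 with hq
  have hqn : ∀ t : ℝ, ‖(y + t • ξ) - (z + t • η)‖ ^ 2 = q t := by
    intro t
    have : (y + t • ξ) - (z + t • η) = h + t • k := by rw [hh, hk, smul_sub]; abel
    rw [this]
    simp only [hq, norm_add_sq_real, inner_smul_right, norm_smul, mul_pow, Real.norm_eq_abs, sq_abs]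
    ring
  have hqs : ∀ t : ℝ, ‖(y + t • ξ) - (z + t • η)‖ = √(q t) := by
    intro t; rw [← hqn, Real.sqrt_sq (norm_nonneg _)]
  have hq0 : √(q 0) = ‖h‖ := by simp [hq]
  have hqd : ∀ t, HasDerivAt q (2 * (inner ℝ h k + t * ‖k‖ ^ 2)) t := by
    intro t
    have h1 := (((hasDerivAt_id t).const_mul 2).mul_const (inner ℝ h k)).const_add (‖h‖ ^ 2)
    have h2 := (((hasDerivAt_id t).pow 2).mul_const (‖k‖ ^ 2))
    refine (h1.add h2).congr_deriv ?_
    simp; ring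
  have hqpos : ∀ᶠ t in 𝓝 (0 : ℝ), 0 < q t :=
    (hqd 0).continuousAt.eventually (lt_mem_nhds (by simp only [hq]; simp; positivity))
  have hsd : ∀ t, 0 < q t → HasDerivAt (fun t => √(q t)) ((inner ℝ h k + t * ‖k‖ ^ 2) / √(q t)) t := by
    intro t ht
    have h1 := Real.sqrt_pos.2 ht
    refine ((hqd t).sqrt ht.ne').congr_deriv ?_
    field_simp
  set g : ℝ → ℝ := fun t => u (y + t • ξ) - u (z + t • η) - A * (√(q t) - q t / (4 * δ)) with hg
  set g' : ℝ → ℝ := fun t => fderiv ℝ u (y + t • ξ) ξ - fderiv ℝ u (z + t • η) η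
    - A * ((inner ℝ h k + t * ‖k‖ ^ 2) / √(q t) - 2 * (inner ℝ h k + t * ‖k‖ ^ 2) / (4 * δ)) with hg'
  have hgd : ∀ᶠ t in 𝓝 (0 : ℝ), HasDerivAt g (g' t) t := by
    filter_upwards [hqpos] with t ht
    exact ((hu.hasDerivAt_line y ξ t).sub (hu.hasDerivAt_line z η t)).sub
      (((hsd t ht).sub ((hqd t).div_const _)).const_mul A)
  have hlind : HasDerivAt (fun t : ℝ => inner ℝ h k + t * ‖k‖ ^ 2) (‖k‖ ^ 2) 0 := by
    simpa using (((hasDerivAt_id (0 : ℝ)).mul_const (‖k‖ ^ 2)).const_add (inner ℝ h k))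
  have hg'd := ((hu.hasDerivAt_line_fderiv y ξ).sub (hu.hasDerivAt_line_fderiv z η)).sub
      (((hlind.div (hsd 0 hqpos.self_of_nhds) (by rw [hq0]; exact hn.ne')).sub
        ((hlind.const_mul 2).div_const (4 * δ))).const_mul A)
  have hloc : IsLocalMax g 0 := by
    have ht : Tendsto (fun t : ℝ => (y + t • ξ, z + t • η)) (𝓝 0) (𝓝 (y, z)) :=
      (tendsto_line y ξ).prodMk_nhds (tendsto_line z η)
    filter_upwards [ht.eventually hmax] with t ht
    simp only [hqs] at ht
    have e0 : g 0 = u y - u z - A * (‖y - z‖ - ‖y - z‖ ^ 2 / (4 * δ)) := by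
      simp [hg, hq, ← hh]
    rw [e0]
    refine le_trans (le_of_eq ?_) ht
    simp only [hg]
    rw [← hqs t, ← hqn t]
  have res := IsLocalMax.hasDerivAt_second_order hgd hg'd hloc
  simp only [hg', hq0, zero_smul, add_zero, zero_mul] at res
  refine ⟨?_, ?_⟩
  · have := res.1
    have h2 : 2 * inner ℝ h k / (4 * δ) = inner ℝ h k / (2 * δ) := by
      rw [show (4 : ℝ) * δ = 2 * (2 * δ) by ring, mul_div_mul_left _ _ two_ne_zero]
    rw [h2] at this
    linarith
  · have := res.2
    have h2 : 2 * ‖k‖ ^ 2 / (4 * δ) = ‖k‖ ^ 2 / (2 * δ) := by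
      rw [show (4 : ℝ) * δ = 2 * (2 * δ) by ring, mul_div_mul_left _ _ two_ne_zero]
    rw [h2] at this
    have h3 : (‖k‖ ^ 2 * ‖h‖ - inner ℝ h k * (inner ℝ h k / ‖h‖)) / ‖h‖ ^ 2 =
        (‖k‖ ^ 2 - (inner ℝ h k / ‖h‖) ^ 2) / ‖h‖ := by field_simp
    rw [h3] at this
    linarith

/-- The trace of `D²u` is unchanged under a reflection of the coefficients. -/
lemma sum_D2_reflect {u : E' n → ℝ} (hu : ContDiff ℝ (⊤ : ℕ∞) u) (z : E' n) (s : Fin n → E' n)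
    (w : Fin n → ℝ) (hw : ∑ i, w i ^ 2 = 1) :
    ∑ i, D2 u z (s i - (2 * w i) • ∑ j, w j • s j) (s i - (2 * w i) • ∑ j, w j • s j)
      = ∑ i, D2 u z (s i) (s i) := by
  set S := ∑ j, w j • s j with hS
  have h1 : ∀ i, D2 u z (s i - (2 * w i) • S) (s i - (2 * w i) • S) =
      D2 u z (s i) (s i) - 4 * (w i * D2 u z (s i) S) + 4 * w i ^ 2 * D2 u z S S := by
    intro i
    have h2 : D2 u z S (s i) = D2 u z (s i) S := hu.D2_symm z S (s i)
    simp only [D2, map_sub, map_smul, _root_.sub_apply, _root_.smul_apply, smul_eq_mul] at h2 ⊢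
    rw [h2]; ring
  simp only [h1, Finset.sum_add_distrib, Finset.sum_sub_distrib, ← Finset.mul_sum]
  rw [sum_D2_apply, ← Finset.sum_mul, ← Finset.mul_sum, hw, ← hS]
  ring

lemma norm_sq_sub_inner_sq_le {e d : E' n} (he : ‖e‖ = 1) (c : ℝ) :
    ‖c • e + d‖ ^ 2 - inner ℝ e (c • e + d) ^ 2 ≤ ‖d‖ ^ 2 := by
  have : inner ℝ e e = (1 : ℝ) := by rw [real_inner_self_eq_norm_sq, he]; norm_num
  rw [norm_add_sq_real, inner_add_right, inner_smul_right, inner_smul_left, norm_smul, this, he]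
  simp only [mul_pow, Real.norm_eq_abs, sq_abs, conj_trivial]
  nlinarith [sq_nonneg (inner ℝ e d)]

lemma le_norm_sq_add {e d : E' n} (he : ‖e‖ = 1) (c : ℝ) :
    c ^ 2 / 2 - ‖d‖ ^ 2 ≤ ‖c • e + d‖ ^ 2 := by
  have h1 : ‖c • e‖ ≤ ‖c • e + d‖ + ‖d‖ := by
    simpa using norm_sub_le (c • e + d) d
  have h2 : ‖c • e‖ = |c| := by rw [norm_smul, he, mul_one, Real.norm_eq_abs]
  rw [h2] at h1
  have h3 : |c| ^ 2 ≤ (‖c • e + d‖ + ‖d‖) ^ 2 := pow_le_pow_left₀ (abs_nonneg c) h1 2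
  rw [sq_abs] at h3
  nlinarith [sq_nonneg (‖c • e + d‖ - ‖d‖)]

set_option maxHeartbeats 1000000 in
open Filter Topology in
/-- Lipschitz bound by doubling of variables. -/
lemma lipschitz_bound_of_Lv {c Λ B δ F U A : ℝ} (hc : 0 < c) (hΛ : 0 ≤ Λ)
    (hδ : 0 < δ) (hδ1 : δ ≤ 1)
    (hδB : (2 * B + 3 / 2 * (n * (3 * n * Λ) ^ 2)) * δ ≤ c ^ 2 / 2)
    (hF : 0 ≤ F) (hAF : 4 * δ * F < A * c ^ 2) (hAU : 2 * U ≤ A * (3 / 4 * δ))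
    {s : Fin n → E' n → E' n} {b : E' n → E' n} {u : E' n → ℝ}
    (hs : ∀ i, ∀ y ∈ Ball n, ∀ z ∈ Ball n, ‖s i y - s i z‖ ≤ Λ * ‖y - z‖)
    (hw : ∀ y ∈ Ball n, ∀ e : E' n, ‖e‖ = 1 → ∃ (w : Fin n → ℝ) (τ : ℝ), ∑ i, w i ^ 2 = 1 ∧
      ∑ i, w i • s i y = τ • e ∧ c ≤ τ)
    (hb : ∀ y ∈ Ball n, ‖b y‖ ≤ B) (hu : ContDiff ℝ (⊤ : ℕ∞) u)
    (hbd : ∀ y ∈ Sphere' n, u y = 0)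
    (hL : ∀ y ∈ Ball n, |Lv s b u y| ≤ F) (hU : ∀ y ∈ Ball n, |u y| ≤ U)
    (hbar : ∀ y ∈ Ball n, |u y| ≤ A / 2 * (1 - ‖y‖)) :
    ∀ y ∈ Ball n, ∀ z ∈ Ball n, ‖y - z‖ ≤ δ → u y - u z ≤ A * ‖y - z‖ := by
  intro y' hy' z' hz' hyz'
  have hA : 0 < A := by
    have h1 : 0 < A * c ^ 2 := lt_of_le_of_lt (by positivity) hAF
    exact pos_of_mul_pos_left h1 (by positivity)
  set ψ : ℝ → ℝ := fun t => A * (t - t ^ 2 / (4 * δ)) with hψ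
  set Φ : E' n × E' n → ℝ := fun p => u p.1 - u p.2 - ψ ‖p.1 - p.2‖ with hΦ
  have hcu := hu.continuous
  have hcΦ : Continuous Φ := by simp only [hΦ, hψ]; fun_prop
  have hcn : Continuous fun p : E' n × E' n => ‖p.1 - p.2‖ := by fun_prop
  set R : Set (E' n × E' n) := (Ball n ×ˢ Ball n) ∩ {p | ‖p.1 - p.2‖ ≤ δ} with hR
  have hRc : IsCompact R :=
    (ball_isCompact.prod ball_isCompact).inter_right (isClosed_le hcn continuous_const)
  obtain ⟨⟨y, z⟩, ⟨⟨hy, hz⟩, hyz⟩, hmax⟩ := hRc.exists_isMaxOn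
    ⟨(y', z'), ⟨hy', hz'⟩, hyz'⟩ hcΦ.continuousOn
  suffices H : Φ (y, z) ≤ 0 by
    have h1 : Φ (y', z') ≤ Φ (y, z) := hmax ⟨⟨hy', hz'⟩, hyz'⟩
    have h2 : 0 ≤ A * (‖y' - z'‖ ^ 2 / (4 * δ)) := by positivity
    simp only [hΦ, hψ] at h1 H
    linarith
  by_contra! hpos
  simp only at hy hz
  replace hyz : ‖y - z‖ ≤ δ := hyz
  have hψ34 : 3 / 4 * A * ‖y - z‖ ≤ ψ ‖y - z‖ := by
    have h1 : ‖y - z‖ ^ 2 / (4 * δ) ≤ ‖y - z‖ / 4 := by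
      rw [div_le_div_iff₀ (by positivity) (by positivity)]
      nlinarith [norm_nonneg (y - z)]
    simp only [hψ]; nlinarith
  have hΦv : Φ (y, z) = u y - u z - ψ ‖y - z‖ := rfl
  have hne : y - z ≠ 0 := by
    intro h0
    rw [hΦv, sub_eq_zero.1 h0] at hpos
    simp [hψ] at hpos
  have hn0 : 0 < ‖y - z‖ := norm_pos_iff.2 hne
  have hlt : ‖y - z‖ < δ := by
    refine lt_of_le_of_ne hyz fun h0 => ?_
    have h1 := abs_le.1 (hU y hy)
    have h2 := abs_le.1 (hU z hz)
    rw [h0] at hψ34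
    rw [hΦv, h0] at hpos
    linarith
  have hball : ‖y‖ < 1 ∧ ‖z‖ < 1 := by
    refine ⟨lt_of_le_of_ne (mem_ball_iff.1 hy) fun h0 => ?_,
      lt_of_le_of_ne (mem_ball_iff.1 hz) fun h0 => ?_⟩
    · have h1 := (abs_le.1 (hbar z hz)).1
      have h2 : 1 - ‖z‖ ≤ ‖y - z‖ := by rw [← h0]; exact norm_sub_norm_le y z
      have h3 := mul_le_mul_of_nonneg_left h2 hA.le
      rw [hΦv, hbd y (mem_sphere_iff.2 h0)] at hpos
      have := mul_pos hA hn0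
      linarith
    · have h1 := (abs_le.1 (hbar y hy)).2
      have h2 : 1 - ‖y‖ ≤ ‖y - z‖ := by
        rw [← h0, ← norm_neg (y - z), neg_sub]; exact norm_sub_norm_le z y
      have h3 := mul_le_mul_of_nonneg_left h2 hA.le
      rw [hΦv, hbd z (mem_sphere_iff.2 h0)] at hpos
      have := mul_pos hA hn0
      linarith
  have hloc : IsLocalMax (fun p : E' n × E' n =>
      u p.1 - u p.2 - A * (‖p.1 - p.2‖ - ‖p.1 - p.2‖ ^ 2 / (4 * δ))) (y, z) := by
    have h1 : ∀ᶠ p : E' n × E' n in 𝓝 (y, z), p.1 ∈ Ball n :=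
      (continuous_fst.tendsto (y, z)).eventually (eventually_mem_ball hball.1)
    have h2 : ∀ᶠ p : E' n × E' n in 𝓝 (y, z), p.2 ∈ Ball n :=
      (continuous_snd.tendsto (y, z)).eventually (eventually_mem_ball hball.2)
    have h3 : ∀ᶠ p : E' n × E' n in 𝓝 (y, z), ‖p.1 - p.2‖ < δ :=
      (hcn.tendsto (y, z)).eventually (gt_mem_nhds hlt)
    filter_upwards [h1, h2, h3] with p p1 p2 p3
    exact hmax ⟨⟨p1, p2⟩, p3.le⟩
  have test := pair_test_of_contDiff hu hne hloc
  set h := y - z with hh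
  set e : E' n := ‖h‖⁻¹ • h with he
  have hen : ‖e‖ = 1 := by rw [he, norm_smul, norm_inv, norm_norm, inv_mul_cancel₀ hn0.ne']
  have hie : ∀ v, inner ℝ h v / ‖h‖ = inner ℝ e v := fun v => by
    rw [he, real_inner_smul_left]; ring
  have hgrad : ∀ v : E' n, |A * (inner ℝ h v / ‖h‖ - inner ℝ h v / (2 * δ))| ≤ A * ‖v‖ := by
    intro v
    have h1 : inner ℝ h v / (2 * δ) = inner ℝ e v * (‖h‖ / (2 * δ)) := by
      rw [← hie]; field_simp
    rw [h1, hie, ← mul_one_sub, abs_mul, abs_of_pos hA, abs_mul]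
    refine mul_le_mul_of_nonneg_left ?_ hA.le
    have h2 : |inner ℝ e v| ≤ ‖v‖ := by
      simpa [hen] using abs_real_inner_le_norm e v
    have h3 : ‖h‖ / (2 * δ) ≤ 1 := by rw [div_le_one (by positivity)]; linarith
    have h4 : 0 ≤ ‖h‖ / (2 * δ) := by positivity
    have h5 : |1 - ‖h‖ / (2 * δ)| ≤ 1 := by rw [abs_le]; constructor <;> linarith
    calc _ ≤ ‖v‖ * 1 := mul_le_mul h2 h5 (abs_nonneg _) (norm_nonneg _)
      _ = ‖v‖ := mul_one _
  have hDy : |fderiv ℝ u y (b y)| ≤ A * B := by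
    have h1 := (test (b y) 0).1
    simp only [map_zero, sub_zero] at h1
    rw [h1]
    exact (hgrad _).trans (mul_le_mul_of_nonneg_left (hb y hy) hA.le)
  have hDz : |fderiv ℝ u z (b z)| ≤ A * B := by
    have h1 := (test 0 (b z)).1
    simp only [map_zero, zero_sub] at h1
    rw [← abs_neg, h1]
    exact (hgrad _).trans (by rw [norm_neg]; exact mul_le_mul_of_nonneg_left (hb z hz) hA.le)
  obtain ⟨w, τ, hw1, hwe, hτ⟩ := hw y hy e hen
  have hwi : ∀ i, |w i| ≤ 1 := by
    intro i
    have : w i ^ 2 ≤ 1 := by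
      rw [← hw1]
      exact Finset.single_le_sum (f := fun i => w i ^ 2) (fun i _ => sq_nonneg _)
        (Finset.mem_univ i)
    exact (sq_le_one_iff_abs_le_one _).1 this
  set S := ∑ j, w j • s j z with hS
  set D : ℝ := 3 * n * Λ with hD
  set d : Fin n → E' n := fun i => (s i y - s i z) - (2 * w i) • ∑ j, w j • (s j y - s j z) with hd
  have hn1 : (Fin n → (1 : ℝ) ≤ n) := fun i => by
    have := i.pos
    exact_mod_cast this
  have hdn : ∀ i, ‖d i‖ ≤ D * ‖h‖ := by
    intro i
    have h1 : ‖∑ j, w j • (s j y - s j z)‖ ≤ n * (Λ * ‖h‖) := by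
      refine (norm_sum_le _ _).trans ?_
      refine (Finset.sum_le_sum (g := fun _ => Λ * ‖h‖) fun j _ => ?_).trans (by simp)
      rw [norm_smul, Real.norm_eq_abs]
      have := mul_le_mul (hwi j) (hs j y hy z hz) (norm_nonneg _) zero_le_one
      simpa using this
    have h2 : ‖(2 * w i) • ∑ j, w j • (s j y - s j z)‖ ≤ 2 * (n * (Λ * ‖h‖)) := by
      rw [norm_smul, Real.norm_eq_abs, abs_mul, abs_two]
      refine mul_le_mul ?_ h1 (norm_nonneg _) zero_le_two
      linarith [hwi i]
    have h3 := hs i y hy z hz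
    have h4 : Λ * ‖h‖ ≤ n * (Λ * ‖h‖) := le_mul_of_one_le_left (by positivity) (hn1 i)
    calc ‖d i‖ ≤ _ := norm_sub_le _ _
      _ ≤ D * ‖h‖ := by rw [hD]; linarith
  have hk : ∀ i, s i y - (s i z - (2 * w i) • S) = (2 * w i * τ) • e + d i := by
    intro i
    have h1 : S = τ • e - ∑ j, w j • (s j y - s j z) := by
      rw [← hwe, hS, ← Finset.sum_sub_distrib]
      refine Finset.sum_congr rfl fun j _ => ?_
      rw [smul_sub]; abel
    rw [h1]
    simp only [hd]
    generalize ∑ j, w j • (s j y - s j z) = Q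
    module
  have hdn2 : ∀ i, ‖d i‖ ^ 2 ≤ D ^ 2 * ‖h‖ ^ 2 := fun i => by
    rw [← mul_pow]; exact pow_le_pow_left₀ (norm_nonneg _) (hdn i) 2
  have hsum : ∑ i, D2 u y (s i y) (s i y) - ∑ i, D2 u z (s i z) (s i z) ≤
      A * (n * D ^ 2 * ‖h‖ - (2 * τ ^ 2 - n * D ^ 2 * ‖h‖ ^ 2) / (2 * δ)) := by
    rw [← sum_D2_reflect hu z (fun i => s i z) w hw1, ← Finset.sum_sub_distrib]
    calc _ ≤ ∑ i, A * (D ^ 2 * ‖h‖ - (2 * τ ^ 2 * w i ^ 2 - D ^ 2 * ‖h‖ ^ 2) / (2 * δ)) := by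
          refine Finset.sum_le_sum fun i _ => ((test _ _).2).trans ?_
          rw [← hS, hk, hie]
          refine mul_le_mul_of_nonneg_left (sub_le_sub ?_ ?_) hA.le
          · rw [div_le_iff₀ hn0]
            refine (norm_sq_sub_inner_sq_le hen _).trans ((hdn2 i).trans (le_of_eq (by ring)))
          · refine div_le_div_of_nonneg_right ?_ (by positivity)
            refine le_trans ?_ (le_norm_sq_add hen _)
            have := hdn2 i
            nlinarith
      _ = _ := by
          have hq : ∑ i, 2 * τ ^ 2 * w i ^ 2 = 2 * τ ^ 2 := by rw [← Finset.mul_sum, hw1, mul_one]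
          rw [← Finset.mul_sum, Finset.sum_sub_distrib, ← Finset.sum_div, Finset.sum_sub_distrib, hq]
          simp only [Finset.sum_const, Finset.card_univ, Fintype.card_fin, nsmul_eq_mul]
          ring
  have hLy := abs_le.1 (hL y hy)
  have hLz := abs_le.1 (hL z hz)
  simp only [Lv] at hLy hLz
  have hDy' := abs_le.1 hDy
  have hDz' := abs_le.1 hDz
  have hfin : - (2 * F) - 2 * (A * B) ≤
      A * (n * D ^ 2 * ‖h‖ - (2 * τ ^ 2 - n * D ^ 2 * ‖h‖ ^ 2) / (2 * δ)) := by
    refine le_trans ?_ hsum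
    linarith
  have hQ : 0 ≤ (n : ℝ) * D ^ 2 := by positivity
  have h1 : n * D ^ 2 * ‖h‖ ≤ n * D ^ 2 * δ := mul_le_mul_of_nonneg_left hyz hQ
  have h2 : c ^ 2 / δ - n * D ^ 2 * δ / 2 ≤ (2 * τ ^ 2 - n * D ^ 2 * ‖h‖ ^ 2) / (2 * δ) := by
    rw [le_div_iff₀ (by positivity)]
    have e1 : (c ^ 2 / δ - n * D ^ 2 * δ / 2) * (2 * δ) = 2 * c ^ 2 - n * D ^ 2 * δ ^ 2 := by
      field_simp
    rw [e1]
    have h3 : c ^ 2 ≤ τ ^ 2 := pow_le_pow_left₀ hc.le hτ 2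
    have h4 : n * D ^ 2 * ‖h‖ ^ 2 ≤ n * D ^ 2 * δ ^ 2 :=
      mul_le_mul_of_nonneg_left (pow_le_pow_left₀ hn0.le hyz 2) hQ
    linarith
  have h3 : - (2 * F) - 2 * (A * B) ≤ A * (3 / 2 * (n * D ^ 2 * δ) - c ^ 2 / δ) :=
    hfin.trans (mul_le_mul_of_nonneg_left (by linarith) hA.le)
  have h4 : A * c ^ 2 ≤ 2 * F * δ + A * ((2 * B + 3 / 2 * (n * D ^ 2)) * δ) := by
    have h5 := mul_le_mul_of_nonneg_right h3 hδ.le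
    have e2 : A * (3 / 2 * (n * D ^ 2 * δ) - c ^ 2 / δ) * δ =
        A * (3 / 2 * (n * D ^ 2) * δ * δ) - A * c ^ 2 := by field_simp
    rw [e2] at h5
    have h6 : 3 / 2 * (n * D ^ 2) * δ * δ ≤ 3 / 2 * (n * D ^ 2) * δ :=
      mul_le_of_le_one_right (by positivity) hδ1
    have h7 := mul_le_mul_of_nonneg_left h6 hA.le
    linarith
  have h5 := mul_le_mul_of_nonneg_left hδB hA.le
  linarith

open Filter Topology in
/-- A one-sided local Lipschitz bound on the ball controls the derivative. -/
lemma abs_fderiv_le_of_lipschitz {u : E' n → ℝ} {δ A : ℝ} (hδ : 0 < δ) (hA : 0 ≤ A)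
    (hu : Sm u)
    (h : ∀ y ∈ Ball n, ∀ z ∈ Ball n, ‖y - z‖ ≤ δ → u y - u z ≤ A * ‖y - z‖) :
    ∀ y ∈ Ball n, ∀ v : E' n, |fderiv ℝ u y v| ≤ 3 * A * ‖v‖ := by
  intro y hy
  have hd := (hu.differentiableAt hy).hasFDerivAt
  have key : ∀ z ∈ Ball n, |fderiv ℝ u y (z - y)| ≤ A * ‖z - y‖ := by
    intro z hz
    have hl : HasDerivAt (fun t : ℝ => u (y + t • (z - y))) (fderiv ℝ u y (z - y)) 0 := by
      have h1 : HasDerivAt (fun t : ℝ => y + t • (z - y)) (z - y) 0 := by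
        simpa using ((hasDerivAt_id (0 : ℝ)).smul_const (z - y)).const_add y
      have h2 : HasFDerivAt u (fderiv ℝ u y) (y + (0 : ℝ) • (z - y)) := by simpa using hd
      exact h2.comp_hasDerivAt (0 : ℝ) h1
    have hs := hl.tendsto_slope_zero_right
    have hb : ∀ᶠ t in 𝓝[>] (0 : ℝ), |t⁻¹ • (u (y + (0 + t) • (z - y)) - u (y + (0 : ℝ) • (z - y)))|
        ≤ A * ‖z - y‖ := by
      have hsm : ∀ᶠ t in 𝓝 (0 : ℝ), t * ‖z - y‖ < δ ∧ t < 1 := by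
        have hc : ContinuousAt (fun t : ℝ => t * ‖z - y‖) 0 := by fun_prop
        refine (hc.eventually (gt_mem_nhds ?_)).and (gt_mem_nhds one_pos)
        simpa using hδ
      filter_upwards [self_mem_nhdsWithin, nhdsWithin_le_nhds hsm] with t ht ⟨ht1, ht2⟩
      replace ht : 0 < t := ht
      have hmem : y + t • (z - y) ∈ Ball n := ball_convex.add_smul_sub_mem hy hz ⟨ht.le, ht2.le⟩
      have hn1 : ‖y + t • (z - y) - y‖ = t * ‖z - y‖ := by
        rw [add_sub_cancel_left, norm_smul, Real.norm_eq_abs, abs_of_pos ht]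
      have e1 := h _ hmem y hy (by rw [hn1]; exact ht1.le)
      have e2 := h y hy _ hmem (by rw [norm_sub_rev, hn1]; exact ht1.le)
      rw [norm_sub_rev, hn1] at e2
      rw [hn1] at e1
      rw [zero_add, zero_smul, add_zero, smul_eq_mul, abs_mul, abs_of_pos (inv_pos.2 ht),
        inv_mul_le_iff₀ ht, abs_le]
      constructor <;> linarith
    exact le_of_tendsto hs.abs hb
  intro v
  rcases eq_or_ne v 0 with rfl | hv
  · simp
  have hvn : 0 < ‖v‖ := norm_pos_iff.2 hv
  set e := ‖v‖⁻¹ • v with he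
  have hen : ‖e‖ = 1 := by rw [he, norm_smul, norm_inv, norm_norm, inv_mul_cancel₀ hvn.ne']
  have hve : v = ‖v‖ • e := by rw [he, smul_smul, mul_inv_cancel₀ hvn.ne', one_smul]
  have hyn := mem_ball_iff.1 hy
  have k1 := key e (mem_ball_iff.2 hen.le)
  have k2 := key 0 zero_mem_ball
  have n1 : ‖e - y‖ ≤ 2 := (norm_sub_le _ _).trans (by linarith)
  have n2 : ‖0 - y‖ ≤ 1 := by simpa using hyn
  have k3 : |fderiv ℝ u y e| ≤ 3 * A := by
    have : e = (e - y) - (0 - y) := by abel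
    rw [this, map_sub]
    refine (abs_sub _ _).trans ?_
    have m1 := mul_le_mul_of_nonneg_left n1 hA
    have m2 := mul_le_mul_of_nonneg_left n2 hA
    linarith
  rw [hve, map_smul, smul_eq_mul, abs_mul, abs_norm, norm_smul, norm_norm, hen, mul_one]
  nlinarith

/-- Gradient bound with a free small parameter. -/
lemma fderiv_bound_of_Lv {lam c Λ B : ℝ} (hl : 0 < lam) (hc : 0 < c) (hΛ : 0 ≤ Λ) (hB : 0 ≤ B) :
    ∃ C δ₀, 0 ≤ C ∧ 0 < δ₀ ∧ ∀ (s : Fin n → E' n → E' n) (b : E' n → E' n) (u : E' n → ℝ)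
      (F U δ : ℝ), 0 < δ → δ ≤ δ₀ → 0 ≤ F → 0 ≤ U →
      (∀ y ∈ Ball n, ∀ ξ : E' n, lam * ‖ξ‖ ^ 2 ≤ ∑ i, inner ℝ (s i y) ξ ^ 2) →
      (∀ i, ∀ y ∈ Ball n, ∀ z ∈ Ball n, ‖s i y - s i z‖ ≤ Λ * ‖y - z‖) →
      (∀ y ∈ Ball n, ∀ e : E' n, ‖e‖ = 1 → ∃ (w : Fin n → ℝ) (τ : ℝ), ∑ i, w i ^ 2 = 1 ∧
        ∑ i, w i • s i y = τ • e ∧ c ≤ τ) →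
      (∀ y ∈ Ball n, ‖b y‖ ≤ B) → ContDiff ℝ (⊤ : ℕ∞) u → (∀ y ∈ Sphere' n, u y = 0) →
      (∀ y ∈ Ball n, |Lv s b u y| ≤ F) → (∀ y ∈ Ball n, |u y| ≤ U) →
      ∀ y ∈ Ball n, ∀ v : E' n, |fderiv ℝ u y v| ≤ C * (δ * F + U / δ) * ‖v‖ := by
  set Q : ℝ := 2 * B + 3 / 2 * (n * (3 * n * Λ) ^ 2) with hQ
  have hQ0 : 0 ≤ Q := by positivity
  set C₁ : ℝ := 4 + 8 / lam + 4 / c ^ 2 with hC₁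
  refine ⟨3 * C₁, min (1 / 4) (min (lam / (4 * B + 1)) (c ^ 2 / 2 / (Q + 1))), by positivity,
    by positivity, ?_⟩
  intro s b u F U δ hδ hδ0 hF hU0 hell hs hw hb hu hbd hL hU y hy v
  have hδ4 : δ ≤ 1 / 4 := hδ0.trans (min_le_left _ _)
  have hδB : δ * (4 * B + 1) ≤ lam := (le_div_iff₀ (by positivity)).1
    (hδ0.trans ((min_le_right _ _).trans (min_le_left _ _)))
  have hδQ : δ * (Q + 1) ≤ c ^ 2 / 2 := (le_div_iff₀ (by positivity)).1
    (hδ0.trans ((min_le_right _ _).trans (min_le_right _ _)))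
  have hB4 : B ≤ lam / (4 * δ) := by rw [le_div_iff₀ (by positivity)]; nlinarith
  have main : ∀ ε > 0, |fderiv ℝ u y v| ≤ 3 * (C₁ * (δ * F + U / δ) + ε) * ‖v‖ := by
    intro ε hε
    set A := C₁ * (δ * F + U / δ) + ε with hA
    have p1 : 0 ≤ δ * F := by positivity
    have p2 : 0 ≤ U / δ := by positivity
    have p3 : 0 ≤ 8 / lam := by positivity
    have p4 : 0 ≤ 4 / c ^ 2 := by positivity
    have hA0 : 0 < A := by positivity
    have a1 : 4 * (U / δ) ≤ A := by
      rw [hA, hC₁]; nlinarith [mul_nonneg p3 p1, mul_nonneg p4 p1, mul_nonneg p3 p2,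
        mul_nonneg p4 p2]
    have a2 : 8 / lam * (δ * F) < A := by
      rw [hA, hC₁]; nlinarith [mul_nonneg p3 p1, mul_nonneg p4 p1, mul_nonneg p3 p2,
        mul_nonneg p4 p2]
    have a3 : 4 / c ^ 2 * (δ * F) < A := by
      rw [hA, hC₁]; nlinarith [mul_nonneg p3 p1, mul_nonneg p4 p1, mul_nonneg p3 p2,
        mul_nonneg p4 p2]
    have b1 : 4 * U ≤ A * δ := by
      have := mul_le_mul_of_nonneg_right a1 hδ.le
      have e : 4 * (U / δ) * δ = 4 * U := by field_simp
      linarith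
    have b2 : F < A / 2 * lam / (4 * δ) := by
      rw [lt_div_iff₀ (by positivity)]
      have := mul_lt_mul_of_pos_right a2 hl
      have e : 8 / lam * (δ * F) * lam = 8 * (δ * F) := by field_simp
      linarith
    have b3 : 4 * δ * F < A * c ^ 2 := by
      have := mul_lt_mul_of_pos_right a3 (pow_pos hc 2)
      have e : 4 / c ^ 2 * (δ * F) * c ^ 2 = 4 * δ * F := by field_simp
      linarith
    have hbar : ∀ y ∈ Ball n, |u y| ≤ A / 2 * (1 - ‖y‖) := by
      intro y hy
      refine abs_le'.2 ⟨?_, ?_⟩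
      · exact boundary_bound_of_Lv hl hδ hδ4 hB4 hF (U := U) (by linarith) b2 hell hb hu hbd
          (fun z hz => (abs_le.1 (hL z hz)).1) (fun z hz => (abs_le.1 (hU z hz)).2) y hy
      · refine boundary_bound_of_Lv (u := fun z => - u z) hl hδ hδ4 hB4 hF (U := U) (by linarith)
          b2 hell hb hu.neg (fun z hz => by simp [hbd z hz]) (fun z hz => ?_) (fun z hz => ?_) y hy
        · rw [Lv_neg]; linarith [(abs_le.1 (hL z hz)).2]
        · linarith [(abs_le.1 (hU z hz)).1]
    refine abs_fderiv_le_of_lipschitz hδ hA0.le hu.sm ?_ y hy v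
    exact lipschitz_bound_of_Lv (F := F) (U := U) hc hΛ hδ (by linarith) (by nlinarith) hF b3
      (by nlinarith) hs hw hb hu hbd hL hU hbar
  refine le_of_forall_pos_le_add fun ε hε => ?_
  have hpos : 0 < 3 * (‖v‖ + 1) := by positivity
  refine (main (ε / (3 * (‖v‖ + 1))) (by positivity)).trans ?_
  have : 3 * (ε / (3 * (‖v‖ + 1))) * ‖v‖ ≤ ε := by
    rw [mul_div_assoc', div_mul_eq_mul_div, div_le_iff₀ hpos]
    nlinarith [norm_nonneg v]
  linarith

/-- The operator `Σ A^{ac} ∂_a ∂_c + Σ b^a ∂_a`. -/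
def Lop (A : Fin n → Fin n → E' n → ℝ) (b : Fin n → E' n → ℝ) (u : E' n → ℝ) (y : E' n) : ℝ :=
  ∑ a, ∑ c, A a c y * pd a (pd c u) y + ∑ a, b a y * pd a u y

lemma D2_eq_sum_pd {u : E' n → ℝ} (hu : ContDiff ℝ (⊤ : ℕ∞) u) (y v w : E' n) :
    D2 u y v w = ∑ a, ∑ c, v a * w c * pd a (pd c u) y := by
  have h1 : ∀ c, pd c u = fun z => fderiv ℝ u z (EuclideanSpace.single c 1) := fun c => rfl
  have hd : DifferentiableAt ℝ (fderiv ℝ u) y :=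
    (hu.fderiv_right (m := (⊤ : ℕ∞)) (by simp)).differentiable (by simp) y
  have h2 : ∀ a c, pd a (pd c u) y =
      D2 u y (EuclideanSpace.single a 1) (EuclideanSpace.single c 1) := by
    intro a c
    rw [h1 c, pd, D2, fderiv_clm_apply hd (differentiableAt_const _)]
    simp
  have hv : v = ∑ a, v a • EuclideanSpace.single a (1 : ℝ) := by
    simpa using ((EuclideanSpace.basisFun (Fin n) ℝ).sum_repr v).symm
  have hw : w = ∑ a, w a • EuclideanSpace.single a (1 : ℝ) := by
    simpa using ((EuclideanSpace.basisFun (Fin n) ℝ).sum_repr w).symm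
  simp only [h2]
  conv_lhs => rw [hv, hw]
  simp only [D2, map_sum, map_smul, _root_.sum_apply, _root_.smul_apply, smul_eq_mul,
    Finset.mul_sum]
  rw [Finset.sum_comm]
  refine Finset.sum_congr rfl fun a _ => Finset.sum_congr rfl fun c _ => by ring

lemma Lop_eq_Lv {A : Fin n → Fin n → E' n → ℝ} {σ : Fin n → Fin n → E' n → ℝ}
    {b : Fin n → E' n → ℝ} {u : E' n → ℝ} (hu : ContDiff ℝ (⊤ : ℕ∞) u) {y : E' n}
    (hA : ∀ a c, A a c y = ∑ i, σ a i y * σ c i y) :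
    Lop A b u y = Lv (fun i z => WithLp.toLp 2 fun a => σ a i z)
      (fun z => WithLp.toLp 2 fun a => b a z) u y := by
  rw [Lop, Lv]
  congr 1
  · simp only [D2_eq_sum_pd hu, hA, Finset.sum_mul]
    conv_rhs => rw [Finset.sum_comm]
    refine Finset.sum_congr rfl fun a _ => ?_
    conv_rhs => rw [Finset.sum_comm]
  · rw [fderiv_eq_sum_pd]

lemma norm_toLp_le {f : Fin n → ℝ} {B : ℝ} (h : ∀ a, |f a| ≤ B) :
    ‖WithLp.toLp 2 f‖ ≤ n * B := by
  have h1 : ‖WithLp.toLp 2 f‖ ≤ ∑ a, |f a| := by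
    rw [EuclideanSpace.norm_eq]
    refine Real.sqrt_le_iff.2 ⟨Finset.sum_nonneg fun _ _ => abs_nonneg _, ?_⟩
    exact Finset.sum_sq_le_sq_sum_of_nonneg fun _ _ => abs_nonneg _
  refine h1.trans ((Finset.sum_le_sum fun a _ => h a).trans (by simp))

lemma abs_sub_le_of_sm {u : E' n → ℝ} (hu : Sm u) {L : ℝ}
    (h : ∀ a, ∀ y ∈ Ball n, |pd a u y| ≤ L) {y z : E' n} (hy : y ∈ Ball n) (hz : z ∈ Ball n) :
    |u y - u z| ≤ n * L * ‖y - z‖ := by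
  have hb : ∀ y ∈ Ball n, ‖fderiv ℝ u y‖ ≤ n * L := by
    intro y hy
    have hL : 0 ≤ n * L := by
      rcases Nat.eq_zero_or_pos n with h0 | h0
      · simp [h0]
      · have := (abs_nonneg _).trans (h ⟨0, h0⟩ y hy)
        positivity
    refine ContinuousLinearMap.opNorm_le_bound _ hL fun v => ?_
    rw [fderiv_eq_sum_pd, Real.norm_eq_abs]
    refine (Finset.abs_sum_le_sum_abs _ _).trans ?_
    refine (Finset.sum_le_sum (g := fun _ => ‖v‖ * L) fun a _ => ?_).trans
      (le_of_eq (by simp; ring))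
    rw [abs_mul]
    exact mul_le_mul (by simpa using PiLp.norm_apply_le v a) (h a y hy) (abs_nonneg _)
      (norm_nonneg _)
  simpa using ball_convex.norm_image_sub_le_of_norm_fderiv_le
    (fun z hz => hu.differentiableAt hz) hb hz hy

/-- A family of second order operators with tame coefficients for which the basic maximum principle
estimates hold uniformly. -/
structure EllFam {ι : Type} (W : ι → ℕ → ℝ) (A : Fin n → Fin n → ι → E' n → ℝ)
    (b : Fin n → ι → E' n → ℝ) : Prop where
  good : GoodW W
  bdd_zero : ∃ C, ∀ ω, W ω 0 ≤ C
  tame_A : ∀ a c, Tame W (A a c)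
  tame_pdA : ∀ a c l, Tame W (fun ω => pd l (A a c ω))
  tame_b : ∀ a, Tame W (b a)
  ell : ∃ lam > 0, ∀ ω, ∀ y ∈ Ball n, lam * ‖y‖ ^ 2 ≤ ∑ a, ∑ c, A a c ω y * (y a * y c)
  sup : ∃ C, 0 ≤ C ∧ ∀ ω (u : E' n → ℝ) (F : ℝ), 0 ≤ F → ContDiff ℝ (⊤ : ℕ∞) u →
    (∀ y ∈ Sphere' n, u y = 0) →
    (∀ y ∈ Ball n, |Lop (fun a c => A a c ω) (fun a => b a ω) u y| ≤ F) →
    ∀ y ∈ Ball n, |u y| ≤ C * F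
  grad : ∃ C δ₀, 0 ≤ C ∧ 0 < δ₀ ∧ ∀ ω (u : E' n → ℝ) (F U δ : ℝ), 0 < δ → δ ≤ δ₀ → 0 ≤ F →
    0 ≤ U → ContDiff ℝ (⊤ : ℕ∞) u → (∀ y ∈ Sphere' n, u y = 0) →
    (∀ y ∈ Ball n, |Lop (fun a c => A a c ω) (fun a => b a ω) u y| ≤ F) →
    (∀ y ∈ Ball n, |u y| ≤ U) →
    ∀ y ∈ Ball n, ∀ a, |pd a u y| ≤ C * (δ * F + U / δ)

lemma inner_toLp (f : Fin n → ℝ) (ξ : E' n) :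
    inner ℝ (WithLp.toLp 2 f : E' n) ξ = ∑ a, f a * ξ a := by
  simp [PiLp.inner_apply, mul_comm]

lemma ellFam_of_factor (hn : 0 < n) {ι : Type} {W : ι → ℕ → ℝ}
    {σ J : Fin n → Fin n → ι → E' n → ℝ} {b : Fin n → ι → E' n → ℝ} (hW : GoodW W)
    (hW0 : ∃ C, ∀ ω, W ω 0 ≤ C) (hσ : ∀ a i, Tame W (σ a i)) (hb : ∀ a, Tame W (b a))
    (hσ1 : ∀ a i c, Tame W (fun ω => pd c (σ a i ω)))
    (hJ : ∃ C, ∀ ω i a, ∀ y ∈ Ball n, |J i a ω y| ≤ C)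
    (hσJ : ∀ ω a c, ∀ y ∈ Ball n, ∑ i, σ a i ω y * J i c ω y = if a = c then 1 else 0) :
    EllFam W (fun a c ω y => ∑ i, σ a i ω y * σ c i ω y) b := by
  obtain ⟨C₀, hC₀⟩ := hW0
  obtain ⟨L, hL⟩ : ∃ L, ∀ ω a i c, ∀ y ∈ Ball n, |pd c (σ a i ω) y| ≤ L := by
    choose D hD hd using fun q : Fin n × Fin n × Fin n => (hσ1 q.1 q.2.1 q.2.2 1).bound
    refine ⟨(∑ q, D q) * |C₀|, fun ω a i c y hy => (hd (a, i, c) ω y hy).trans ?_⟩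
    exact mul_le_mul (Finset.single_le_sum (fun b _ => hD b) (Finset.mem_univ (a, i, c)))
      ((hC₀ ω).trans (le_abs_self _)) (hW.nonneg ω 0) (Finset.sum_nonneg fun a _ => hD a)
  obtain ⟨cJ, hcJ⟩ := hJ
  set s : ι → Fin n → E' n → E' n := fun ω i z => WithLp.toLp 2 fun a => σ a i ω z with hs
  set bv : ι → E' n → E' n := fun ω z => WithLp.toLp 2 fun a => b a ω z with hbv
  set Q : ℝ := n ^ 2 * cJ ^ 2 + 1 with hQ
  have hQ0 : 0 < Q := by positivity
  have hξ : ∀ ω, ∀ y ∈ Ball n, ∀ ξ : E' n, ∀ c, ξ c = ∑ i, inner ℝ (s ω i y) ξ * J i c ω y := by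
    intro ω y hy ξ c
    simp only [hs, inner_toLp, Finset.sum_mul]
    rw [Finset.sum_comm]
    have : ∀ a, ∑ i, σ a i ω y * ξ a * J i c ω y = ξ a * if a = c then 1 else 0 := by
      intro a
      rw [← hσJ ω a c y hy, Finset.mul_sum]
      exact Finset.sum_congr rfl fun i _ => by ring
    simp [this]
  have hell : ∀ ω, ∀ y ∈ Ball n, ∀ ξ : E' n,
      Q⁻¹ * ‖ξ‖ ^ 2 ≤ ∑ i, inner ℝ (s ω i y) ξ ^ 2 := by
    intro ω y hy ξ
    rw [inv_mul_le_iff₀ hQ0, EuclideanSpace.norm_sq_eq]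
    set E := ∑ i, inner ℝ (s ω i y) ξ ^ 2 with hE
    have hE0 : 0 ≤ E := Finset.sum_nonneg fun _ _ => sq_nonneg _
    have h1 : ∀ c, ‖ξ c‖ ^ 2 ≤ E * (n * cJ ^ 2) := by
      intro c
      rw [Real.norm_eq_abs, sq_abs, hξ ω y hy ξ c]
      refine (Finset.sum_mul_sq_le_sq_mul_sq _ _ _).trans (mul_le_mul_of_nonneg_left ?_ hE0)
      refine (Finset.sum_le_sum (g := fun _ => cJ ^ 2) fun i _ => ?_).trans (by simp)
      exact sq_le_sq' (neg_le_of_abs_le (hcJ ω i c y hy)) (le_of_abs_le (hcJ ω i c y hy))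
    refine (Finset.sum_le_sum fun c _ => h1 c).trans ?_
    simp only [Finset.sum_const, Finset.card_univ, Fintype.card_fin, nsmul_eq_mul, hQ]
    nlinarith
  have hw : ∀ ω, ∀ y ∈ Ball n, ∀ e : E' n, ‖e‖ = 1 → ∃ (w : Fin n → ℝ) (τ : ℝ),
      ∑ i, w i ^ 2 = 1 ∧ ∑ i, w i • s ω i y = τ • e ∧ (√Q)⁻¹ ≤ τ := by
    intro ω y hy e he
    set w : Fin n → ℝ := fun i => ∑ c, J i c ω y * e c with hw
    have h1 : ∑ i, w i • s ω i y = e := by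
      ext a
      simp only [WithLp.ofLp_sum, WithLp.ofLp_smul, Finset.sum_apply, Pi.smul_apply, smul_eq_mul,
        hs, hw, Finset.sum_mul]
      rw [Finset.sum_comm]
      have : ∀ c, ∑ i, J i c ω y * e c * σ a i ω y = e c * if a = c then 1 else 0 := by
        intro c
        rw [← hσJ ω a c y hy, Finset.mul_sum]
        exact Finset.sum_congr rfl fun i _ => by ring
      simp [this]
    set N := ∑ i, w i ^ 2 with hN
    have hNQ : N ≤ Q := by
      have h2 : ∀ i, w i ^ 2 ≤ n * cJ ^ 2 := by
        intro i
        refine (Finset.sum_mul_sq_le_sq_mul_sq _ _ _).trans ?_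
        have h3 : ∑ c, e c ^ 2 = 1 := by
          have := EuclideanSpace.norm_sq_eq e
          rw [he] at this
          simpa using this.symm
        rw [h3, mul_one]
        refine (Finset.sum_le_sum (g := fun _ => cJ ^ 2) fun c _ => ?_).trans (by simp)
        exact sq_le_sq' (neg_le_of_abs_le (hcJ ω i c y hy)) (le_of_abs_le (hcJ ω i c y hy))
      refine (Finset.sum_le_sum fun i _ => h2 i).trans ?_
      simp only [Finset.sum_const, Finset.card_univ, Fintype.card_fin, nsmul_eq_mul, hQ]
      nlinarith
    have hN0 : 0 < N := by
      refine lt_of_le_of_ne (Finset.sum_nonneg fun _ _ => sq_nonneg _) fun h0 => ?_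
      have h2 : ∀ i, w i = 0 := fun i => by
        have := (Finset.sum_eq_zero_iff_of_nonneg fun i _ => sq_nonneg (w i)).1 h0.symm i
          (Finset.mem_univ i)
        exact pow_eq_zero_iff two_ne_zero |>.1 this
      rw [← h1] at he
      simp [h2] at he
    refine ⟨fun i => (√N)⁻¹ * w i, (√N)⁻¹, ?_, ?_, ?_⟩
    · simp only [mul_pow, ← Finset.mul_sum, inv_pow, Real.sq_sqrt hN0.le]
      exact inv_mul_cancel₀ hN0.ne'
    · simp only [mul_smul, ← Finset.smul_sum, h1]
    · exact inv_anti₀ (Real.sqrt_pos.2 hN0) (Real.sqrt_le_sqrt hNQ)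
  have hbB : ∃ B, 0 ≤ B ∧ ∀ ω, ∀ y ∈ Ball n, ‖bv ω y‖ ≤ B := by
    choose D hD hd using fun a => (hb a 1).bound
    have hC0 : ∀ ω, 0 ≤ C₀ := fun ω => (hW.nonneg ω 0).trans (hC₀ ω)
    refine ⟨n * ((∑ a, D a) * |C₀|), mul_nonneg (Nat.cast_nonneg n)
      (mul_nonneg (Finset.sum_nonneg fun a _ => hD a) (abs_nonneg _)), fun ω y hy =>
      norm_toLp_le fun a => (hd a ω y hy).trans ?_⟩
    refine mul_le_mul (Finset.single_le_sum (fun b _ => hD b) (Finset.mem_univ a))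
      ((hC₀ ω).trans (le_abs_self _)) (hW.nonneg ω 0) (Finset.sum_nonneg fun a _ => hD a)
  obtain ⟨B, hB, hbB⟩ := hbB
  have hlip : ∀ ω i, ∀ y ∈ Ball n, ∀ z ∈ Ball n,
      ‖s ω i y - s ω i z‖ ≤ n * (n * |L|) * ‖y - z‖ := by
    intro ω i y hy z hz
    have e : s ω i y - s ω i z = WithLp.toLp 2 fun a => σ a i ω y - σ a i ω z := rfl
    rw [e]
    refine (norm_toLp_le fun a => abs_sub_le_of_sm ((hσ a i).sm ω)
      (fun c y hy => (hL ω a i c y hy).trans (le_abs_self L)) hy hz).trans (le_of_eq (by ring))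
  have hQi : 0 < Q⁻¹ := inv_pos.2 hQ0
  have hLop : ∀ ω (u : E' n → ℝ), ContDiff ℝ (⊤ : ℕ∞) u → ∀ y,
      Lop (fun a c y => ∑ i, σ a i ω y * σ c i ω y) (fun a => b a ω) u y = Lv (s ω) (bv ω) u y :=
    fun ω u hu y => Lop_eq_Lv hu fun a c => rfl
  refine ⟨hW, ⟨C₀, hC₀⟩, fun a c => Tame.sum fun i _ => Tame.mul hW (hσ a i) (hσ c i), fun a c l => ?_,
    hb, ?_, ?_, ?_⟩
  · refine Tame.congr (u := fun ω y => ∑ i, (pd l (σ a i ω) y * σ c i ω y +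
      σ a i ω y * pd l (σ c i ω) y)) (Tame.sum fun i _ => (Tame.mul hW (hσ1 a i l) (hσ c i)).add
        (Tame.mul hW (hσ a i) (hσ1 c i l))) (fun ω => Sm.pd (Sm.sum fun i _ =>
          ((hσ a i).sm ω).mul ((hσ c i).sm ω)) l) fun ω y hy => ?_
    have d1 := fun i => ((hσ a i).sm ω).differentiableAt hy
    have d2 := fun i => ((hσ c i).sm ω).differentiableAt hy
    simp only
    rw [pd_sum fun i _ => (d1 i).fun_mul (d2 i)]
    exact Finset.sum_congr rfl fun i _ => (pd_mul (d1 i) (d2 i) l).symm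
  · refine ⟨Q⁻¹, hQi, fun ω y hy => (hell ω y hy y).trans (le_of_eq ?_)⟩
    simp only [hs, inner_toLp, pow_two, Finset.sum_mul, Finset.mul_sum]
    rw [Finset.sum_comm]
    refine Finset.sum_congr rfl fun a _ => ?_
    rw [Finset.sum_comm]
    refine Finset.sum_congr rfl fun c _ => Finset.sum_congr rfl fun i _ => by ring
  · obtain ⟨C, hC, h⟩ := sup_bound_of_Lv (n := n) hQi hB hn
    refine ⟨C, hC, fun ω u F hF hu hbd hLF y hy => ?_⟩
    simp only [hLop ω u hu] at hLF
    refine abs_le'.2 ⟨?_, ?_⟩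
    · exact h (s ω) (bv ω) u F hF (hell ω) (hbB ω) hu hbd
        (fun z hz => (abs_le.1 (hLF z hz)).1) y hy
    · refine h (s ω) (bv ω) (fun z => - u z) F hF (hell ω) (hbB ω) hu.neg
        (fun z hz => by simp [hbd z hz]) (fun z hz => ?_) y hy
      rw [Lv_neg]; linarith [(abs_le.1 (hLF z hz)).2]
  · obtain ⟨C, δ₀, hC, hδ₀, h⟩ := fderiv_bound_of_Lv (n := n) hQi
      (inv_pos.2 (Real.sqrt_pos.2 hQ0)) (Λ := n * (n * |L|)) (by positivity) hB
    refine ⟨C, δ₀, hC, hδ₀, fun ω u F U δ hδ hδ1 hF hU hu hbd hLF hUu y hy a => ?_⟩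
    simp only [hLop ω u hu] at hLF
    have := h (s ω) (bv ω) u F U δ hδ hδ1 hF hU (hell ω) (hlip ω) (hw ω) (hbB ω) hu hbd hLF hUu
      y hy (EuclideanSpace.single a 1)
    simpa [pd] using this

lemma Sm.exists_wt : ∀ (k : ℕ) {u : E' n → ℝ}, Sm u → ∃ M, 0 ≤ M ∧ Wt k (fun _ => M) u
  | 0, _, _ => ⟨0, le_rfl, trivial⟩
  | k + 1, u, hu => by
    obtain ⟨C, hC⟩ := ball_isCompact.exists_bound_of_continuousOn hu.continuousOn
    choose D hD hd using fun a => Sm.exists_wt k (hu.pd a)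
    have hS : 0 ≤ ∑ a, D a := Finset.sum_nonneg fun a _ => hD a
    refine ⟨|C| + ∑ a, D a, add_nonneg (abs_nonneg _) hS, fun y hy => ?_, fun a => ?_⟩
    · exact (hC y hy).trans ((le_abs_self C).trans (le_add_of_nonneg_right hS))
    · exact (hd a).mono fun _ _ => (Finset.single_le_sum (fun b _ => hD b)
        (Finset.mem_univ a)).trans (le_add_of_nonneg_left (abs_nonneg _))

/-- Combination of two families of bounds, the first one being available at low orders only. -/
lemma Wt.combine : ∀ {l k : ℕ} {P Q R : ℕ → ℝ} {u : E' n → ℝ}, Wt k P u → Wt l Q u →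
    (∀ j < l, (j < k ∧ P j ≤ R j) ∨ Q j ≤ R j) → Wt l R u
  | 0, _, _, _, _, _, _, _, _ => trivial
  | l + 1, 0, _, _, _, _, _, hQ, h => hQ.mono fun j hj => by
      rcases h j hj with h | h
      · exact absurd h.1 (Nat.not_lt_zero j)
      · exact h
  | l + 1, k + 1, P, Q, R, u, hP, hQ, h => by
    refine ⟨fun y hy => ?_, fun a => (hP.2 a).combine (hQ.2 a) fun j hj => ?_⟩
    · rcases h 0 (Nat.succ_pos l) with h | h
      · exact (hP.1 y hy).trans h.2
      · exact (hQ.1 y hy).trans h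
    · rcases h (j + 1) (by omega) with h | h
      · exact Or.inl ⟨by omega, h.2⟩
      · exact Or.inr h

lemma Wt.top_of_pd {k : ℕ} {P Q R : ℕ → ℝ} {u : E' n → ℝ} (hP : Wt (k + 1) P u)
    (hQ : ∀ a, Wt (k + 1) Q (pd a u)) (h1 : ∀ j < k + 1, P j ≤ R j) (h2 : Q k ≤ R (k + 1)) :
    Wt (k + 2) R u := by
  have hc : Wt (k + 2) (fun j => Nat.casesOn j (P 0) Q) u := ⟨hP.1, hQ⟩
  refine hP.combine hc fun j hj => ?_
  rcases Nat.lt_or_ge j (k + 1) with h | h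
  · exact Or.inl ⟨h, h1 j h⟩
  · obtain rfl : j = k + 1 := by omega
    exact Or.inr h2

section

variable {ι : Type} {k : ℕ} {W H P Q R : ι → ℕ → ℝ} {u v : ι → E' n → ℝ}

lemma Tame.of_contDiff (hW : GoodW W) {g : E' n → ℝ} (hg : ContDiff ℝ (⊤ : ℕ∞) g) :
    Tame W (fun _ => g) := fun k => by
  obtain ⟨M, hM, h⟩ := Sm.exists_wt k hg.sm
  exact ⟨fun _ => hg.sm, M, hM, fun ω => h.mono fun j _ =>
    le_mul_of_one_le_right hM (hW.one_le ω j)⟩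

lemma Bdd.mul_of_le (hu : Bdd k P u) (hv : Bdd k Q v) (hP : ∀ ω j, 0 ≤ P ω j)
    (hQ : ∀ ω j, 0 ≤ Q ω j)
    (hm : ∃ C, 0 ≤ C ∧ ∀ ω i j, i + j < k → P ω i * Q ω j ≤ C * R ω (i + j)) :
    Bdd k R (fun ω y => u ω y * v ω y) := by
  obtain ⟨su, C, hC, hu⟩ := hu
  obtain ⟨sv, D, hD, hv⟩ := hv
  obtain ⟨A, hA, hm⟩ := hm
  refine ⟨fun ω => (su ω).mul (sv ω), 2 ^ k * (C * D * A), by positivity, fun ω => ?_⟩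
  refine (Wt.mul (R := fun j => C * D * A * R ω j) (hu ω) (hv ω) (su ω) (sv ω)
    (fun i => mul_nonneg hC (hP ω i)) (fun i => mul_nonneg hD (hQ ω i))
    fun i j hij => ?_).mono fun j _ => le_of_eq (by ring)
  have := mul_le_mul_of_nonneg_left (hm ω i j hij) (mul_nonneg hC hD)
  linarith

lemma Tame.mul_bdd (hu : Tame W u) (hv : Bdd k H v) (hW : GoodW W) (hH : ∀ ω j, 0 ≤ H ω j)
    (hm : Modl k W H) : Bdd k H (fun ω y => u ω y * v ω y) :=
  (hu k).mul hv hW.nonneg hH hm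

lemma Modl.of_le {l : ℕ} (h : Modl k W H) (hl : l ≤ k) : Modl l W H := by
  obtain ⟨C, hC, h⟩ := h
  exact ⟨C, hC, fun ω i j hij => h ω i j (by omega)⟩

lemma Modl.succ (h : Modl (k + 1) W H) : Modl k W (fun ω j => H ω (j + 1)) := by
  obtain ⟨C, hC, h⟩ := h
  exact ⟨C, hC, fun ω i j hij => h ω i (j + 1) (by omega)⟩

end

/-- The weight `H`, enlarged by `θ` at orders at least `k`. -/
def topw (k : ℕ) (H : ℕ → ℝ) (θ : ℝ) (j : ℕ) : ℝ := H j + if k ≤ j then θ else 0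

lemma topw_nonneg {k : ℕ} {H : ℕ → ℝ} {θ : ℝ} (hH : ∀ j, 0 ≤ H j) (hθ : 0 ≤ θ) (j : ℕ) :
    0 ≤ topw k H θ j := by
  unfold topw; split_ifs <;> linarith [hH j]

lemma le_topw {k : ℕ} {H : ℕ → ℝ} {θ : ℝ} (hθ : 0 ≤ θ) (j : ℕ) : H j ≤ topw k H θ j := by
  unfold topw; split_ifs <;> linarith

lemma topw_succ {k : ℕ} {H : ℕ → ℝ} {θ : ℝ} (j : ℕ) :
    topw (k + 1) H θ (j + 1) = topw k (fun j => H (j + 1)) θ j := by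
  simp [topw]

lemma Modl.topw {ι κ : Type} {k : ℕ} {W H : ι → ℕ → ℝ} (hW : ∃ C, ∀ ω, W ω 0 ≤ C)
    (h : Modl (k + 1) W H) (f : κ → ι) {K θ : κ → ℝ} (hK : ∀ ω, 0 ≤ K ω) (hθ : ∀ ω, 0 ≤ θ ω)
    (hH : ∀ ω j, 0 ≤ H ω j) :
    Modl (k + 1) (fun ω => W (f ω)) (fun ω => topw k (fun j => K ω * H (f ω) j) (θ ω)) := by
  obtain ⟨C, hC, h⟩ := h
  obtain ⟨D, hD⟩ := hW
  refine ⟨C + |D|, by positivity, fun ω i j hij => ?_⟩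
  have h1 := mul_le_mul_of_nonneg_left (h (f ω) i j hij) (hK ω)
  have h2 : 0 ≤ |D| * (K ω * H (f ω) (i + j)) := by have := hK ω; have := hH (f ω) (i + j); positivity
  have h3 := hθ ω
  have h4 : 0 ≤ |D| * θ ω := by positivity
  have h5 : 0 ≤ C * θ ω := by positivity
  simp only [_root_.topw]
  by_cases hj : k ≤ j
  · obtain rfl : i = 0 := by omega
    rw [if_pos hj, if_pos (by omega)]
    have : W (f ω) 0 * θ ω ≤ |D| * θ ω :=
      mul_le_mul_of_nonneg_right ((hD _).trans (le_abs_self D)) h3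
    linarith
  · rw [if_neg hj]
    split_ifs <;> linarith

/-- A function vanishing on the sphere has vanishing tangential derivatives there. -/
lemma fderiv_tangential {u : E' n → ℝ} (hu : ContDiff ℝ (⊤ : ℕ∞) u)
    (hbd : ∀ y ∈ Sphere' n, u y = 0) {y v : E' n} (hy : y ∈ Sphere' n) (hv : inner ℝ y v = (0 : ℝ)) :
    fderiv ℝ u y v = 0 := by
  rcases eq_or_ne v 0 with rfl | hv0
  · simp
  have hvn : 0 < ‖v‖ := norm_pos_iff.2 hv0
  set e := ‖v‖⁻¹ • v with he
  have hen : ‖e‖ = 1 := by rw [he, norm_smul, norm_inv, norm_norm, inv_mul_cancel₀ hvn.ne']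
  have hve : v = ‖v‖ • e := by rw [he, smul_smul, mul_inv_cancel₀ hvn.ne', one_smul]
  have hye : inner ℝ y e = (0 : ℝ) := by rw [he, real_inner_smul_right, hv, mul_zero]
  have hyn := mem_sphere_iff.1 hy
  have hγ : HasDerivAt (fun t : ℝ => Real.cos t • y + Real.sin t • e) e 0 := by
    have h1 := ((Real.hasDerivAt_cos 0).smul_const y).fun_add
      ((Real.hasDerivAt_sin 0).smul_const e)
    exact h1.congr_deriv (by simp)
  have hs : ∀ t : ℝ, u (Real.cos t • y + Real.sin t • e) = 0 := by
    intro t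
    refine hbd _ (mem_sphere_iff.2 ?_)
    have : ‖Real.cos t • y + Real.sin t • e‖ ^ 2 = 1 := by
      rw [norm_add_sq_real, real_inner_smul_left, real_inner_smul_right, hye, norm_smul, norm_smul,
        hyn, hen]
      simp
    exact (pow_eq_one_iff_of_nonneg (norm_nonneg _) two_ne_zero).1 this
  have hd : HasFDerivAt u (fderiv ℝ u y) (Real.cos 0 • y + Real.sin 0 • e) := by
    simpa using (hu.differentiable (by simp) y).hasFDerivAt
  have hc := hd.comp_hasDerivAt (0 : ℝ) hγ
  have h0 : (u ∘ fun t : ℝ => Real.cos t • y + Real.sin t • e) = fun _ => 0 := funext hs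
  rw [h0] at hc
  have := hc.unique (hasDerivAt_const (0 : ℝ) (0 : ℝ))
  rw [hve, map_smul, this, smul_zero]

/-- Commutator of the second order operator with a vector field. -/
lemma Lop_vectorField {A : Fin n → Fin n → E' n → ℝ} {b : Fin n → E' n → ℝ}
    {s : Fin n → E' n → ℝ} {u : E' n → ℝ} (hA : ∀ a c, Sm (A a c)) (hb : ∀ a, Sm (b a))
    (hs : ∀ l, ContDiff ℝ (⊤ : ℕ∞) (s l)) (hu : ContDiff ℝ (⊤ : ℕ∞) u) {y : E' n}
    (hy : y ∈ Ball n) :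
    Lop A b (fun z => ∑ l, s l z * pd l u z) y =
      ∑ l, (s l y * pd l (Lop A b u) y
        + (∑ a, ∑ c, (A a c y * pd c (s l) y * pd a (pd l u) y
            + A a c y * pd a (s l) y * pd c (pd l u) y
            + A a c y * pd a (pd c (s l)) y * pd l u y
            - s l y * pd l (A a c) y * pd a (pd c u) y)
          + ∑ a, (b a y * pd a (s l) y * pd l u y - s l y * pd l (b a) y * pd a u y))) := by
  have dd : ∀ {w : E' n → ℝ}, ContDiff ℝ (⊤ : ℕ∞) w → ∀ z, DifferentiableAt ℝ w z :=
    fun h z => h.differentiable (by simp) z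
  have h1 : ∀ c, pd c (fun z => ∑ l, s l z * pd l u z) =
      fun z => ∑ l, (pd c (s l) z * pd l u z + s l z * pd c (pd l u) z) := by
    intro c; ext1 z
    rw [pd_sum fun l _ => (dd (hs l) z).fun_mul (dd (hu.pd l) z)]
    exact Finset.sum_congr rfl fun l _ => pd_mul (dd (hs l) z) (dd (hu.pd l) z) c
  have h2 : ∀ a c, pd a (pd c (fun z => ∑ l, s l z * pd l u z)) y =
      ∑ l, (pd a (pd c (s l)) y * pd l u y + pd c (s l) y * pd a (pd l u) y
        + pd a (s l) y * pd c (pd l u) y + s l y * pd l (pd a (pd c u)) y) := by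
    intro a c
    have e1 := fun l => dd ((hs l).pd c) y
    have e2 := fun l => dd (hu.pd l) y
    have e3 := fun l => dd (hs l) y
    have e4 := fun l => dd ((hu.pd l).pd c) y
    rw [h1, pd_sum fun l _ => ((e1 l).fun_mul (e2 l)).fun_add ((e3 l).fun_mul (e4 l))]
    refine Finset.sum_congr rfl fun l _ => ?_
    rw [pd_add ((e1 l).fun_mul (e2 l)) ((e3 l).fun_mul (e4 l)), pd_mul (e1 l) (e2 l), pd_mul (e3 l) (e4 l)]
    have e5 : pd a (pd c (pd l u)) y = pd l (pd a (pd c u)) y := by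
      have : pd c (pd l u) = pd l (pd c u) := funext fun z => pd_comm hu.contDiffAt c l
      rw [this, pd_comm (hu.pd c).contDiffAt]
    rw [e5]; ring
  have dA := fun a c => (hA a c).differentiableAt hy
  have db := fun a => (hb a).differentiableAt hy
  have h3 : ∀ l, pd l (Lop A b u) y =
      ∑ a, ∑ c, (pd l (A a c) y * pd a (pd c u) y + A a c y * pd l (pd a (pd c u)) y)
      + ∑ a, (pd l (b a) y * pd a u y + b a y * pd a (pd l u) y) := by
    intro l
    have e1 := fun a c => (dA a c).fun_mul (dd ((hu.pd c).pd a) y)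
    have e2 := fun a => (db a).fun_mul (dd (hu.pd a) y)
    have e3 := fun a => DifferentiableAt.fun_sum (u := Finset.univ) fun c _ => e1 a c
    unfold Lop
    rw [pd_add (DifferentiableAt.fun_sum fun a _ => e3 a) (DifferentiableAt.fun_sum fun a _ => e2 a),
      pd_sum (fun a _ => e3 a), pd_sum (fun a _ => e2 a)]
    congr 1
    · refine Finset.sum_congr rfl fun a _ => ?_
      rw [pd_sum fun c _ => e1 a c]
      exact Finset.sum_congr rfl fun c _ => pd_mul (dA a c) (dd ((hu.pd c).pd a) y) l
    · refine Finset.sum_congr rfl fun a _ => ?_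
      rw [pd_mul (db a) (dd (hu.pd a) y), pd_comm hu.contDiffAt l a]
  simp only [h3]
  rw [Lop]
  simp only [h2]
  simp only [h1, Finset.mul_sum]
  have c1 : ∀ f : Fin n → Fin n → Fin n → ℝ, ∑ a, ∑ c, ∑ l, f a c l = ∑ l, ∑ a, ∑ c, f a c l := by
    intro f
    rw [Finset.sum_comm' (s := Finset.univ) (t := fun _ => Finset.univ) (s' := fun _ => Finset.univ)
      (t' := Finset.univ) (f := fun l a => ∑ c, f a c l) (by simp)]
    exact Finset.sum_congr rfl fun a _ => Finset.sum_comm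
  rw [c1, Finset.sum_comm (f := fun a l => b a y * _), ← Finset.sum_add_distrib]
  refine Finset.sum_congr rfl fun l _ => ?_
  rw [mul_add, Finset.mul_sum, Finset.mul_sum]
  simp only [Finset.mul_sum]
  rw [show ∀ p q r t : ℝ, p + q + (r + t) = (p + r) + (q + t) by intros; ring]
  simp only [← Finset.sum_add_distrib]
  refine Finset.sum_congr rfl fun a _ => ?_
  congr 1
  · exact Finset.sum_congr rfl fun c _ => by ring
  · ring

lemma Tame.inv {ι : Type} {W : ι → ℕ → ℝ} {m : ι → E' n → ℝ} (hW : GoodW W) (hm : Tame W m)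
    {c : ℝ} (hc : 0 < c) (h : ∀ ω, ∀ y ∈ Ball n, c ≤ m ω y) :
    Tame W (fun ω y => (m ω y)⁻¹) := by
  have h0 : ∀ ω, ∀ y ∈ Ball n, m ω y ≠ 0 := fun ω y hy => (hc.trans_le (h ω y hy)).ne'
  have hs : ∀ ω, Sm (fun y => (m ω y)⁻¹) := fun ω => (hm.sm ω).inv (h0 ω)
  intro k
  induction k with
  | zero => exact ⟨hs, 0, le_rfl, fun _ => trivial⟩
  | succ k ih =>
    refine Bdd.succ (bdd_one_of_le hs (inv_nonneg.2 hc.le) fun ω y hy => ?_) hW.nonneg fun a => ?_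
    · rw [abs_inv, abs_of_pos (hc.trans_le (h ω y hy))]
      exact (inv_anti₀ hc (h ω y hy)).trans
        (le_mul_of_one_le_right (inv_nonneg.2 hc.le) (hW.one_le ω 0))
    · have hw := (hW.modl (k + 1)).succ
      have h1 := ih.mul ((hm (k + 1)).pd a) hW.nonneg (fun ω j => hW.nonneg ω (j + 1)) hw
      have h2 := (ih.mul h1 hW.nonneg (fun ω j => hW.nonneg ω (j + 1)) hw).neg
      refine h2.congr (fun ω => (hs ω).pd a) fun ω y hy => ?_
      rw [pd_inv ((hm.sm ω).differentiableAt hy) (h0 ω y hy)]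
      field_simp

lemma EllFam.comp {ι κ : Type} {W : ι → ℕ → ℝ} {A : Fin n → Fin n → ι → E' n → ℝ}
    {b : Fin n → ι → E' n → ℝ} (h : EllFam W A b) (f : κ → ι) :
    EllFam (fun ω => W (f ω)) (fun a c ω => A a c (f ω)) (fun a ω => b a (f ω)) where
  good := ⟨fun ω => h.good.one_le _, fun ω => h.good.mono _, fun k => by
    obtain ⟨C, hC, h⟩ := h.good.modl k
    exact ⟨C, hC, fun ω => h _⟩⟩
  bdd_zero := by
    obtain ⟨C, h⟩ := h.bdd_zero
    exact ⟨C, fun ω => h _⟩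
  tame_A a c k := (h.tame_A a c k).comp f
  tame_pdA a c l k := (h.tame_pdA a c l k).comp f
  tame_b a k := (h.tame_b a k).comp f
  ell := by
    obtain ⟨C, hC, h⟩ := h.ell
    exact ⟨C, hC, fun ω => h _⟩
  sup := by
    obtain ⟨C, hC, h⟩ := h.sup
    exact ⟨C, hC, fun ω => h _⟩
  grad := by
    obtain ⟨C, d, hC, hd, h⟩ := h.grad
    exact ⟨C, d, hC, hd, fun ω => h _⟩

/-- Coefficients of the tangential projection. -/
def tanS (k l : Fin n) (z : E' n) : ℝ := (if k = l then 1 else 0) - z k * z l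

/-- Tangential derivatives. -/
def tanD (k : Fin n) (u : E' n → ℝ) (z : E' n) : ℝ := ∑ l, tanS k l z * pd l u z

lemma contDiff_tanS (k l : Fin n) : ContDiff ℝ (⊤ : ℕ∞) (tanS k l : E' n → ℝ) :=
  contDiff_const.sub ((contDiff_coord k).mul (contDiff_coord l))

lemma ContDiff.tanD {u : E' n → ℝ} (hu : ContDiff ℝ (⊤ : ℕ∞) u) (k : Fin n) :
    ContDiff ℝ (⊤ : ℕ∞) (tanD k u) :=
  ContDiff.sum fun l _ => (contDiff_tanS k l).mul (hu.pd l)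

lemma tanD_sphere {u : E' n → ℝ} (hu : ContDiff ℝ (⊤ : ℕ∞) u)
    (hbd : ∀ y ∈ Sphere' n, u y = 0) (k : Fin n) : ∀ y ∈ Sphere' n, tanD k u y = 0 := by
  intro y hy
  have h1 : tanD k u y = fderiv ℝ u y (WithLp.toLp 2 fun l => tanS k l y) := by
    rw [fderiv_eq_sum_pd]; rfl
  rw [h1]
  refine fderiv_tangential hu hbd hy ?_
  have h2 : ∑ l, y l * y l = 1 := by
    have := EuclideanSpace.norm_sq_eq y
    rw [mem_sphere_iff.1 hy] at this
    simpa [sq] using this.symm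
  rw [real_inner_comm, inner_toLp]
  simp only [tanS, sub_mul, Finset.sum_sub_distrib, ite_mul, one_mul, zero_mul, Finset.sum_ite_eq,
    Finset.mem_univ, if_true, mul_assoc, ← Finset.mul_sum, h2]
  ring

lemma pd_tanD {u : E' n → ℝ} (hu : ContDiff ℝ (⊤ : ℕ∞) u) (j k : Fin n) (y : E' n) :
    pd j (tanD k u) y = pd j (pd k u) y - (if j = k then 1 else 0) * ∑ l, y l * pd l u y
      - y k * pd j u y - y k * ∑ l, y l * pd j (pd l u) y := by
  have dd : ∀ {w : E' n → ℝ}, ContDiff ℝ (⊤ : ℕ∞) w → DifferentiableAt ℝ w y :=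
    fun h => h.differentiable (by simp) y
  have hs : ∀ l, pd j (tanS k l) y = -((if j = k then 1 else 0) * y l
      + y k * (if j = l then 1 else 0)) := by
    intro l
    unfold tanS
    rw [pd_sub (differentiableAt_const _)
      ((dd (contDiff_coord k)).fun_mul (dd (contDiff_coord l))), pd_const,
      pd_mul (dd (contDiff_coord k)) (dd (contDiff_coord l)), pd_coord, pd_coord]
    ring
  unfold tanD
  rw [pd_sum fun l _ => (dd (contDiff_tanS k l)).fun_mul (dd (hu.pd l))]
  have h1 : ∀ l, pd j (fun z => tanS k l z * pd l u z) y =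
      -((if j = k then 1 else 0) * (y l * pd l u y)) - (if j = l then y k * pd l u y else 0)
        + (if k = l then pd j (pd l u) y else 0) - y k * (y l * pd j (pd l u) y) := by
    intro l
    rw [pd_mul (dd (contDiff_tanS k l)) (dd (hu.pd l)), hs, tanS]
    split_ifs <;> ring
  simp only [h1, Finset.sum_add_distrib, Finset.sum_sub_distrib, Finset.sum_neg_distrib,
    ← Finset.mul_sum, Finset.sum_ite_eq, Finset.mem_univ, if_true]
  ring

/-- Recovering all second derivatives from the tangential ones: first part. -/
lemma recover_mixed {D dv : Fin n → Fin n → ℝ} {p y : Fin n → ℝ} {N q : ℝ}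
    (hD : ∀ j k, D j k = D k j) (hN : N = ∑ l, y l * p l)
    (hq : q = ∑ j, y j * ∑ l, y l * D j l + N)
    (hdv : ∀ j k, dv j k = D j k - (if j = k then 1 else 0) * N - y k * p j
      - y k * ∑ l, y l * D j l) :
    ∀ j k, D j k = dv j k + (if j = k then 1 else 0) * N + y k * p j
      + y k * ∑ l, y l * dv l j + y k * y j * N + y k * y j * q := by
  have h1 : ∀ j, ∑ l, y l * dv l j = ∑ l, y l * D j l - y j * N - y j * q := by
    intro j
    simp only [hdv, mul_sub, Finset.sum_sub_distrib]
    have e1 : ∑ x, y x * D x j = ∑ l, y l * D j l :=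
      Finset.sum_congr rfl fun l _ => by rw [hD]
    have e2 : ∑ x, y x * ((if x = j then 1 else 0) * N) = y j * N := by simp
    have e3 : ∑ x, y x * (y j * p x) = y j * N := by
      rw [hN, Finset.mul_sum]; exact Finset.sum_congr rfl fun l _ => by ring
    have e4 : ∑ x, y x * (y j * ∑ l, y l * D x l) = y j * ∑ x, y x * ∑ l, y l * D x l := by
      rw [Finset.mul_sum]; exact Finset.sum_congr rfl fun l _ => by ring
    rw [e1, e2, e3, e4, hq]; ring
  intro j k
  rw [h1, hdv]; ring

/-- Recovering all second derivatives from the tangential ones: the doubly radial derivative. -/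
lemma recover_radial {D dv A : Fin n → Fin n → ℝ} {p y : Fin n → ℝ} {N q : ℝ}
    (hD : ∀ j k, D j k = D k j) (hN : N = ∑ l, y l * p l)
    (hq : q = ∑ j, y j * ∑ l, y l * D j l + N)
    (hdv : ∀ j k, dv j k = D j k - (if j = k then 1 else 0) * N - y k * p j
      - y k * ∑ l, y l * D j l) :
    (∑ j, ∑ k, A j k * (y j * y k) + (1 - ∑ l, y l * y l)) * q =
      ∑ j, ∑ k, A j k * D j k
        - ∑ j, ∑ k, A j k * (dv j k + (if j = k then 1 else 0) * N + y k * p j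
          + y k * ∑ l, y l * dv l j + y k * y j * N)
        + ∑ j, y j * ∑ l, y l * dv l j + (1 + ∑ l, y l * y l) * N := by
  have h0 := recover_mixed hD hN hq hdv
  have h1 : ∑ j, ∑ k, A j k * D j k = ∑ j, ∑ k, A j k * (dv j k + (if j = k then 1 else 0) * N
      + y k * p j + y k * ∑ l, y l * dv l j + y k * y j * N)
      + (∑ j, ∑ k, A j k * (y j * y k)) * q := by
    simp only [Finset.sum_mul, ← Finset.sum_add_distrib]
    refine Finset.sum_congr rfl fun j _ => Finset.sum_congr rfl fun k _ => ?_
    rw [h0 j k]; ring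
  have h2 : ∀ j, ∑ l, y l * dv l j = ∑ l, y l * D j l - y j * N - y j * q := by
    intro j
    simp only [hdv, mul_sub, Finset.sum_sub_distrib]
    have e1 : ∑ x, y x * D x j = ∑ l, y l * D j l :=
      Finset.sum_congr rfl fun l _ => by rw [hD]
    have e2 : ∑ x, y x * ((if x = j then 1 else 0) * N) = y j * N := by simp
    have e3 : ∑ x, y x * (y j * p x) = y j * N := by
      rw [hN, Finset.mul_sum]; exact Finset.sum_congr rfl fun l _ => by ring
    have e4 : ∑ x, y x * (y j * ∑ l, y l * D x l) = y j * ∑ x, y x * ∑ l, y l * D x l := by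
      rw [Finset.mul_sum]; exact Finset.sum_congr rfl fun l _ => by ring
    rw [e1, e2, e3, e4, hq]; ring
  have h3 : ∑ j, y j * ∑ l, y l * dv l j = q - N - (∑ l, y l * y l) * N - (∑ l, y l * y l) * q := by
    have e1 : ∑ j, y j * ∑ l, y l * D j l = q - N := by rw [hq]; ring
    rw [← e1]
    simp only [h2, mul_sub, Finset.sum_sub_distrib, ← mul_assoc, Finset.sum_mul]
  rw [h1, h3]; ring

section

variable {ι : Type} {W H : ι → ℕ → ℝ} {A : Fin n → Fin n → ι → E' n → ℝ}
  {b : Fin n → ι → E' n → ℝ} {u : ι → E' n → ℝ}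

lemma tame_tanS (hW : GoodW W) (k l : Fin n) : Tame W (fun _ => (tanS k l : E' n → ℝ)) :=
  Tame.of_contDiff hW (contDiff_tanS k l)

/-- All second derivatives are controlled by the tangential ones and the operator. -/
lemma EllFam.second_deriv (h : EllFam W A b) {k : ℕ} (hu : ∀ ω, ContDiff ℝ (⊤ : ℕ∞) (u ω))
    (hH : ∀ ω j, 0 ≤ H ω j) (hm : Modl k W H) (h1 : ∀ a, Bdd k H (fun ω => pd a (u ω)))
    (hv : ∀ a c, Bdd k H (fun ω => pd a (tanD c (u ω))))
    (hL : Bdd k H (fun ω => Lop (fun a c => A a c ω) (fun a => b a ω) (u ω))) (a c : Fin n) :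
    Bdd k H (fun ω => pd a (pd c (u ω))) := by
  have hW := h.good
  have tm : ∀ {f v : ι → E' n → ℝ}, Tame W f → Bdd k H v → Bdd k H (fun ω y => f ω y * v ω y) :=
    fun hf hv => hf.mul_bdd hv hW hH hm
  have ty := fun a : Fin n => Tame.coord (n := n) (ι := ι) hW a
  have tr : Tame W (fun (_ : ι) (y : E' n) => ∑ l, y l * y l) :=
    Tame.sum fun l _ => (ty l).mul hW (ty l)
  have t1 : Tame W (fun (_ : ι) (_ : E' n) => (1 : ℝ)) := Tame.const hW 1
  set m : ι → E' n → ℝ := fun ω y =>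
    ∑ j, ∑ k, A j k ω y * (y j * y k) + (1 - ∑ l, y l * y l) with hmdef
  have tmm : Tame W m := (Tame.sum fun j _ => Tame.sum fun k _ =>
    (h.tame_A j k).mul hW ((ty j).mul hW (ty k))).add (t1.sub tr)
  obtain ⟨lam, hl, hell⟩ := h.ell
  have hnorm : ∀ y : E' n, ∑ l, y l * y l = ‖y‖ ^ 2 := fun y => by
    rw [EuclideanSpace.norm_sq_eq]; simp [sq]
  have hmpos : ∀ ω, ∀ y ∈ Ball n, min lam 1 ≤ m ω y := by
    intro ω y hy
    have e1 := hell ω y hy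
    have e2 : ‖y‖ ^ 2 ≤ 1 := by
      have := mem_ball_iff.1 hy
      have := norm_nonneg y
      nlinarith
    have e3 : min lam 1 ≤ lam := min_le_left _ _
    have e4 : min lam 1 ≤ 1 := min_le_right _ _
    simp only [hmdef, hnorm]
    nlinarith [sq_nonneg ‖y‖]
  have tinv := tmm.inv hW (lt_min hl one_pos) hmpos
  set N : ι → E' n → ℝ := fun ω y => ∑ l, y l * pd l (u ω) y with hN
  have bN : Bdd k H N := Bdd.sum fun l _ => tm (ty l) (h1 l)
  set Nv : Fin n → ι → E' n → ℝ := fun j ω y => ∑ l, y l * pd l (tanD j (u ω)) y with hNv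
  have bNv : ∀ j, Bdd k H (Nv j) := fun j => Bdd.sum fun l _ => tm (ty l) (hv l j)
  set X : Fin n → Fin n → ι → E' n → ℝ := fun j k ω y => pd j (tanD k (u ω)) y
    + (if j = k then 1 else 0) * N ω y + y k * pd j (u ω) y + y k * Nv j ω y
    + y k * (y j * N ω y) with hX
  have bX : ∀ j k, Bdd _ H (X j k) := fun j k =>
    ((((hv j k).add (tm (Tame.const hW _) bN)).add (tm (ty k) (h1 j))).add
      (tm (ty k) (bNv j))).add (tm (ty k) (tm (ty j) bN))
  set R : ι → E' n → ℝ := fun ω y => Lop (fun a c => A a c ω) (fun a => b a ω) (u ω) y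
    - ∑ a, b a ω y * pd a (u ω) y - ∑ j, ∑ k, A j k ω y * X j k ω y + ∑ j, y j * Nv j ω y
    + (1 + ∑ l, y l * y l) * N ω y with hR
  have bR : Bdd k H R :=
    (((hL.sub (Bdd.sum fun a _ => tm (h.tame_b a) (h1 a))).sub (Bdd.sum fun j _ => Bdd.sum
      fun k _ => tm (h.tame_A j k) (bX j k))).add (Bdd.sum fun j _ => tm (ty j) (bNv j))).add
      (tm (t1.add tr) bN)
  refine ((bX a c).add (tm (ty c) (tm (ty a) (tm tinv bR)))).congr
    (fun ω => (((hu ω).pd c).pd a).sm) fun ω y hy => ?_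
  have hD : ∀ j k, pd j (pd k (u ω)) y = pd k (pd j (u ω)) y :=
    fun j k => pd_comm (hu ω).contDiffAt j k
  have hdv := fun j k => pd_tanD (hu ω) j k y
  have r1 := recover_mixed (D := fun j k => pd j (pd k (u ω)) y)
    (dv := fun j k => pd j (tanD k (u ω)) y) (y := fun l => y l) hD rfl rfl hdv a c
  have r2 := recover_radial (A := fun j k => A j k ω y) (D := fun j k => pd j (pd k (u ω)) y)
    (dv := fun j k => pd j (tanD k (u ω)) y) (y := fun l => y l) hD rfl rfl hdv
  have hm0 : m ω y ≠ 0 := ((lt_min hl one_pos).trans_le (hmpos ω y hy)).ne'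
  set q := ∑ j, y j * ∑ l, y l * pd j (pd l (u ω)) y + ∑ l, y l * pd l (u ω) y with hq
  have r3 : m ω y * q = R ω y := by
    simp only [hmdef, r2, hR, hX, hN, hNv, Lop]
    have : ∀ p q r s t t' : ℝ, t = t' → p - t + r + s = p + q - q - t' + r + s := by
      intros; subst_vars; ring
    refine this _ _ _ _ _ _ ?_
    refine Finset.sum_congr rfl fun j _ => Finset.sum_congr rfl fun k _ => by ring
  have r4 : (m ω y)⁻¹ * R ω y = q := by rw [← r3, inv_mul_cancel_left₀ hm0]
  show X a c ω y + y c * (y a * ((m ω y)⁻¹ * R ω y)) = pd a (pd c (u ω)) y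
  rw [r4]
  simp only [hX, hN, hNv]
  refine Eq.trans ?_ r1.symm
  simp only [hq]
  ring

end

section

variable {ι : Type} {W H : ι → ℕ → ℝ} {A : Fin n → Fin n → ι → E' n → ℝ}
  {b : Fin n → ι → E' n → ℝ} {u : ι → E' n → ℝ}

lemma topw_mono_right {k j : ℕ} {H : ℕ → ℝ} {θ θ' : ℝ} (h : θ ≤ θ') :
    topw k H θ j ≤ topw k H θ' j := by
  unfold topw; split_ifs <;> linarith

lemma sm_Lop (h : EllFam W A b) {ω : ι} {u : E' n → ℝ} (hu : ContDiff ℝ (⊤ : ℕ∞) u) :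
    Sm (Lop (fun a c => A a c ω) (fun a => b a ω) u) :=
  (Sm.sum fun a _ => Sm.sum fun c _ => ((h.tame_A a c).sm ω).mul ((hu.pd c).pd a).sm).add
    (Sm.sum fun a _ => ((h.tame_b a).sm ω).mul (hu.pd a).sm)

/-- Weighted bounds for the operator applied to a tangential derivative. -/
lemma EllFam.lop_tanD (h : EllFam W A b) {k : ℕ} {θ Θ : ι → ℝ}
    (hu : ∀ ω, ContDiff ℝ (⊤ : ℕ∞) (u ω)) (hH : ∀ ω j, 0 ≤ H ω j)
    (hmono : ∀ ω j, H ω j ≤ H ω (j + 1)) (hθ : ∀ ω, 0 ≤ θ ω) (hΘ : ∀ ω, 0 ≤ Θ ω)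
    (hm : Modl (k + 2) W H) (h1 : ∀ a, Bdd (k + 1) H (fun ω => pd a (u ω)))
    (h2 : ∀ a, Bdd (k + 2) (fun ω => topw (k + 1) (H ω) (Θ ω)) (fun ω => pd a (u ω)))
    (hL : Bdd (k + 2) (fun ω => topw (k + 1) (H ω) (θ ω))
      (fun ω => Lop (fun a c => A a c ω) (fun a => b a ω) (u ω))) (j : Fin n) :
    Bdd (k + 1) (fun ω => topw k (fun i => H ω (i + 1)) (θ ω + Θ ω))
      (fun ω => Lop (fun a c => A a c ω) (fun a => b a ω) (tanD j (u ω))) := by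
  have hW := h.good
  set G : ι → ℕ → ℝ := fun ω => topw k (fun i => H ω (i + 1)) (θ ω + Θ ω) with hG
  have hs : ∀ ω, 0 ≤ θ ω + Θ ω := fun ω => add_nonneg (hθ ω) (hΘ ω)
  have hG0 : ∀ ω i, 0 ≤ G ω i := fun ω i => topw_nonneg (fun i => hH ω (i + 1)) (hs ω) i
  have hmG : Modl (k + 1) W G := by
    have := Modl.topw h.bdd_zero hm.succ (fun ω : ι => ω) (K := fun _ => 1) (θ := fun ω => θ ω + Θ ω)
      (fun _ => zero_le_one) hs (fun ω j => hH ω (j + 1))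
    simpa only [one_mul] using this
  have tm : ∀ {f v : ι → E' n → ℝ}, Tame W f → Bdd (k + 1) G v →
      Bdd (k + 1) G (fun ω y => f ω y * v ω y) := fun hf hv => hf.mul_bdd hv hW hG0 hmG
  have b1 : ∀ a, Bdd (k + 1) G (fun ω => pd a (u ω)) := fun a =>
    (h1 a).mono_one fun ω i _ => (hmono ω i).trans (le_topw (H := fun i => H ω (i + 1)) (hs ω) i)
  have b2 : ∀ a c, Bdd (k + 1) G (fun ω => pd a (pd c (u ω))) := fun a c =>
    ((h2 c).pd a).mono_one fun ω i _ => by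
      rw [topw_succ]; exact topw_mono_right (le_add_of_nonneg_left (hθ ω))
  have bL : ∀ l, Bdd (k + 1) G
      (fun ω => pd l (Lop (fun a c => A a c ω) (fun a => b a ω) (u ω))) := fun l =>
    (hL.pd l).mono_one fun ω i _ => by
      rw [topw_succ]; exact topw_mono_right (le_add_of_nonneg_right (hΘ ω))
  have bb : ∀ l a, Bdd (k + 1) G (fun ω y => pd l (b a ω) y * pd a (u ω) y) := fun l a => by
    have e : Bdd (k + 1) (fun ω i => H ω (i + 1)) (fun ω y => pd l (b a ω) y * pd a (u ω) y) := by
      refine Bdd.mul_of_le ((h.tame_b a (k + 2)).pd l) (h1 a) (fun ω i => hW.nonneg ω _) hH ?_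
      obtain ⟨C, hC, hm⟩ := hm
      refine ⟨C, hC, fun ω i j hij => ?_⟩
      have := hm ω (i + 1) j (by omega)
      rwa [show i + 1 + j = i + j + 1 by omega] at this
    exact e.mono_one fun ω i _ => le_topw (H := fun i => H ω (i + 1)) (hs ω) i
  have ts := fun l => tame_tanS (n := n) hW j l
  have ts1 := fun l a => Tame.of_contDiff hW ((contDiff_tanS (n := n) j l).pd a)
  have ts2 := fun l a c => Tame.of_contDiff hW (((contDiff_tanS (n := n) j l).pd c).pd a)
  have key : Bdd (k + 1) G (fun ω y => ∑ l, (tanS j l y *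
      pd l (Lop (fun a c => A a c ω) (fun a => b a ω) (u ω)) y
        + (∑ a, ∑ c, ((A a c ω y * pd c (tanS j l) y) * pd a (pd l (u ω)) y
            + (A a c ω y * pd a (tanS j l) y) * pd c (pd l (u ω)) y
            + (A a c ω y * pd a (pd c (tanS j l)) y) * pd l (u ω) y
            - (tanS j l y * pd l (A a c ω) y) * pd a (pd c (u ω)) y)
          + ∑ a, ((b a ω y * pd a (tanS j l) y) * pd l (u ω) y
            - tanS j l y * (pd l (b a ω) y * pd a (u ω) y))))) := by
    refine Bdd.sum fun l _ => (tm (ts l) (bL l)).add ((Bdd.sum fun a _ => Bdd.sum fun c _ =>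
      (((tm ((h.tame_A a c).mul hW (ts1 l c)) (b2 a l)).add
        (tm ((h.tame_A a c).mul hW (ts1 l a)) (b2 c l))).add
        (tm ((h.tame_A a c).mul hW (ts2 l a c)) (b1 l))).sub
        (tm ((ts l).mul hW (h.tame_pdA a c l)) (b2 a c))).add (Bdd.sum fun a _ =>
        (tm ((h.tame_b a).mul hW (ts1 l a)) (b1 l)).sub (tm (ts l) (bb l a))))
  refine key.congr (fun ω => sm_Lop h ((hu ω).tanD j)) fun ω y hy => ?_
  have := Lop_vectorField (A := fun a c => A a c ω) (b := fun a => b a ω) (s := tanS j)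
    (fun a c => (h.tame_A a c).sm ω) (fun a => (h.tame_b a).sm ω) (contDiff_tanS j) (hu ω) hy
  refine Eq.trans ?_ this.symm
  simp only [mul_assoc]

end

/-- Uniform choice of the constant for finitely many bounded families. -/
lemma Bdd.exists_uniform {ι α : Type} [Fintype α] {k : ℕ} {H : ι → ℕ → ℝ} (hH : ∀ ω j, 0 ≤ H ω j)
    {u : α → ι → E' n → ℝ} (h : ∀ a, Bdd k H (u a)) :
    ∃ C, 0 ≤ C ∧ ∀ ω a, Wt k (fun j => C * H ω j) (u a ω) := by
  choose C hC hw using fun a => (h a).2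
  refine ⟨∑ a, C a, Finset.sum_nonneg fun a _ => hC a, fun ω a => (hw a ω).mono fun j _ => ?_⟩
  exact mul_le_mul_of_nonneg_right
    (Finset.single_le_sum (fun b _ => hC b) (Finset.mem_univ a)) (hH ω j)

/-- Nearly optimal top order bounds. -/
lemma exists_near_optimal {k : ℕ} {H : ℕ → ℝ} (hH : ∀ j, 0 < H j) {α : Type} [Fintype α]
    {w : α → E' n → ℝ} (sw : ∀ a, Sm (w a)) (hw : ∀ a, Wt (k + 1) H (w a)) {ε : ℝ} (hε : 0 < ε) :
    ∃ Θ, 0 ≤ Θ ∧ (∀ a, Wt (k + 2) (topw (k + 1) H Θ) (w a)) ∧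
      ∀ M, 0 ≤ M → (∀ a, Wt (k + 2) (topw (k + 1) H M) (w a)) → Θ ≤ M + ε := by
  set T : Set ℝ := {M | 0 ≤ M ∧ ∀ a, Wt (k + 2) (topw (k + 1) H M) (w a)} with hT
  have hne : T.Nonempty := by
    choose D hD hd using fun a => Sm.exists_wt (k + 2) (sw a)
    refine ⟨∑ a, D a, Finset.sum_nonneg fun a _ => hD a, fun a => ?_⟩
    refine (hw a).combine (hd a) fun j hj => ?_
    rcases Nat.lt_or_ge j (k + 1) with h | h
    · refine Or.inl ⟨h, le_topw (Finset.sum_nonneg fun a _ => hD a) j⟩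
    · right
      have := Finset.single_le_sum (fun b _ => hD b) (Finset.mem_univ a)
      have := hH j
      rw [topw, if_pos h]; linarith
  have hbb : BddBelow T := ⟨0, fun M hM => hM.1⟩
  obtain ⟨Θ, hΘ, hlt⟩ := exists_lt_of_csInf_lt hne (lt_add_of_pos_right (sInf T) hε)
  refine ⟨Θ, hΘ.1, hΘ.2, fun M h0 hM => ?_⟩
  have := csInf_le hbb (show M ∈ T from ⟨h0, hM⟩)
  linarith

/-- The top order estimate, with an arbitrarily small constant in front of the top order part of the
right-hand side. -/
theorem EllFam.top_bound : ∀ (k : ℕ) {ι : Type} {W H : ι → ℕ → ℝ}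
    {A : Fin n → Fin n → ι → E' n → ℝ} {b : Fin n → ι → E' n → ℝ} {u : ι → E' n → ℝ} {θ : ι → ℝ},
    EllFam W A b → (∀ ω, ContDiff ℝ (⊤ : ℕ∞) (u ω)) → (∀ ω, ∀ y ∈ Sphere' n, u ω y = 0) →
    (∀ ω j, 0 < H ω j) → (∀ ω j, H ω j ≤ H ω (j + 1)) → (∀ ω, 0 ≤ θ ω) → Modl (k + 1) W H →
    Bdd 1 H u → (∀ a, Bdd k H (fun ω => pd a (u ω))) →
    Bdd (k + 1) (fun ω => topw k (H ω) (θ ω))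
      (fun ω => Lop (fun a c => A a c ω) (fun a => b a ω) (u ω)) →
    ∀ δ > 0, ∃ K, 0 ≤ K ∧ ∀ ω a,
      Wt (k + 1) (topw k (fun j => K * H ω j) (δ * θ ω)) (pd a (u ω)) := by
  intro k
  induction k with
  | zero =>
    intro ι W H A b u θ h hu hbd hH hmono hθ hm h0 h1 hL δ hδ
    obtain ⟨C, δ₀, hC, hδ₀, hg⟩ := h.grad
    obtain ⟨C₀, hC₀, hU⟩ := h0.bound
    obtain ⟨C₁, hC₁, hF⟩ := hL.bound
    set δ' := min δ₀ (δ / (C * C₁ + 1)) with hδ'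
    have hp : 0 < C * C₁ + 1 := by positivity
    have hδ'0 : 0 < δ' := lt_min hδ₀ (div_pos hδ hp)
    have hδ'1 : C * C₁ * δ' ≤ δ := by
      have e1 : δ' ≤ δ / (C * C₁ + 1) := min_le_right _ _
      have e2 : δ' * (C * C₁ + 1) ≤ δ := (le_div_iff₀ hp).1 e1
      nlinarith
    refine ⟨δ + C * (C₀ / δ'), by positivity, fun ω a => ⟨fun y hy => ?_, fun _ => trivial⟩⟩
    have hHp := hH ω 0
    have e0 : topw 0 (H ω) (θ ω) 0 = H ω 0 + θ ω := by simp [topw]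
    have e := hg ω (u ω) (C₁ * (H ω 0 + θ ω)) (C₀ * H ω 0) δ' hδ'0 (min_le_left _ _)
      (mul_nonneg hC₁ (add_nonneg hHp.le (hθ ω))) (mul_nonneg hC₀ hHp.le) (hu ω) (hbd ω)
      (fun y hy => by have := hF ω y hy; rwa [e0] at this) (hU ω) y hy a
    refine e.trans ?_
    have e2 : topw 0 (fun j => (δ + C * (C₀ / δ')) * H ω j) (δ * θ ω) 0 =
      (δ + C * (C₀ / δ')) * H ω 0 + δ * θ ω := by simp [topw]
    rw [e2]
    have e3 := mul_le_mul_of_nonneg_right hδ'1 (add_nonneg hHp.le (hθ ω))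
    calc C * (δ' * (C₁ * (H ω 0 + θ ω)) + C₀ * H ω 0 / δ')
        = C * C₁ * δ' * (H ω 0 + θ ω) + C * (C₀ / δ') * H ω 0 := by ring
      _ ≤ _ := by linarith
  | succ k ih =>
    intro ι W H A b u θ h hu hbd hH hmono hθ hm h0 h1 hL δ' hδ'
    have hW := h.good
    have hH0 : ∀ ω j, 0 ≤ H ω j := fun ω j => (hH ω j).le
    obtain ⟨C', hC', hc'⟩ := Bdd.exists_uniform hH0 h1
    set C₀ := C' + 1 with hC₀
    have hC₀p : 0 < C₀ := by positivity
    have hc₀ : ∀ ω a, Wt (k + 1) (fun j => C₀ * H ω j) (pd a (u ω)) := fun ω a =>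
      (hc' ω a).mono fun j _ => mul_le_mul_of_nonneg_right (by linarith) (hH0 ω j)
    choose Θ hΘ0 hΘT hΘle using fun ω => exists_near_optimal (k := k)
      (H := fun j => C₀ * H ω j) (fun j => mul_pos hC₀p (hH ω j)) (w := fun a => pd a (u ω))
      (fun a => ((hu ω).pd a).sm) (hc₀ ω) (hH ω (k + 1))
    have h2 : ∀ a, Bdd (k + 2) (fun ω => topw (k + 1) (H ω) (Θ ω)) (fun ω => pd a (u ω)) := by
      refine fun a => ⟨fun ω => ((hu ω).pd a).sm, C₀, hC₀p.le, fun ω =>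
        (hΘT ω a).mono fun j _ => ?_⟩
      have := hΘ0 ω
      have : 0 ≤ C' * Θ ω := mul_nonneg hC' this
      simp only [topw]
      split_ifs
      · rw [mul_add, hC₀]; linarith
      · simp
    have ts := fun j l => tame_tanS (n := n) hW j l
    have hm1 : Modl (k + 1) W H := hm.of_le (Nat.le_succ _)
    have bv : ∀ j, Bdd (k + 1) H (fun ω => tanD j (u ω)) := fun j =>
      Bdd.sum fun l _ => (ts j l).mul_bdd (h1 l) hW hH0 hm1
    have hLv := h.lop_tanD hu hH0 hmono hθ hΘ0 hm h1 h2 hL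
    have hs : ∀ ω, 0 ≤ θ ω + Θ ω := fun ω => add_nonneg (hθ ω) (hΘ0 ω)
    have hv := fun j => ih h (fun ω => (hu ω).tanD j) (fun ω => tanD_sphere (hu ω) (hbd ω) j)
      (fun ω i => hH ω (i + 1)) (fun ω i => hmono ω (i + 1)) hs hm.succ
      (((bv j).of_le (Nat.succ_le_succ (Nat.zero_le k))).mono_one fun ω i _ => hmono ω i)
      (fun a => (bv j).pd a) (hLv j)
    choose K hK0 hK using hv
    set κ := ι × {δ : ℝ // 0 < δ} with hκ
    set Kδ : {δ : ℝ // 0 < δ} → ℝ := fun δ => 1 + ∑ j, K j δ.1 δ.2 with hKδ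
    have hKδ1 : ∀ δ, 1 ≤ Kδ δ := fun δ =>
      le_add_of_nonneg_right (Finset.sum_nonneg fun j _ => hK0 j δ.1 δ.2)
    have hKle : ∀ δ j, K j δ.1 δ.2 ≤ Kδ δ := fun δ j => by
      have := Finset.single_le_sum (fun j _ => hK0 j δ.1 δ.2) (Finset.mem_univ j)
      simp only [hKδ]; linarith
    set G : κ → ℕ → ℝ := fun ω => topw k (fun i => Kδ ω.2 * H ω.1 (i + 1))
      (ω.2.1 * (θ ω.1 + Θ ω.1)) with hG
    have hθ' : ∀ ω : κ, 0 ≤ ω.2.1 * (θ ω.1 + Θ ω.1) := fun ω => mul_nonneg ω.2.2.le (hs _)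
    have hK0' : ∀ ω : κ, 0 ≤ Kδ ω.2 := fun ω => zero_le_one.trans (hKδ1 _)
    have hG0 : ∀ ω j, 0 ≤ G ω j := fun ω j =>
      topw_nonneg (fun i => mul_nonneg (hK0' ω) (hH0 _ _)) (hθ' ω) j
    have hHG : ∀ (ω : κ) j, H ω.1 (j + 1) ≤ G ω j := fun ω j =>
      (le_mul_of_one_le_left (hH0 _ _) (hKδ1 ω.2)).trans
        (le_topw (H := fun i => Kδ ω.2 * H ω.1 (i + 1)) (hθ' ω) j)
    have hD := (h.comp (Prod.fst : κ → ι)).second_deriv (k := k + 1) (H := G)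
      (fun ω => hu ω.1) hG0
      (Modl.topw h.bdd_zero hm.succ Prod.fst hK0' hθ' fun ω j => hH0 ω (j + 1))
      (fun a => ((h1 a).comp Prod.fst).mono_one fun ω j _ => (hmono _ _).trans (hHG ω j))
      (fun a c => ⟨fun ω => (((hu ω.1).tanD c).pd a).sm, 1, zero_le_one, fun ω =>
        (hK c ω.2.1 ω.2.2 ω.1 a).mono fun j _ => by
          rw [one_mul]
          simp only [hG, topw]
          gcongr
          · exact hH0 _ _
          · exact hKle ω.2 c⟩)
      (((hL.of_le (Nat.le_succ (k + 1))).comp Prod.fst).mono_one fun ω j hj => by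
        rw [topw, if_neg (by omega), add_zero]
        exact (hmono _ _).trans (hHG ω j))
    obtain ⟨C, hC, hc⟩ := Bdd.exists_uniform (α := Fin n × Fin n) hG0 (fun p => hD p.1 p.2)
    set δ : ℝ := min (1 / 2) (δ' / 2) / (C + 1) with hδdef
    have hC1 : 0 < C + 1 := by positivity
    have hδ : 0 < δ := div_pos (lt_min (by norm_num) (by positivity)) hC1
    have hδ1 : δ * (C + 1) = min (1 / 2) (δ' / 2) := div_mul_cancel₀ _ hC1.ne'
    have hδ2 : C * δ ≤ 1 / 2 := by
      have := min_le_left (1 / 2) (δ' / 2); linarith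
    have hδ3 : C * δ ≤ δ' / 2 := by
      have := min_le_right (1 / 2) (δ' / 2); linarith
    set L := Kδ ⟨δ, hδ⟩ with hL'
    have hL0 : 0 ≤ L := zero_le_one.trans (hKδ1 _)
    refine ⟨C₀ + 2 * (C * L + 1), by positivity, fun ω a => (hΘT ω a).mono fun j hj => ?_⟩
    have hM0 : 0 ≤ C * (L * H ω (k + 1) + δ * (θ ω + Θ ω)) :=
      mul_nonneg hC (add_nonneg (mul_nonneg hL0 (hH0 _ _)) (mul_nonneg hδ.le (hs ω)))
    have hM := hΘle ω _ hM0 fun c => by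
      refine Wt.top_of_pd (hc₀ ω c) (fun a => hc (ω, ⟨δ, hδ⟩) (a, c)) (fun j _ =>
        le_topw (H := fun j => C₀ * H ω j) hM0 j) ?_
      have e1 : G (ω, ⟨δ, hδ⟩) k = L * H ω (k + 1) + δ * (θ ω + Θ ω) := by simp [hG, topw, hL']
      rw [e1, topw, if_pos le_rfl]
      have := mul_nonneg hC₀p.le (hH0 ω (k + 1))
      linarith
    have hΘb : Θ ω ≤ 2 * (C * L + 1) * H ω (k + 1) + δ' * θ ω := by
      have e1 := mul_le_mul_of_nonneg_right hδ2 (hΘ0 ω)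
      have e2 := mul_le_mul_of_nonneg_right hδ3 (hθ ω)
      have e3 : C * (L * H ω (k + 1) + δ * (θ ω + Θ ω)) =
        C * L * H ω (k + 1) + C * δ * θ ω + C * δ * Θ ω := by ring
      rw [e3] at hM
      linarith
    unfold topw
    split_ifs with hj'
    · obtain rfl : j = k + 1 := by omega
      linarith
    · have : 0 ≤ 2 * (C * L + 1) * H ω j := mul_nonneg (by positivity) (hH0 _ _)
      linarith

/-- Tame estimates for the Dirichlet problem. -/
theorem EllFam.tame_solution {ι : Type} {W : ι → ℕ → ℝ} {A : Fin n → Fin n → ι → E' n → ℝ}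
    {b : Fin n → ι → E' n → ℝ} {u f : ι → E' n → ℝ} (h : EllFam W A b)
    (hu : ∀ ω, ContDiff ℝ (⊤ : ℕ∞) (u ω)) (hbd : ∀ ω, ∀ y ∈ Sphere' n, u ω y = 0)
    (hf : Tame W f)
    (hL : ∀ ω, EqOn (f ω) (Lop (fun a c => A a c ω) (fun a => b a ω) (u ω)) (Ball n)) :
    (∀ a, Tame W (fun ω => pd a (u ω))) ∧ Tame W u := by
  have hW := h.good
  have tL : Tame W (fun ω => Lop (fun a c => A a c ω) (fun a => b a ω) (u ω)) :=
    hf.congr (fun ω => sm_Lop h (hu ω)) hL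
  have h0 : Bdd 1 W u := by
    obtain ⟨C, hC, hs⟩ := h.sup
    obtain ⟨C₁, hC₁, hb⟩ := (tL 1).bound
    refine bdd_one_of_le (fun ω => (hu ω).sm) (mul_nonneg hC hC₁) fun ω y hy => ?_
    rw [mul_assoc]
    exact hs ω (u ω) _ (mul_nonneg hC₁ (hW.nonneg ω 0)) (hu ω) (hbd ω) (hb ω) y hy
  have h1 : ∀ k a, Bdd k W (fun ω => pd a (u ω)) := by
    intro k
    induction k with
    | zero => exact fun a => ⟨fun ω => ((hu ω).pd a).sm, 0, le_rfl, fun _ => trivial⟩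
    | succ k ih =>
      obtain ⟨K, hK, hw⟩ := EllFam.top_bound k (θ := fun _ => 0) h hu hbd
        (fun ω j => zero_lt_one.trans_le (hW.one_le ω j))
        (fun ω j => hW.mono ω (Nat.le_succ j)) (fun _ => le_rfl) (hW.modl _) h0 ih
        ((tL (k + 1)).mono_one fun ω j _ => le_topw le_rfl j) 1 one_pos
      exact fun a => ⟨fun ω => ((hu ω).pd a).sm, K, hK, fun ω => (hw ω a).mono fun j _ => by
        simp [topw]⟩
  refine ⟨fun a k => h1 k a, fun k => Bdd.of_le (k := k + 1) ?_ (Nat.le_succ k)⟩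
  exact h0.succ hW.nonneg fun a => (h1 k a).mono_one fun ω j _ => hW.mono ω (Nat.le_succ j)

/-- A Landau type interpolation inequality on the ball. -/
lemma landau_ball {G : Type*} [NormedAddCommGroup G] [NormedSpace ℝ G] {g : E' n → G}
    (hg : ContDiff ℝ (⊤ : ℕ∞) g) {a c : ℝ} (ha : ∀ y ∈ Ball n, ‖g y‖ ≤ a)
    (hc : ∀ y ∈ Ball n, ‖fderiv ℝ (fderiv ℝ g) y‖ ≤ c) {y : E' n} (hy : y ∈ Ball n) :
    ‖fderiv ℝ g y‖ ^ 2 ≤ 144 * (a * (a + c)) := by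
  have ha0 : 0 ≤ a := (norm_nonneg _).trans (ha y hy)
  have hc0 : 0 ≤ c := (norm_nonneg (fderiv ℝ (fderiv ℝ g) y)).trans (hc y hy)
  have hdg : ContDiff ℝ (⊤ : ℕ∞) (fderiv ℝ g) := hg.fderiv_right (by simp)
  have hlip : ∀ w ∈ Ball n, ‖fderiv ℝ g w - fderiv ℝ g y‖ ≤ c * ‖w - y‖ := fun w hw =>
    ball_convex.norm_image_sub_le_of_norm_fderiv_le
      (fun z _ => hdg.differentiable (by simp) z) hc hy hw
  have hT : ∀ z ∈ Ball n, ∀ h : ℝ, 0 < h → h ≤ 1 →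
      ‖fderiv ℝ g y (z - y)‖ ≤ 2 * a / h + 4 * c * h := by
    intro z hz h h0 h1
    set w := y + h • (z - y) with hw
    have hwB : w ∈ Ball n := ball_convex.add_smul_sub_mem hy hz ⟨h0.le, h1⟩
    have hzy : ‖z - y‖ ≤ 2 := by
      have := norm_sub_le z y
      have := mem_ball_iff.1 hy
      have := mem_ball_iff.1 hz
      linarith
    have hwy : ‖w - y‖ ≤ 2 * h := by
      rw [hw, add_sub_cancel_left, norm_smul, Real.norm_of_nonneg h0.le]; nlinarith
    have hseg : segment ℝ y w ⊆ Ball n := ball_convex.segment_subset hy hwB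
    have e1 : ‖g w - g y - fderiv ℝ g y (w - y)‖ ≤ c * (2 * h) * ‖w - y‖ := by
      refine (convex_segment y w).norm_image_sub_le_of_norm_fderiv_le'
        (fun z _ => hg.differentiable (by simp) z) (fun v hv => ?_)
        (left_mem_segment ℝ y w) (right_mem_segment ℝ y w)
      refine (hlip v (hseg hv)).trans (mul_le_mul_of_nonneg_left (le_trans ?_ hwy) hc0)
      obtain ⟨t, ⟨ht0, ht1⟩, rfl⟩ := (segment_eq_image' ℝ y w ▸ hv : v ∈ _)
      rw [add_sub_cancel_left, norm_smul, Real.norm_of_nonneg ht0]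
      exact mul_le_of_le_one_left (norm_nonneg _) ht1
    have e2 : fderiv ℝ g y (w - y) = h • fderiv ℝ g y (z - y) := by
      rw [hw, add_sub_cancel_left, map_smul]
    have e3 : h * ‖fderiv ℝ g y (z - y)‖ ≤ a + a + c * (2 * h) * (2 * h) := by
      have : h * ‖fderiv ℝ g y (z - y)‖ = ‖g w - g y - (g w - g y - fderiv ℝ g y (w - y))‖ := by
        rw [sub_sub_cancel, e2, norm_smul, Real.norm_of_nonneg h0.le]
      rw [this]
      refine (norm_sub_le _ _).trans (add_le_add ((norm_sub_le _ _).trans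
        (add_le_add (ha w hwB) (ha y hy))) (e1.trans ?_))
      exact mul_le_mul_of_nonneg_left hwy (by positivity)
    have e4 : 2 * a / h + 4 * c * h = (a + a + c * (2 * h) * (2 * h)) / h := by
      field_simp; ring
    rw [e4, le_div_iff₀ h0]
    linarith
  have hN : ∀ h : ℝ, 0 < h → h ≤ 1 → ‖fderiv ℝ g y‖ ≤ 4 * a / h + 8 * c * h := by
    intro h h0 h1
    refine ContinuousLinearMap.opNorm_le_of_unit_norm (by positivity) fun v hv => ?_
    have e : fderiv ℝ g y v = fderiv ℝ g y (v - y) - fderiv ℝ g y (0 - y) := by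
      rw [← map_sub]; congr 1; abel
    rw [e]
    have := hT v (mem_ball_iff.2 hv.le) h h0 h1
    have := hT 0 zero_mem_ball h h0 h1
    refine (norm_sub_le _ _).trans ?_
    have e5 : 4 * a / h = 2 * a / h + 2 * a / h := by ring
    linarith
  suffices H : ∀ a' > a, ‖fderiv ℝ g y‖ ^ 2 ≤ 144 * (a' * (a' + c)) by
    have hcont : Continuous fun a' : ℝ => 144 * (a' * (a' + c)) := by fun_prop
    exact ge_of_tendsto (x := nhdsWithin a (Ioi a)) (hcont.continuousWithinAt)
      (Filter.eventually_of_mem self_mem_nhdsWithin H)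
  intro a' haa
  have ha' : 0 < a' := ha0.trans_lt haa
  set q := Real.sqrt (a' * (a' + c)) with hq
  have hq2 : q ^ 2 = a' * (a' + c) := Real.sq_sqrt (by positivity)
  have hq0 : 0 < q := Real.sqrt_pos.2 (by positivity)
  have haq : a' ≤ q := Real.le_sqrt_of_sq_le (by nlinarith)
  have h1 := hN (a' / q) (by positivity) ((div_le_one hq0).2 haq)
  have h2 : 4 * a / (a' / q) ≤ 4 * q := by
    rw [div_div_eq_mul_div, div_le_iff₀ ha']
    nlinarith
  have h3 : 8 * c * (a' / q) ≤ 8 * q := by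
    rw [← mul_div_assoc, div_le_iff₀ hq0]
    nlinarith
  have h4 : ‖fderiv ℝ g y‖ ≤ 12 * q := by linarith
  calc ‖fderiv ℝ g y‖ ^ 2 ≤ (12 * q) ^ 2 := pow_le_pow_left₀ (norm_nonneg _) h4 2
    _ = _ := by rw [mul_pow, hq2]; norm_num

lemma logconvex_step {ι : Type} {W : ι → ℕ → ℝ} (hpos : ∀ ω k, 0 < W ω k) {C : ℝ} (hC : 0 ≤ C)
    (h : ∀ ω k, W ω (k + 1) ^ 2 ≤ C * (W ω k * W ω (k + 2))) (i m : ℕ) :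
    ∀ ω, W ω (i + 1) * W ω (i + m) ≤ C ^ m * (W ω i * W ω (i + m + 1)) := by
  intro ω
  induction m with
  | zero => simp [mul_comm]
  | succ m ih =>
    have h1 := hpos ω (i + m)
    have h2 := hpos ω (i + m + 1)
    have h3 := h ω (i + m)
    have h4 := hpos ω i
    rw [← mul_le_mul_iff_right₀ h1]
    calc W ω (i + m) * (W ω (i + 1) * W ω (i + (m + 1)))
        = (W ω (i + 1) * W ω (i + m)) * W ω (i + m + 1) := by rw [← add_assoc]; ring
      _ ≤ (C ^ m * (W ω i * W ω (i + m + 1))) * W ω (i + m + 1) :=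
        mul_le_mul_of_nonneg_right ih h2.le
      _ = C ^ m * W ω i * W ω (i + m + 1) ^ 2 := by ring
      _ ≤ C ^ m * W ω i * (C * (W ω (i + m) * W ω (i + m + 2))) := by gcongr
      _ = _ := by rw [← add_assoc]; ring

/-- Logarithmic convexity up to constants gives submultiplicativity. -/
lemma modl_of_logconvex {ι : Type} {W : ι → ℕ → ℝ} (hpos : ∀ ω k, 0 < W ω k) {C D : ℝ}
    (hC : 1 ≤ C) (h : ∀ ω k, W ω (k + 1) ^ 2 ≤ C * (W ω k * W ω (k + 2)))
    (hD : ∀ ω, W ω 0 ≤ D) (k : ℕ) : Modl k W W := by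
  have h1 : ∀ i j, i ≤ j → ∃ A, 0 ≤ A ∧ ∀ ω, W ω i * W ω j ≤ A * (W ω 0 * W ω (i + j)) := by
    intro i
    induction i with
    | zero => exact fun j _ => ⟨1, zero_le_one, fun ω => by simp⟩
    | succ i ih =>
      intro j hj
      obtain ⟨m, rfl⟩ : ∃ m, j = i + m := ⟨j - i, by omega⟩
      obtain ⟨A, hA, hh⟩ := ih (i + m + 1) (by omega)
      refine ⟨C ^ m * A, by positivity, fun ω => ?_⟩
      refine (logconvex_step hpos (by linarith) h i m ω).trans ?_
      rw [mul_assoc]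
      have := hh ω
      rw [show i + 1 + (i + m) = i + (i + m + 1) by omega]
      gcongr
  have h2 : ∀ i j, ∃ A, 0 ≤ A ∧ ∀ ω, W ω i * W ω j ≤ A * W ω (i + j) := by
    intro i j
    have : ∃ A, 0 ≤ A ∧ ∀ ω, W ω i * W ω j ≤ A * (W ω 0 * W ω (i + j)) := by
      rcases le_total i j with hij | hij
      · exact h1 i j hij
      · obtain ⟨A, hA, hh⟩ := h1 j i hij
        exact ⟨A, hA, fun ω => by rw [mul_comm, add_comm i j]; exact hh ω⟩
    obtain ⟨A, hA, hh⟩ := this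
    refine ⟨A * |D|, by positivity, fun ω => (hh ω).trans ?_⟩
    rw [mul_assoc]
    have := hpos ω (i + j)
    have := (hD ω).trans (le_abs_self D)
    gcongr
  choose A hA hh using h2
  refine ⟨∑ i ∈ Finset.range k, ∑ j ∈ Finset.range k, A i j,
    Finset.sum_nonneg fun i _ => Finset.sum_nonneg fun j _ => hA i j, fun ω i j hij => ?_⟩
  refine (hh i j ω).trans (mul_le_mul_of_nonneg_right ?_ (hpos ω _).le)
  have e1 := Finset.single_le_sum (f := fun j => A i j) (fun j _ => hA i j)
    (Finset.mem_range.2 (show j < k by omega))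
  have e2 := Finset.single_le_sum (f := fun i => ∑ j ∈ Finset.range k, A i j)
    (fun i _ => Finset.sum_nonneg fun j _ => hA i j) (Finset.mem_range.2 (show i < k by omega))
  exact e1.trans e2

lemma norm_iteratedFDeriv_le_iSup {f : E' n → F} (hf : ContDiff ℝ (⊤ : ℕ∞) f) (j : ℕ) {y : E' n}
    (hy : y ∈ Ball n) :
    ‖iteratedFDeriv ℝ j f y‖ ≤ ⨆ y ∈ Ball n, ‖iteratedFDeriv ℝ j f y‖ := by
  have hc : Continuous fun y => ‖iteratedFDeriv ℝ j f y‖ :=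
    (hf.continuous_iteratedFDeriv (by exact_mod_cast le_top)).norm
  obtain ⟨C, hC⟩ := (ball_isCompact.bddAbove_image hc.continuousOn)
  have hb : BddAbove (range fun y => ⨆ (_ : y ∈ Ball n), ‖iteratedFDeriv ℝ j f y‖) := by
    refine ⟨max C 0, ?_⟩
    rintro _ ⟨z, rfl⟩
    exact Real.iSup_le (fun hz => (hC ⟨z, hz, rfl⟩).trans (le_max_left _ _)) (le_max_right _ _)
  refine le_trans ?_ (le_ciSup hb y)
  simp [hy]

lemma iSup_ball_nonneg (g : E' n → ℝ) (hg : ∀ y, 0 ≤ g y) : 0 ≤ ⨆ y ∈ Ball n, g y :=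
  Real.iSup_nonneg fun _ => Real.iSup_nonneg fun _ => hg _

lemma iSup_ball_le {g : E' n → ℝ} {C : ℝ} (hC : 0 ≤ C) (h : ∀ y ∈ Ball n, g y ≤ C) :
    ⨆ y ∈ Ball n, g y ≤ C :=
  Real.iSup_le (fun y => Real.iSup_le (fun hy => h y hy) hC) hC

lemma ckNorm_nonneg (k : ℕ) (f : E' n → F) : 0 ≤ ckNorm k f :=
  Finset.sum_nonneg fun _ _ => iSup_ball_nonneg _ fun _ => norm_nonneg _

lemma ckNorm_succ (k : ℕ) (f : E' n → F) :
    ckNorm (k + 1) f = ckNorm k f + ⨆ y ∈ Ball n, ‖iteratedFDeriv ℝ (k + 1) f y‖ :=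
  Finset.sum_range_succ _ _

lemma ckNorm_mono (f : E' n → F) : Monotone fun k => ckNorm k f :=
  monotone_nat_of_le_succ fun k => by
    rw [ckNorm_succ]
    exact le_add_of_nonneg_right (iSup_ball_nonneg _ fun _ => norm_nonneg _)

lemma iSup_le_ckNorm (f : E' n → F) {j k : ℕ} (hjk : j ≤ k) :
    ⨆ y ∈ Ball n, ‖iteratedFDeriv ℝ j f y‖ ≤ ckNorm k f :=
  Finset.single_le_sum
    (f := fun j => ⨆ y ∈ Ball n, ‖iteratedFDeriv ℝ j f y‖)
    (fun _ _ => iSup_ball_nonneg _ fun _ => norm_nonneg _) (Finset.mem_range.2 (by omega))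

lemma norm_iteratedFDeriv_le_ckNorm {f : E' n → F} (hf : ContDiff ℝ (⊤ : ℕ∞) f) {j k : ℕ}
    (hjk : j ≤ k) {y : E' n} (hy : y ∈ Ball n) : ‖iteratedFDeriv ℝ j f y‖ ≤ ckNorm k f :=
  (norm_iteratedFDeriv_le_iSup hf j hy).trans (iSup_le_ckNorm f hjk)

lemma norm_fderiv_fderiv_of_comp {G H : Type*} [NormedAddCommGroup G] [NormedSpace ℝ G]
    [NormedAddCommGroup H] [NormedSpace ℝ H] {g : E' n → G} {h : E' n → H}
    (e : H ≃ₗᵢ[ℝ] (E' n →L[ℝ] G)) (hg : fderiv ℝ g = e ∘ h) (y : E' n) :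
    ‖fderiv ℝ (fderiv ℝ g) y‖ = ‖fderiv ℝ h y‖ := by
  rw [hg, LinearIsometryEquiv.comp_fderiv]
  exact LinearIsometry.norm_toContinuousLinearMap_comp e.toLinearIsometry

lemma landau_ball_of_comp {G H : Type*} [NormedAddCommGroup G] [NormedSpace ℝ G]
    [NormedAddCommGroup H] [NormedSpace ℝ H] {g : E' n → G} {h : E' n → H}
    (hs : ContDiff ℝ (⊤ : ℕ∞) g) (e : H ≃ₗᵢ[ℝ] (E' n →L[ℝ] G)) (hg : fderiv ℝ g = e ∘ h)
    {a c : ℝ} (ha : ∀ y ∈ Ball n, ‖g y‖ ≤ a) (hc : ∀ y ∈ Ball n, ‖fderiv ℝ h y‖ ≤ c) {y : E' n}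
    (hy : y ∈ Ball n) : ‖fderiv ℝ g y‖ ^ 2 ≤ 144 * (a * (a + c)) :=
  landau_ball hs ha (fun z hz => (norm_fderiv_fderiv_of_comp e hg z).trans_le (hc z hz)) hy

lemma ckNorm_logconvex {f : E' n → F} (hf : ContDiff ℝ (⊤ : ℕ∞) f) (k : ℕ) :
    ckNorm (k + 1) f ^ 2 ≤ 300 * (ckNorm k f * ckNorm (k + 2) f) := by
  set s : ℕ → ℝ := fun j => ⨆ y ∈ Ball n, ‖iteratedFDeriv ℝ j f y‖ with hs
  have s0 : ∀ j, 0 ≤ s j := fun j => iSup_ball_nonneg _ fun _ => norm_nonneg _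
  have hg : ContDiff ℝ (⊤ : ℕ∞) (iteratedFDeriv ℝ k f) :=
    hf.iteratedFDeriv_right (m := (⊤ : ℕ∞)) (by exact_mod_cast le_top)
  have h1 : s (k + 1) ^ 2 ≤ 144 * (s k * (s k + s (k + 2))) := by
    have : s (k + 1) ≤ Real.sqrt (144 * (s k * (s k + s (k + 2)))) := by
      refine iSup_ball_le (Real.sqrt_nonneg _) fun y hy => Real.le_sqrt_of_sq_le ?_
      rw [← norm_fderiv_iteratedFDeriv]
      refine landau_ball_of_comp hg _ fderiv_iteratedFDeriv
        (fun z hz => norm_iteratedFDeriv_le_iSup hf k hz) (fun z hz => ?_) hy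
      rw [norm_fderiv_iteratedFDeriv]
      exact norm_iteratedFDeriv_le_iSup hf (k + 2) hz
    have hnn : 0 ≤ 144 * (s k * (s k + s (k + 2))) :=
      mul_nonneg (by norm_num) (mul_nonneg (s0 _) (add_nonneg (s0 _) (s0 _)))
    calc s (k + 1) ^ 2 ≤ Real.sqrt (144 * (s k * (s k + s (k + 2)))) ^ 2 :=
          pow_le_pow_left₀ (s0 _) this 2
      _ = _ := Real.sq_sqrt hnn
  have e1 : ckNorm (k + 1) f = ckNorm k f + s (k + 1) := ckNorm_succ k f
  have e2 : ckNorm (k + 2) f = ckNorm (k + 1) f + s (k + 2) := ckNorm_succ (k + 1) f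
  have h2 : s k ≤ ckNorm k f := iSup_le_ckNorm f le_rfl
  have h3 := ckNorm_nonneg k f
  have h4 : s k * (s k + s (k + 2)) ≤ ckNorm k f * ckNorm (k + 2) f :=
    mul_le_mul h2 (by linarith [s0 (k + 1)]) (add_nonneg (s0 _) (s0 _)) h3
  have h5 : ckNorm k f * ckNorm k f ≤ ckNorm k f * ckNorm (k + 2) f :=
    mul_le_mul_of_nonneg_left (by linarith [s0 (k + 1), s0 (k + 2)]) h3
  rw [e1]
  nlinarith [sq_nonneg (ckNorm k f - s (k + 1))]

/-- Nonnegative sequences which are logarithmically convex up to a constant. -/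
def LogCvx (C : ℝ) (a : ℕ → ℝ) : Prop :=
  (∀ k, 0 ≤ a k) ∧ Monotone a ∧ ∀ k, a (k + 1) ^ 2 ≤ C * (a k * a (k + 2))

lemma LogCvx.add {C : ℝ} {a b : ℕ → ℝ} (hC : 0 ≤ C) (ha : LogCvx C a) (hb : LogCvx C b) :
    LogCvx (2 * C) (fun k => a k + b k) := by
  refine ⟨fun k => add_nonneg (ha.1 k) (hb.1 k), ha.2.1.add hb.2.1, fun k => ?_⟩
  have h1 := ha.2.2 k
  have h2 := hb.2.2 k
  have h3 := mul_nonneg hC (mul_nonneg (ha.1 k) (hb.1 (k + 2)))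
  have h4 := mul_nonneg hC (mul_nonneg (hb.1 k) (ha.1 (k + 2)))
  nlinarith [sq_nonneg (a (k + 1) - b (k + 1))]

lemma LogCvx.of_le {C D : ℝ} {a : ℕ → ℝ} (ha : LogCvx C a) (h : C ≤ D) : LogCvx D a :=
  ⟨ha.1, ha.2.1, fun k => (ha.2.2 k).trans
    (mul_le_mul_of_nonneg_right h (mul_nonneg (ha.1 _) (ha.1 _)))⟩

lemma logCvx_one : LogCvx 300 (fun _ => 1) :=
  ⟨fun _ => zero_le_one, monotone_const, fun _ => by norm_num⟩

lemma logCvx_ckNorm {f : E' n → F} (hf : ContDiff ℝ (⊤ : ℕ∞) f) (m : ℕ) :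
    LogCvx 300 (fun k => ckNorm (k + m) f) :=
  ⟨fun _ => ckNorm_nonneg _ _, fun i j h => ckNorm_mono f (Nat.add_le_add_right h m), fun k => by
    simp only []
    rw [show k + 1 + m = k + m + 1 by omega, show k + 2 + m = k + m + 2 by omega]
    exact ckNorm_logconvex hf (k + m)⟩

lemma goodW_of_logCvx {ι : Type} {W : ι → ℕ → ℝ} {C D : ℝ} (hC : 1 ≤ C)
    (h : ∀ ω, LogCvx C (W ω)) (h1 : ∀ ω k, 1 ≤ W ω k) (hD : ∀ ω, W ω 0 ≤ D) : GoodW W :=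
  ⟨h1, fun ω => (h ω).2.1, modl_of_logconvex (fun ω k => zero_lt_one.trans_le (h1 ω k)) hC
    (fun ω => (h ω).2.2) hD⟩

lemma norm_iteratedFDeriv_pd_le {u : E' n → ℝ} (hu : ContDiff ℝ (⊤ : ℕ∞) u) (a : Fin n) (j : ℕ)
    (y : E' n) : ‖iteratedFDeriv ℝ j (pd a u) y‖ ≤ ‖iteratedFDeriv ℝ (j + 1) u y‖ := by
  set L : (E' n →L[ℝ] ℝ) →L[ℝ] ℝ :=
    ContinuousLinearMap.apply ℝ ℝ (EuclideanSpace.single a (1 : ℝ)) with hL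
  have hLn : ‖L‖ ≤ 1 := L.opNorm_le_bound zero_le_one fun φ => by
    have := φ.le_opNorm (EuclideanSpace.single a (1 : ℝ))
    rw [PiLp.norm_single, norm_one, mul_one] at this
    rw [one_mul]; exact this
  have hd : ContDiff ℝ (⊤ : ℕ∞) (fderiv ℝ u) := hu.fderiv_right (by simp)
  have h1 := L.norm_iteratedFDeriv_comp_left (n := j) (x := y)
    (hd.contDiffAt (x := y)) (by exact_mod_cast le_top)
  rw [← norm_iteratedFDeriv_fderiv]
  refine le_trans (le_of_eq ?_) (h1.trans (mul_le_of_le_one_left (norm_nonneg _) hLn))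
  rfl

lemma wt_of_iteratedFDeriv {k : ℕ} : ∀ {H : ℕ → ℝ} {u : E' n → ℝ}, ContDiff ℝ (⊤ : ℕ∞) u →
    (∀ j < k, ∀ y ∈ Ball n, ‖iteratedFDeriv ℝ j u y‖ ≤ H j) → Wt k H u := by
  induction k with
  | zero => intros; trivial
  | succ k ih =>
    intro H u hu h
    refine ⟨fun y hy => ?_, fun a => ih (ContDiff.pd hu a) fun j hj y hy => ?_⟩
    · have := h 0 (by omega) y hy
      rwa [norm_iteratedFDeriv_zero] at this
    · exact (norm_iteratedFDeriv_pd_le hu a j y).trans (h (j + 1) (by omega) y hy)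

lemma norm_iteratedFDeriv_succ_le_sum {u : E' n → ℝ} (hu : ContDiff ℝ (⊤ : ℕ∞) u) (j : ℕ)
    (y : E' n) : ‖iteratedFDeriv ℝ (j + 1) u y‖ ≤ ∑ a, ‖iteratedFDeriv ℝ j (pd a u) y‖ := by
  have e : fderiv ℝ u = fun y => ∑ a, ContinuousLinearMap.smulRightL ℝ (E' n) ℝ
      (EuclideanSpace.proj (𝕜 := ℝ) a) (pd a u y) := by
    funext y
    ext v
    rw [fderiv_eq_sum_pd]
    simp [_root_.sum_apply]
  have hle : ∀ a : Fin n, ‖ContinuousLinearMap.smulRightL ℝ (E' n) ℝ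
      (EuclideanSpace.proj (𝕜 := ℝ) a)‖ ≤ 1 := fun a => by
    refine ContinuousLinearMap.opNorm_le_bound _ zero_le_one fun c => ?_
    rw [one_mul]
    refine ContinuousLinearMap.opNorm_le_bound _ (norm_nonneg _) fun v => ?_
    have := PiLp.norm_apply_le v a
    simp only [ContinuousLinearMap.smulRightL_apply_apply, ContinuousLinearMap.smulRight_apply,
      PiLp.proj_apply, norm_smul]
    rw [mul_comm]
    exact mul_le_mul_of_nonneg_left this (norm_nonneg _)
  rw [← norm_iteratedFDeriv_fderiv, e]
  rw [iteratedFDeriv_fun_sum_apply]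
  · refine (norm_sum_le _ _).trans (Finset.sum_le_sum fun a _ => ?_)
    refine (ContinuousLinearMap.norm_iteratedFDeriv_comp_left _
      ((ContDiff.pd hu a).contDiffAt (x := y)) (n := j) (by exact_mod_cast le_top)).trans ?_
    exact mul_le_of_le_one_left (norm_nonneg _) (hle a)
  · intro a _
    exact (((ContinuousLinearMap.contDiff _).comp (ContDiff.pd hu a)).of_le
      (by exact_mod_cast le_top)).contDiffAt

lemma Wt.norm_iteratedFDeriv_le {k : ℕ} : ∀ {H : ℕ → ℝ} {u : E' n → ℝ}, Wt k H u →
    ContDiff ℝ (⊤ : ℕ∞) u → ∀ j < k, ∀ y ∈ Ball n,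
      ‖iteratedFDeriv ℝ j u y‖ ≤ (n : ℝ) ^ j * H j := by
  induction k with
  | zero => intro _ _ _ _ j hj; omega
  | succ k ih =>
    intro H u h hu j hj y hy
    cases j with
    | zero => simpa using h.1 y hy
    | succ j =>
      refine (norm_iteratedFDeriv_succ_le_sum hu j y).trans ?_
      refine (Finset.sum_le_sum fun a _ => ih (h.2 a) (ContDiff.pd hu a) j (by omega) y hy).trans ?_
      simp only [Finset.sum_const, Finset.card_univ, Fintype.card_fin, nsmul_eq_mul]
      rw [pow_succ]
      exact le_of_eq (by ring)

/-- `C^k` bounds for the derivatives give tame families. -/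
lemma tame_of_ckNorm {ι : Type} {W : ι → ℕ → ℝ} {u : ι → E' n → ℝ}
    (hu : ∀ ω, ContDiff ℝ (⊤ : ℕ∞) (u ω))
    (h : ∀ ω j, ∀ y ∈ Ball n, ‖iteratedFDeriv ℝ j (u ω) y‖ ≤ W ω j) : Tame W u := fun k =>
  ⟨fun ω => ContDiff.sm (hu ω), 1, zero_le_one, fun ω =>
    wt_of_iteratedFDeriv (hu ω) fun j _ y hy => by rw [one_mul]; exact h ω j y hy⟩

/-- A tame family with tame derivatives has `C^r` norm controlled by the weight of
order `r - 1`. -/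
lemma Tame.ckNorm_le {ι : Type} {W : ι → ℕ → ℝ} {u : ι → E' n → ℝ} (hW : GoodW W)
    (hu : ∀ ω, ContDiff ℝ (⊤ : ℕ∞) (u ω)) (h0 : Tame W u)
    (h1 : ∀ a, Tame W (fun ω => _root_.pd a (u ω))) (r : ℕ) :
    ∃ C, 0 ≤ C ∧ ∀ ω, ckNorm (r + 1) (u ω) ≤ C * W ω r := by
  induction r with
  | zero =>
    obtain ⟨C, hC, hb⟩ := (h0 1).bound
    choose D hD hd using fun a => (h1 a 1).bound
    have hS : 0 ≤ ∑ a, D a := Finset.sum_nonneg fun a _ => hD a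
    refine ⟨C + ∑ a, D a, by positivity, fun ω => ?_⟩
    rw [ckNorm_succ, add_mul]
    have hw := hW.nonneg ω 0
    refine add_le_add ?_ (iSup_ball_le (by positivity) fun y hy => ?_)
    · simp only [ckNorm, zero_add, Finset.sum_range_one]
      refine iSup_ball_le (by positivity) fun y hy => ?_
      rw [norm_iteratedFDeriv_zero]; exact hb ω y hy
    · refine (norm_iteratedFDeriv_succ_le_sum (hu ω) 0 y).trans ?_
      rw [Finset.sum_mul]
      refine Finset.sum_le_sum fun a _ => ?_
      rw [norm_iteratedFDeriv_zero]; exact hd a ω y hy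
  | succ r ih =>
    obtain ⟨C, hC, hb⟩ := ih
    choose D hD hd using fun a => (h1 a (r + 2)).2
    have hS : 0 ≤ ∑ a, D a := Finset.sum_nonneg fun a _ => hD a
    refine ⟨C + (n : ℝ) ^ (r + 1) * ∑ a, D a, by positivity, fun ω => ?_⟩
    rw [ckNorm_succ, add_mul]
    have hw := hW.nonneg ω (r + 1)
    have hw' := hW.nonneg ω r
    refine add_le_add ((hb ω).trans (mul_le_mul_of_nonneg_left (hW.mono ω (Nat.le_succ r)) hC))
      (iSup_ball_le (by positivity) fun y hy => ?_)
    refine (norm_iteratedFDeriv_succ_le_sum (hu ω) (r + 1) y).trans ?_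
    rw [Finset.mul_sum, Finset.sum_mul]
    refine Finset.sum_le_sum fun a _ => ?_
    refine ((hd a ω).norm_iteratedFDeriv_le (ContDiff.pd (hu ω) a) (r + 1) (by omega) y hy).trans ?_
    exact le_of_eq (by ring)

lemma contDiffAt_det {X : Type*} [NormedAddCommGroup X] [NormedSpace ℝ X]
    {M : X → Matrix (Fin n) (Fin n) ℝ} {p : X}
    (h : ∀ i j, ContDiffAt ℝ (⊤ : ℕ∞) (fun q => M q i j) p) :
    ContDiffAt ℝ (⊤ : ℕ∞) (fun q => (M q).det) p := by
  simp_rw [Matrix.det_apply']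
  exact ContDiffAt.sum fun σ _ => contDiffAt_const.mul (contDiffAt_prod fun i _ => h _ _)

lemma inv_entry_eq (M : Matrix (Fin n) (Fin n) ℝ) (a i : Fin n) :
    M⁻¹ a i = M.det⁻¹ * (M.updateRow i (Pi.single a 1)).det := by
  rw [Matrix.inv_def, Matrix.smul_apply, Matrix.adjugate_apply, Ring.inverse_eq_inv', smul_eq_mul]

lemma contDiffAt_inv_entry {X : Type*} [NormedAddCommGroup X] [NormedSpace ℝ X]
    {M : X → Matrix (Fin n) (Fin n) ℝ} {p : X}
    (h : ∀ i j, ContDiffAt ℝ (⊤ : ℕ∞) (fun q => M q i j) p) (h0 : (M p).det ≠ 0) (a i : Fin n) :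
    ContDiffAt ℝ (⊤ : ℕ∞) (fun q => (M q)⁻¹ a i) p := by
  simp_rw [inv_entry_eq]
  refine ((contDiffAt_det h).inv h0).mul (contDiffAt_det fun j k => ?_)
  by_cases hj : j = i
  · subst hj
    simp only [Matrix.updateRow_self]
    exact contDiffAt_const
  · simp only [Matrix.updateRow_ne hj]
    exact h j k

/-- If `S M = 1` and `S' M + S M' = 0` then `S' = - S M' S`. -/
lemma deriv_inv_aux {S S' M M' : Fin n → Fin n → ℝ}
    (h1 : ∀ i j, ∑ a, M i a * S a j = if i = j then 1 else 0)
    (h2 : ∀ a c, ∑ k, (S' a k * M k c + S a k * M' k c) = 0) (a i : Fin n) :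
    S' a i = -∑ k, ∑ c, S a k * M' k c * S c i := by
  have e : ∑ c, (∑ k, (S' a k * M k c + S a k * M' k c)) * S c i = 0 := by
    simp [h2]
  have e1 : ∑ c, (∑ k, S' a k * M k c) * S c i = S' a i := by
    simp_rw [Finset.sum_mul]
    rw [Finset.sum_comm]
    simp_rw [mul_assoc, ← Finset.mul_sum, h1]
    simp
  have e2 : ∑ c, (∑ k, S a k * M' k c) * S c i = ∑ k, ∑ c, S a k * M' k c * S c i := by
    simp_rw [Finset.sum_mul]
    rw [Finset.sum_comm]
  simp_rw [Finset.sum_add_distrib, add_mul] at e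
  rw [Finset.sum_add_distrib, e1, e2] at e
  linarith

/-- The inverse Jacobian `∂y^a/∂x^i`. -/
def sg (x : E' n → E' n) (a i : Fin n) (y : E' n) : ℝ := (jacM x y)⁻¹ a i

/-- The second derivatives `∂²x^k/∂y^c∂y^a`. -/
def hsx (x : E' n → E' n) (k c a : Fin n) (y : E' n) : ℝ := pd c (pd a (fun z => x z k)) y

lemma contDiff_comp_coord {x : E' n → E' n} (hx : ContDiff ℝ (⊤ : ℕ∞) x) (i : Fin n) :
    ContDiff ℝ (⊤ : ℕ∞) (fun z => x z i) := (contDiff_coord i).comp hx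

lemma hsx_comm {x : E' n → E' n} (hx : ContDiff ℝ (⊤ : ℕ∞) x) (k c a : Fin n) (y : E' n) :
    hsx x k c a y = hsx x k a c y := pd_comm (contDiff_comp_coord hx k).contDiffAt c a

section static
variable {x : E' n → E' n}

lemma jac_smooth (hx : ContDiff ℝ (⊤ : ℕ∞) x) (i a : Fin n) :
    ContDiff ℝ (⊤ : ℕ∞) (pd a (fun z => x z i)) := ContDiff.pd (contDiff_comp_coord hx i) a

lemma sg_sm (hx : ContDiff ℝ (⊤ : ℕ∞) x) (hdet : ∀ y ∈ Ball n, (jacM x y).det ≠ 0)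
    (a i : Fin n) : Sm (sg x a i) := fun y hy =>
  contDiffAt_inv_entry (M := jacM x) (fun i j => (jac_smooth hx i j).contDiffAt) (hdet y hy) a i

lemma kappa_sm (hx : ContDiff ℝ (⊤ : ℕ∞) x) : Sm (kappa x) := fun _ _ =>
  contDiffAt_det (M := jacM x) fun i j => (jac_smooth hx i j).contDiffAt

lemma sg_mul_jac {y : E' n} (h : (jacM x y).det ≠ 0) (a c : Fin n) :
    ∑ i, sg x a i y * pd c (fun z => x z i) y = if a = c then 1 else 0 := by
  have := congrFun (congrFun (Matrix.nonsing_inv_mul (jacM x y) (isUnit_iff_ne_zero.2 h)) a) c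
  rwa [Matrix.mul_apply, Matrix.one_apply] at this

lemma jac_mul_sg {y : E' n} (h : (jacM x y).det ≠ 0) (i k : Fin n) :
    ∑ a, pd a (fun z => x z i) y * sg x a k y = if i = k then 1 else 0 := by
  have := congrFun (congrFun (Matrix.mul_nonsing_inv (jacM x y) (isUnit_iff_ne_zero.2 h)) i) k
  rwa [Matrix.mul_apply, Matrix.one_apply] at this

lemma pd_sg (hx : ContDiff ℝ (⊤ : ℕ∞) x) (hdet : ∀ y ∈ Ball n, (jacM x y).det ≠ 0)
    (c a i : Fin n) {y : E' n} (hy : y ∈ Ball n) :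
    pd c (sg x a i) y = -∑ k, ∑ d, sg x a k y * hsx x k c d y * sg x d i y := by
  refine deriv_inv_aux (M := fun i a => pd a (fun z => x z i) y) (S := fun a i => sg x a i y)
    (S' := fun a i => pd c (sg x a i) y) (M' := fun k d => hsx x k c d y)
    (fun i j => jac_mul_sg (hdet y hy) i j) (fun a d => ?_) a i
  have s1 : ∀ k, Sm (fun y => sg x a k y * pd d (fun z => x z k) y) := fun k =>
    (sg_sm hx hdet a k).mul (ContDiff.sm (jac_smooth hx k d))
  have e := pd_congr_ball (Sm.sum fun k _ => s1 k) (sm_const (if a = d then 1 else 0))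
    (fun z hz => sg_mul_jac (hdet z hz) a d) c hy
  rw [pd_const, pd_sum fun k _ => (s1 k).differentiableAt hy] at e
  rw [← e]
  refine Finset.sum_congr rfl fun k _ => ?_
  rw [pd_mul ((sg_sm hx hdet a k).differentiableAt hy)
    ((ContDiff.sm (jac_smooth hx k d)).differentiableAt hy)]
  rfl

/-- Jacobi's formula. -/
lemma pd_kappa (hx : ContDiff ℝ (⊤ : ℕ∞) x) (c : Fin n) {y : E' n} (h : (jacM x y).det ≠ 0) :
    pd c (kappa x) y = kappa x y * ∑ d, ∑ k, sg x d k y * hsx x k c d y := by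
  set f : ContinuousMultilinearMap ℝ (fun _ : Fin n => Fin n → ℝ) ℝ :=
    ⟨(Matrix.detRowAlternating : (Fin n → ℝ) [⋀^Fin n]→ₗ[ℝ] ℝ).toMultilinearMap,
      (Continuous.matrix_det continuous_id : Continuous fun M : Matrix (Fin n) (Fin n) ℝ => M.det)⟩
    with hf
  have hg : ∀ i, HasFDerivAt (fun z : E' n => (fun a => pd a (fun z => x z i) z : Fin n → ℝ))
      (ContinuousLinearMap.pi fun a => fderiv ℝ (pd a (fun z => x z i)) y) y := fun i =>
    hasFDerivAt_pi.2 fun a => ((jac_smooth hx i a).differentiable (by simp) y).hasFDerivAt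
  have h1 := HasFDerivAt.multilinear_comp (f := f) hg
  have h2 : pd c (kappa x) y = ∑ i, ((jacM x y).updateRow i fun d => hsx x i c d y).det := by
    have e : fderiv ℝ (kappa x) y = _ := h1.fderiv
    rw [pd, e, _root_.sum_apply]
    rfl
  rw [h2]
  have h3 : ∀ i, ((jacM x y).updateRow i fun d => hsx x i c d y).det
      = ∑ d, kappa x y * (sg x d i y * hsx x i c d y) := by
    intro i
    rw [← Matrix.cramer_transpose_apply, Matrix.cramer_eq_adjugate_mulVec,
      ← Matrix.adjugate_transpose, Matrix.mulVec, dotProduct]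
    refine Finset.sum_congr rfl fun d _ => ?_
    rw [Matrix.transpose_apply, sg, Matrix.inv_def, Matrix.smul_apply, Ring.inverse_eq_inv',
      smul_eq_mul, kappa]
    field_simp
  simp_rw [h3]
  rw [Finset.sum_comm, Finset.mul_sum]
  simp_rw [Finset.mul_sum]

lemma gMet_inv (y : E' n) (a b : Fin n) :
    (gMet x y)⁻¹ a b = ∑ i, sg x a i y * sg x b i y := by
  rw [gMet, Matrix.mul_inv_rev, ← Matrix.transpose_nonsing_inv, Matrix.mul_apply]
  rfl

/-- The inverse metric. -/
def Asg (x : E' n → E' n) (a c : Fin n) (y : E' n) : ℝ := ∑ i, sg x a i y * sg x c i y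

/-- The first order coefficients of the Laplace-Beltrami operator. -/
def bsg (x : E' n → E' n) (d : Fin n) (y : E' n) : ℝ :=
  -∑ a, ∑ c, ∑ k, Asg x a c y * sg x d k y * hsx x k a c y

lemma Asg_sm (hx : ContDiff ℝ (⊤ : ℕ∞) x) (hdet : ∀ y ∈ Ball n, (jacM x y).det ≠ 0)
    (a c : Fin n) : Sm (Asg x a c) :=
  Sm.sum fun i _ => (sg_sm hx hdet a i).mul (sg_sm hx hdet c i)

lemma pd_Asg (hx : ContDiff ℝ (⊤ : ℕ∞) x) (hdet : ∀ y ∈ Ball n, (jacM x y).det ≠ 0)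
    (c a b : Fin n) {y : E' n} (hy : y ∈ Ball n) :
    pd c (Asg x a b) y = -(∑ k, ∑ d, sg x a k y * hsx x k c d y * Asg x d b y) -
      ∑ k, ∑ d, sg x b k y * hsx x k c d y * Asg x a d y := by
  have e : pd c (Asg x a b) y =
      ∑ i, (pd c (sg x a i) y * sg x b i y + sg x a i y * pd c (sg x b i) y) := by
    unfold Asg
    rw [pd_sum fun i _ => ((sg_sm hx hdet a i).mul (sg_sm hx hdet b i)).differentiableAt hy]
    exact Finset.sum_congr rfl fun i _ => pd_mul ((sg_sm hx hdet a i).differentiableAt hy)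
      ((sg_sm hx hdet b i).differentiableAt hy) c
  rw [e, Finset.sum_add_distrib, sub_eq_add_neg]
  congr 1
  · simp_rw [pd_sg hx hdet _ _ _ hy, neg_mul, Finset.sum_neg_distrib, Finset.sum_mul, Asg,
      Finset.mul_sum]
    rw [Finset.sum_comm]
    congr 1
    refine Finset.sum_congr rfl fun k _ => ?_
    rw [Finset.sum_comm]
    simp_rw [mul_assoc]
  · simp_rw [pd_sg hx hdet _ _ _ hy, mul_neg, Finset.sum_neg_distrib, Asg, Finset.mul_sum]
    rw [Finset.sum_comm]
    congr 1
    refine Finset.sum_congr rfl fun k _ => ?_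
    rw [Finset.sum_comm]
    refine Finset.sum_congr rfl fun d _ => Finset.sum_congr rfl fun i _ => by ring

/-- The Laplace-Beltrami operator in nondivergence form. -/
lemma lapl_eq_Lop (hx : ContDiff ℝ (⊤ : ℕ∞) x) (hdet : ∀ y ∈ Ball n, (jacM x y).det ≠ 0)
    {q : E' n → ℝ} (hq : ContDiff ℝ (⊤ : ℕ∞) q) {y : E' n} (hy : y ∈ Ball n) :
    lapl x q y = Lop (Asg x) (bsg x) q y := by
  have hk : kappa x y ≠ 0 := hdet y hy
  have sAq : ∀ a b, Sm (fun z => Asg x a b z * pd b q z) := fun a b =>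
    (Asg_sm hx hdet a b).mul (ContDiff.sm (ContDiff.pd hq b))
  have e1 : ∀ a, pd a (fun z => kappa x z * ∑ b, (gMet x z)⁻¹ a b * pd b q z) y =
      kappa x y * ((∑ d, ∑ k, sg x d k y * hsx x k a d y) * ∑ b, Asg x a b y * pd b q y) +
      kappa x y * ∑ b, (pd a (Asg x a b) y * pd b q y + Asg x a b y * pd a (pd b q) y) := by
    intro a
    have : (fun z => kappa x z * ∑ b, (gMet x z)⁻¹ a b * pd b q z) =
        fun z => kappa x z * ∑ b, Asg x a b z * pd b q z := by
      funext z
      simp_rw [gMet_inv]; rfl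
    rw [this, pd_mul ((kappa_sm hx).differentiableAt hy)
      ((Sm.sum fun b _ => sAq a b).differentiableAt hy), pd_kappa hx a (hdet y hy),
      pd_sum fun b _ => (sAq a b).differentiableAt hy]
    rw [mul_assoc]
    congr 2
    refine Finset.sum_congr rfl fun b _ => ?_
    exact pd_mul ((Asg_sm hx hdet a b).differentiableAt hy)
      ((ContDiff.sm (ContDiff.pd hq b)).differentiableAt hy) a
  rw [lapl]
  simp_rw [e1]
  rw [← Finset.sum_add_distrib.symm, ← Finset.mul_sum, ← Finset.mul_sum, ← mul_add, ← mul_assoc,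
    inv_mul_cancel₀ hk, one_mul]
  simp_rw [Finset.sum_add_distrib]
  rw [← add_assoc, Lop, add_comm]
  congr 1
  rw [← Finset.sum_add_distrib]
  simp_rw [Finset.mul_sum, ← Finset.sum_add_distrib]
  rw [Finset.sum_comm]
  refine Finset.sum_congr rfl fun b _ => ?_
  simp_rw [← mul_assoc, ← add_mul]
  rw [← Finset.sum_mul]
  congr 1
  simp_rw [pd_Asg hx hdet _ _ _ hy]
  rw [bsg, Finset.sum_add_distrib, Finset.sum_sub_distrib, Finset.sum_neg_distrib]
  have h1 : ∑ a, (∑ d, ∑ k, sg x d k y * hsx x k a d y) * Asg x a b y =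
      ∑ a, ∑ k, ∑ d, sg x a k y * hsx x k a d y * Asg x d b y := by
    simp_rw [Finset.sum_mul]
    rw [Finset.sum_comm]
    refine Finset.sum_congr rfl fun d _ => ?_
    rw [Finset.sum_comm]
    refine Finset.sum_congr rfl fun k _ => Finset.sum_congr rfl fun a _ => ?_
    rw [hsx_comm hx]
  have h2 : ∑ a, ∑ k, ∑ d, sg x b k y * hsx x k a d y * Asg x a d y =
      ∑ a, ∑ c, ∑ k, Asg x a c y * sg x b k y * hsx x k a c y := by
    refine Finset.sum_congr rfl fun a _ => ?_
    rw [Finset.sum_comm]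
    refine Finset.sum_congr rfl fun d _ => Finset.sum_congr rfl fun k _ => by ring
  rw [h1, h2]
  ring

end static

lemma abs_jac_le_of_coordCond {x : E' n → E' n} {c₁ : ℝ} {y : E' n} (h : coordCond x c₁ y)
    (i a : Fin n) : |pd a (fun z => x z i) y| ≤ |c₁| := by
  refine sq_le_sq.1 (le_trans ?_ h)
  have h1 : ∑ a, (jacM x y i a) ^ 2 ≤ ∑ i, ∑ a, (jacM x y i a) ^ 2 :=
    Finset.single_le_sum (f := fun i => ∑ a, (jacM x y i a) ^ 2)
      (fun i _ => Finset.sum_nonneg fun a _ => sq_nonneg _) (Finset.mem_univ i)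
  have h2 : (jacM x y i a) ^ 2 ≤ ∑ a, (jacM x y i a) ^ 2 :=
    Finset.single_le_sum (f := fun a => (jacM x y i a) ^ 2)
      (fun a _ => sq_nonneg _) (Finset.mem_univ a)
  have h3 : 0 ≤ ∑ i, ∑ a, ((jacM x y)⁻¹ i a) ^ 2 :=
    Finset.sum_nonneg fun i _ => Finset.sum_nonneg fun a _ => sq_nonneg _
  have h4 : (jacM x y i a) = pd a (fun z => x z i) y := rfl
  rw [← h4]; linarith

lemma abs_sg_le_of_coordCond {x : E' n → E' n} {c₁ : ℝ} {y : E' n} (h : coordCond x c₁ y)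
    (i a : Fin n) : |sg x i a y| ≤ |c₁| := by
  refine sq_le_sq.1 (le_trans ?_ h)
  have h1 : ∑ a, ((jacM x y)⁻¹ i a) ^ 2 ≤ ∑ i, ∑ a, ((jacM x y)⁻¹ i a) ^ 2 :=
    Finset.single_le_sum (f := fun i => ∑ a, ((jacM x y)⁻¹ i a) ^ 2)
      (fun i _ => Finset.sum_nonneg fun a _ => sq_nonneg _) (Finset.mem_univ i)
  have h2 : ((jacM x y)⁻¹ i a) ^ 2 ≤ ∑ a, ((jacM x y)⁻¹ i a) ^ 2 :=
    Finset.single_le_sum (f := fun a => ((jacM x y)⁻¹ i a) ^ 2)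
      (fun a _ => sq_nonneg _) (Finset.mem_univ a)
  have h3 : 0 ≤ ∑ i, ∑ a, (jacM x y i a) ^ 2 :=
    Finset.sum_nonneg fun i _ => Finset.sum_nonneg fun a _ => sq_nonneg _
  rw [sg]; linarith

/-- Families of coordinates satisfying a uniform coordinate condition, with second derivatives
controlled by the weight. -/
structure CoordFam {ι : Type} (W : ι → ℕ → ℝ) (x : ι → E' n → E' n) (c₁ : ℝ) : Prop where
  good : GoodW W
  bdd_zero : ∃ C, ∀ ω, W ω 0 ≤ C
  smooth : ∀ ω, ContDiff ℝ (⊤ : ℕ∞) (x ω)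
  det_ne : ∀ ω, ∀ y ∈ Ball n, (jacM (x ω) y).det ≠ 0
  cond : ∀ ω, ∀ y ∈ Ball n, coordCond (x ω) c₁ y
  tame_hsx : ∀ k c a, Tame W (fun ω => hsx (x ω) k c a)

section CoordFam
variable {ι : Type} {W : ι → ℕ → ℝ} {x : ι → E' n → E' n} {c₁ : ℝ}

lemma CoordFam.bdd_pd_sg (h : CoordFam W x c₁) {k : ℕ}
    (hs : ∀ a i, Bdd k W (fun ω => sg (x ω) a i)) (c a i : Fin n) :
    Bdd k W (fun ω => pd c (sg (x ω) a i)) := by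
  have hW := h.good
  have hm := hW.modl k
  have e : Bdd k W (fun ω y => -∑ l, ∑ d, sg (x ω) a l y * hsx (x ω) l c d y * sg (x ω) d i y) :=
    (Bdd.sum fun l _ => Bdd.sum fun d _ =>
      ((hs a l).mul (h.tame_hsx l c d k) hW.nonneg hW.nonneg hm).mul (hs d i)
        hW.nonneg hW.nonneg hm).neg
  exact e.congr (fun ω => (sg_sm (h.smooth ω) (h.det_ne ω) a i).pd c) fun ω y hy =>
    (pd_sg (h.smooth ω) (h.det_ne ω) c a i hy).symm

lemma CoordFam.tame_sg (h : CoordFam W x c₁) (a i : Fin n) : Tame W (fun ω => sg (x ω) a i) := by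
  have hW := h.good
  intro k
  induction k generalizing a i with
  | zero => exact ⟨fun ω => sg_sm (h.smooth ω) (h.det_ne ω) a i, 0, le_rfl, fun _ => trivial⟩
  | succ k ih =>
    refine Bdd.succ (bdd_one_of_le (fun ω => sg_sm (h.smooth ω) (h.det_ne ω) a i)
      (abs_nonneg c₁) fun ω y hy => ?_) hW.nonneg fun c => ?_
    · exact (abs_sg_le_of_coordCond (h.cond ω y hy) a i).trans
        (le_mul_of_one_le_right (abs_nonneg _) (hW.one_le ω 0))
    · exact (h.bdd_pd_sg ih c a i).mono_one fun ω j _ => hW.mono ω (Nat.le_succ j)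

lemma CoordFam.tame_Asg (h : CoordFam W x c₁) (a c : Fin n) :
    Tame W (fun ω => Asg (x ω) a c) :=
  Tame.sum fun i _ => Tame.mul h.good (h.tame_sg a i) (h.tame_sg c i)

lemma CoordFam.tame_bsg (h : CoordFam W x c₁) (d : Fin n) : Tame W (fun ω => bsg (x ω) d) :=
  (Tame.sum fun a _ => Tame.sum fun c _ => Tame.sum fun k _ =>
    (((h.tame_Asg a c).mul h.good (h.tame_sg d k)).mul h.good (h.tame_hsx k a c))).neg

lemma CoordFam.ellFam (hn : 0 < n) (h : CoordFam W x c₁) :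
    EllFam W (fun a c ω => Asg (x ω) a c) (fun d ω => bsg (x ω) d) :=
  ellFam_of_factor hn h.good h.bdd_zero (σ := fun a i ω => sg (x ω) a i)
    (J := fun i a ω => pd a (fun z => x ω z i)) h.tame_sg h.tame_bsg
    (fun a i c k => h.bdd_pd_sg (fun a i => h.tame_sg a i k) c a i)
    ⟨|c₁|, fun ω i a y hy => abs_jac_le_of_coordCond (h.cond ω y hy) i a⟩
    fun ω a c y hy => sg_mul_jac (h.det_ne ω y hy) a c

lemma CoordFam.tame_solution (hn : 0 < n) (h : CoordFam W x c₁) {u f : ι → E' n → ℝ}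
    (hu : ∀ ω, ContDiff ℝ (⊤ : ℕ∞) (u ω)) (hbd : ∀ ω, ∀ y ∈ Sphere' n, u ω y = 0)
    (hf : Tame W f) (hL : ∀ ω, EqOn (f ω) (Lop (Asg (x ω)) (bsg (x ω)) (u ω)) (Ball n)) :
    (∀ a, Tame W (fun ω => pd a (u ω))) ∧ Tame W u :=
  (h.ellFam hn).tame_solution hu hbd hf hL

end CoordFam

lemma SmoothST.at_time {u : ℝ → E' n → F} (h : SmoothST u) (t : ℝ) :
    ContDiff ℝ (⊤ : ℕ∞) (u t) :=
  ContDiff.comp (g := fun p : ℝ × E' n => u p.1 p.2) (f := fun y => (t, y)) h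
    (contDiff_const.prodMk contDiff_id)

lemma SmoothST.hasDerivAt_time {u : ℝ → E' n → F} (h : SmoothST u) (t : ℝ) (y : E' n) :
    HasDerivAt (fun s => u s y) (fderiv ℝ (fun p : ℝ × E' n => u p.1 p.2) (t, y) (1, 0)) t := by
  have h1 : HasDerivAt (fun s : ℝ => (s, y)) ((1 : ℝ), (0 : E' n)) t :=
    (hasDerivAt_id t).prodMk (hasDerivAt_const t y)
  exact ((ContDiff.differentiable h (by simp) (t, y)).hasFDerivAt).comp_hasDerivAt t h1

lemma SmoothST.hasDerivAt {u : ℝ → E' n → F} (h : SmoothST u) (t : ℝ) (y : E' n) :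
    HasDerivAt (fun s => u s y) (_root_.Dt u t y) t :=
  (h.hasDerivAt_time t y).differentiableAt.hasDerivAt

lemma SmoothST.Dt_eq {u : ℝ → E' n → F} (h : SmoothST u) (t : ℝ) (y : E' n) :
    _root_.Dt u t y = fderiv ℝ (fun p : ℝ × E' n => u p.1 p.2) (t, y) (1, 0) :=
  (h.hasDerivAt_time t y).deriv

lemma SmoothST.Dt {u : ℝ → E' n → F} (h : SmoothST u) : SmoothST (_root_.Dt u) := by
  have : (fun p : ℝ × E' n => _root_.Dt u p.1 p.2) =
      fun p => fderiv ℝ (fun p : ℝ × E' n => u p.1 p.2) p (1, 0) := by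
    funext p; exact h.Dt_eq p.1 p.2
  unfold SmoothST
  rw [this]
  exact (ContDiff.fderiv_right (m := (⊤ : ℕ∞)) h (by simp)).clm_apply contDiff_const

lemma SmoothST.coord {x : ℝ → E' n → E' n} (h : SmoothST x) (i : Fin n) :
    SmoothST (fun s y => x s y i) :=
  (contDiff_coord i).comp h

lemma Dt_coord {x : ℝ → E' n → E' n} (h : SmoothST x) (i : Fin n) (t : ℝ) (y : E' n) :
    Dt (fun s y => x s y i) t y = Dt x t y i :=
  ((EuclideanSpace.proj (𝕜 := ℝ) i).hasFDerivAt.comp_hasDerivAt t (h.hasDerivAt t y)).deriv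

section scalar
variable {u : ℝ → E' n → ℝ}

lemma SmoothST.pd_eq (h : SmoothST u) (a : Fin n) (t : ℝ) (y : E' n) :
    _root_.pd a (u t) y = fderiv ℝ (fun p : ℝ × E' n => u p.1 p.2) (t, y)
      (0, EuclideanSpace.single a 1) := by
  have h1 : HasFDerivAt (fun z : E' n => (t, z))
      ((0 : E' n →L[ℝ] ℝ).prod (ContinuousLinearMap.id ℝ (E' n))) y :=
    (hasFDerivAt_const t y).prodMk (hasFDerivAt_id y)
  have h2 : HasFDerivAt (u t) _ y :=
    ((ContDiff.differentiable h (by simp) (t, y)).hasFDerivAt).comp y h1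
  rw [_root_.pd, h2.fderiv]
  rfl

lemma SmoothST.pd (h : SmoothST u) (a : Fin n) : SmoothST (fun s y => _root_.pd a (u s) y) := by
  have : (fun p : ℝ × E' n => _root_.pd a (u p.1) p.2) =
      fun p => fderiv ℝ (fun p : ℝ × E' n => u p.1 p.2) p (0, EuclideanSpace.single a 1) := by
    funext p; exact h.pd_eq a p.1 p.2
  unfold SmoothST
  rw [this]
  exact (ContDiff.fderiv_right (m := (⊤ : ℕ∞)) h (by simp)).clm_apply contDiff_const

lemma Dt_pd (h : SmoothST u) (a : Fin n) (t : ℝ) (y : E' n) :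
    Dt (fun s y => pd a (u s) y) t y = pd a (Dt u t) y := by
  have hs : ContDiff ℝ (⊤ : ℕ∞) (fun p : ℝ × E' n => u p.1 p.2) := h
  have hd : ContDiff ℝ (⊤ : ℕ∞) (fderiv ℝ (fun p : ℝ × E' n => u p.1 p.2)) :=
    hs.fderiv_right (by simp)
  have hd' := (hd.differentiable (by simp) (t, y)).hasFDerivAt
  have key : ∀ v w : ℝ × E' n,
      fderiv ℝ (fun p => fderiv ℝ (fun p : ℝ × E' n => u p.1 p.2) p v) (t, y) w =
      fderiv ℝ (fderiv ℝ (fun p : ℝ × E' n => u p.1 p.2)) (t, y) w v := fun v w => by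
    rw [((hd'.clm_apply (hasFDerivAt_const v _)).fderiv)]
    simp
  rw [(h.pd a).Dt_eq, h.Dt.pd_eq]
  have e1 : (fun p : ℝ × E' n => pd a (u p.1) p.2) =
      fun p => fderiv ℝ (fun p : ℝ × E' n => u p.1 p.2) p (0, EuclideanSpace.single a 1) := by
    funext p; exact h.pd_eq a p.1 p.2
  have e2 : (fun p : ℝ × E' n => Dt u p.1 p.2) =
      fun p => fderiv ℝ (fun p : ℝ × E' n => u p.1 p.2) p (1, 0) := by
    funext p; exact h.Dt_eq p.1 p.2
  rw [e1, e2, key, key]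
  exact (hs.contDiffAt.isSymmSndFDerivAt (by
    rw [minSmoothness_of_isRCLikeNormedField]
    exact WithTop.coe_le_coe.2 (le_top : (2 : ℕ∞) ≤ ⊤))).eq _ _

lemma SmoothST.hasDerivAt_pd (h : SmoothST u) (a : Fin n) (t : ℝ) (y : E' n) :
    HasDerivAt (fun s => _root_.pd a (u s) y) (_root_.pd a (_root_.Dt u t) y) t := by
  rw [← Dt_pd h]
  exact (h.pd a).hasDerivAt t y

lemma SmoothST.hasDerivAt_pd_pd (h : SmoothST u) (a c : Fin n) (t : ℝ) (y : E' n) :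
    HasDerivAt (fun s => _root_.pd a (_root_.pd c (u s)) y)
      (_root_.pd a (_root_.pd c (_root_.Dt u t)) y) t := by
  have := (h.pd c).hasDerivAt_pd a t y
  have e : _root_.Dt (fun s y => _root_.pd c (u s) y) t = _root_.pd c (_root_.Dt u t) := by
    funext z; exact Dt_pd h c t z
  rwa [e] at this

end scalar

/-- Time derivative of the inverse Jacobian, with velocity `v`. -/
def sgd (x v : E' n → E' n) (a i : Fin n) (y : E' n) : ℝ :=
  -∑ k, ∑ d, sg x a k y * pd d (fun z => v z k) y * sg x d i y

/-- Time derivative of the inverse metric. -/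
def Asgd (x v : E' n → E' n) (a c : Fin n) (y : E' n) : ℝ :=
  ∑ i, (sgd x v a i y * sg x c i y + sg x a i y * sgd x v c i y)

/-- Time derivative of the first order coefficients. -/
def bsgd (x v : E' n → E' n) (d : Fin n) (y : E' n) : ℝ :=
  -∑ a, ∑ c, ∑ k, ((Asgd x v a c y * sg x d k y + Asg x a c y * sgd x v d k y) * hsx x k a c y +
    Asg x a c y * sg x d k y * hsx v k a c y)

/-- The Eulerian velocity gradient. -/
def evg (x v : E' n → E' n) (i k : Fin n) (y : E' n) : ℝ :=
  ∑ a, sg x a i y * pd a (fun z => v z k) y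

/-- Time derivative of the Eulerian velocity gradient, with acceleration `w`. -/
def evgd (x v w : E' n → E' n) (i k : Fin n) (y : E' n) : ℝ :=
  ∑ a, (sgd x v a i y * pd a (fun z => v z k) y + sg x a i y * pd a (fun z => w z k) y)

/-- The source term of the pressure equation. -/
def psrc (x v : E' n → E' n) (y : E' n) : ℝ := -∑ i, ∑ k, evg x v i k y * evg x v k i y

/-- The source term of the differentiated pressure equation. -/
def psrcd (x v w : E' n → E' n) (p : E' n → ℝ) (y : E' n) : ℝ :=
  -(∑ i, ∑ k, (evgd x v w i k y * evg x v k i y + evg x v i k y * evgd x v w k i y)) -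
    (∑ a, ∑ c, Asgd x v a c y * pd a (pd c p) y + ∑ a, bsgd x v a y * pd a p y)

section time
variable {x : ℝ → E' n → E' n} {t : ℝ} {y : E' n}

lemma hasDerivAt_jac (hx : SmoothST x) (i a : Fin n) (t : ℝ) (y : E' n) :
    HasDerivAt (fun s => pd a (fun z => x s z i) y) (pd a (fun z => Dt x t z i) y) t := by
  have := (hx.coord i).hasDerivAt_pd a t y
  rwa [show Dt (fun s y => x s y i) t = fun z => Dt x t z i from
    funext fun z => Dt_coord hx i t z] at this

lemma hasDerivAt_hsx (hx : SmoothST x) (k c a : Fin n) (t : ℝ) (y : E' n) :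
    HasDerivAt (fun s => hsx (x s) k c a y) (hsx (Dt x t) k c a y) t := by
  have := (hx.coord k).hasDerivAt_pd_pd c a t y
  rwa [show Dt (fun s y => x s y k) t = fun z => Dt x t z k from
    funext fun z => Dt_coord hx k t z] at this

lemma hasDerivAt_sg (hx : SmoothST x) (h0 : (jacM (x t) y).det ≠ 0) (a i : Fin n) :
    HasDerivAt (fun s => sg (x s) a i y) (sgd (x t) (Dt x t) a i y) t := by
  have hJ : ∀ i j, ContDiffAt ℝ (⊤ : ℕ∞) (fun s => jacM (x s) y i j) t := fun i j =>
    (ContDiff.comp (g := fun p : ℝ × E' n => pd j (fun z => x p.1 z i) p.2)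
      (f := fun s : ℝ => (s, y)) ((hx.coord i).pd j)
      (contDiff_id.prodMk contDiff_const)).contDiffAt
  have hS : ∀ a i, DifferentiableAt ℝ (fun s => sg (x s) a i y) t := fun a i =>
    (contDiffAt_inv_entry hJ h0 a i).differentiableAt (by simp)
  have hev : ∀ᶠ s in nhds t, (jacM (x s) y).det ≠ 0 :=
    (contDiffAt_det hJ).continuousAt.eventually_ne h0
  have e : deriv (fun s => sg (x s) a i y) t = sgd (x t) (Dt x t) a i y := by
    refine deriv_inv_aux (M := fun i a => pd a (fun z => x t z i) y)
      (S := fun a i => sg (x t) a i y) (S' := fun a i => deriv (fun s => sg (x s) a i y) t)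
      (M' := fun k d => pd d (fun z => Dt x t z k) y)
      (fun i j => jac_mul_sg h0 i j) (fun a c => ?_) a i
    have h1 : HasDerivAt (fun s => ∑ k, sg (x s) a k y * pd c (fun z => x s z k) y)
        (∑ k, (deriv (fun s => sg (x s) a k y) t * pd c (fun z => x t z k) y +
          sg (x t) a k y * pd c (fun z => Dt x t z k) y)) t :=
      HasDerivAt.fun_sum fun k _ => (hS a k).hasDerivAt.fun_mul (hasDerivAt_jac hx k c t y)
    refine h1.unique ((hasDerivAt_const t (if a = c then (1 : ℝ) else 0)).congr_of_eventuallyEq ?_)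
    filter_upwards [hev] with s hs
    exact sg_mul_jac hs a c
  rw [← e]
  exact (hS a i).hasDerivAt

lemma hasDerivAt_Asg (hx : SmoothST x) (h0 : (jacM (x t) y).det ≠ 0) (a c : Fin n) :
    HasDerivAt (fun s => Asg (x s) a c y) (Asgd (x t) (Dt x t) a c y) t :=
  HasDerivAt.fun_sum fun i _ => (hasDerivAt_sg hx h0 a i).fun_mul (hasDerivAt_sg hx h0 c i)

lemma hasDerivAt_bsg (hx : SmoothST x) (h0 : (jacM (x t) y).det ≠ 0) (d : Fin n) :
    HasDerivAt (fun s => bsg (x s) d y) (bsgd (x t) (Dt x t) d y) t :=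
  (HasDerivAt.fun_sum fun a _ => HasDerivAt.fun_sum fun c _ => HasDerivAt.fun_sum fun k _ =>
    ((hasDerivAt_Asg hx h0 a c).fun_mul (hasDerivAt_sg hx h0 d k)).fun_mul
      (hasDerivAt_hsx hx k a c t y)).fun_neg

lemma hasDerivAt_evg (hx : SmoothST x) (h0 : (jacM (x t) y).det ≠ 0) (i k : Fin n) :
    HasDerivAt (fun s => evg (x s) (Dt x s) i k y)
      (evgd (x t) (Dt x t) (Dt (Dt x) t) i k y) t :=
  HasDerivAt.fun_sum fun a _ => (hasDerivAt_sg hx h0 a i).fun_mul (hasDerivAt_jac hx.Dt k a t y)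

lemma hasDerivAt_psrc (hx : SmoothST x) (h0 : (jacM (x t) y).det ≠ 0) :
    HasDerivAt (fun s => psrc (x s) (Dt x s) y)
      (-∑ i, ∑ k, (evgd (x t) (Dt x t) (Dt (Dt x) t) i k y * evg (x t) (Dt x t) k i y +
        evg (x t) (Dt x t) i k y * evgd (x t) (Dt x t) (Dt (Dt x) t) k i y)) t :=
  (HasDerivAt.fun_sum fun i _ => HasDerivAt.fun_sum fun k _ =>
    (hasDerivAt_evg hx h0 i k).fun_mul (hasDerivAt_evg hx h0 k i)).fun_neg

lemma hasDerivAt_eq_zero_of_Icc {g : ℝ → ℝ} {g' T : ℝ} (hT : 0 < T) (ht : t ∈ Icc 0 T)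
    (hg : HasDerivAt g g' t) (h0 : ∀ s ∈ Icc 0 T, g s = 0) : g' = 0 :=
  (uniqueDiffOn_Icc hT t ht).eq_deriv _ hg.hasDerivWithinAt
    ((hasDerivWithinAt_const t (Icc 0 T) (0 : ℝ)).congr h0 (h0 t ht))

/-- The equation satisfied by the time derivative of the pressure. -/
lemma Lop_Dt (hx : SmoothST x) {p : ℝ → E' n → ℝ} (hp : SmoothST p) {T : ℝ} (hT : 0 < T)
    (ht : t ∈ Icc 0 T) (h0 : (jacM (x t) y).det ≠ 0)
    (h : ∀ s ∈ Icc 0 T, psrc (x s) (Dt x s) y = Lop (Asg (x s)) (bsg (x s)) (p s) y) :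
    psrcd (x t) (Dt x t) (Dt (Dt x) t) (p t) y =
      Lop (Asg (x t)) (bsg (x t)) (Dt p t) y := by
  have h1 : HasDerivAt (fun s => Lop (Asg (x s)) (bsg (x s)) (p s) y)
      (∑ a, ∑ c, (Asgd (x t) (Dt x t) a c y * pd a (pd c (p t)) y +
          Asg (x t) a c y * pd a (pd c (Dt p t)) y) +
        ∑ a, (bsgd (x t) (Dt x t) a y * pd a (p t) y + bsg (x t) a y * pd a (Dt p t) y)) t :=
    (HasDerivAt.fun_sum fun a _ => HasDerivAt.fun_sum fun c _ =>
      (hasDerivAt_Asg hx h0 a c).fun_mul (hp.hasDerivAt_pd_pd a c t y)).fun_add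
    (HasDerivAt.fun_sum fun a _ => (hasDerivAt_bsg hx h0 a).fun_mul (hp.hasDerivAt_pd a t y))
  have h2 := hasDerivAt_eq_zero_of_Icc hT ht ((hasDerivAt_psrc hx h0).fun_sub h1)
    fun s hs => sub_eq_zero.2 (h s hs)
  simp_rw [Finset.sum_add_distrib] at h2
  rw [psrcd, Lop]
  simp_rw [Finset.sum_add_distrib]
  linarith

end time

lemma norm_iteratedFDeriv_coord_le {x : E' n → E' n} (hx : ContDiff ℝ (⊤ : ℕ∞) x) (i : Fin n)
    (j : ℕ) (y : E' n) :
    ‖iteratedFDeriv ℝ j (fun z => x z i) y‖ ≤ ‖iteratedFDeriv ℝ j x y‖ := by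
  set L : E' n →L[ℝ] ℝ := EuclideanSpace.proj (𝕜 := ℝ) i with hL
  have hLn : ‖L‖ ≤ 1 := L.opNorm_le_bound zero_le_one fun v => by
    rw [one_mul]; exact PiLp.norm_apply_le v i
  exact (L.norm_iteratedFDeriv_comp_left (n := j) (x := y) (hx.contDiffAt (x := y))
    (by exact_mod_cast le_top)).trans (mul_le_of_le_one_left (norm_nonneg _) hLn)

lemma norm_iteratedFDeriv_jac_le {x : E' n → E' n} (hx : ContDiff ℝ (⊤ : ℕ∞) x) (i a : Fin n)
    {j m : ℕ} (hj : j + 1 ≤ m) {y : E' n} (hy : y ∈ Ball n) :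
    ‖iteratedFDeriv ℝ j (pd a (fun z => x z i)) y‖ ≤ ckNorm m x :=
  (norm_iteratedFDeriv_pd_le (contDiff_comp_coord hx i) a j y).trans
    ((norm_iteratedFDeriv_coord_le hx i _ y).trans (norm_iteratedFDeriv_le_ckNorm hx hj hy))

lemma norm_iteratedFDeriv_hsx_le {x : E' n → E' n} (hx : ContDiff ℝ (⊤ : ℕ∞) x) (k c a : Fin n)
    {j m : ℕ} (hj : j + 2 ≤ m) {y : E' n} (hy : y ∈ Ball n) :
    ‖iteratedFDeriv ℝ j (hsx x k c a) y‖ ≤ ckNorm m x :=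
  (norm_iteratedFDeriv_pd_le (jac_smooth hx k a) c j y).trans
    (norm_iteratedFDeriv_jac_le hx k a hj hy)

/-- Coordinates, velocity, acceleration, pressure and its time derivative at a fixed time. -/
structure PressureData (n : ℕ) (c₁ M : ℝ) where
  x : E' n → E' n
  v : E' n → E' n
  w : E' n → E' n
  p : E' n → ℝ
  q : E' n → ℝ
  hx : ContDiff ℝ (⊤ : ℕ∞) x
  hv : ContDiff ℝ (⊤ : ℕ∞) v
  hw : ContDiff ℝ (⊤ : ℕ∞) w
  hp : ContDiff ℝ (⊤ : ℕ∞) p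
  hq : ContDiff ℝ (⊤ : ℕ∞) q
  det_ne : ∀ y ∈ Ball n, (jacM x y).det ≠ 0
  cond : ∀ y ∈ Ball n, coordCond x c₁ y
  p_zero : ∀ y ∈ Sphere' n, p y = 0
  q_zero : ∀ y ∈ Sphere' n, q y = 0
  eq_p : ∀ y ∈ Ball n, psrc x v y = Lop (Asg x) (bsg x) p y
  eq_q : ∀ y ∈ Ball n, psrcd x v w p y = Lop (Asg x) (bsg x) q y
  le : ckNorm 3 x + ckNorm 2 v + ckNorm 1 w ≤ M

namespace PressureData
variable {c₁ M : ℝ}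

/-- The weight controlling the pressure. -/
def wt₁ (D : PressureData n c₁ M) (k : ℕ) : ℝ := 1 + ckNorm (k + 2) D.x + ckNorm (k + 1) D.v

/-- The weight controlling the time derivative of the pressure. -/
def wt₂ (D : PressureData n c₁ M) (k : ℕ) : ℝ :=
  1 + ckNorm (k + 3) D.x + ckNorm (k + 2) D.v + ckNorm (k + 1) D.w

lemma wt₁_zero_le (D : PressureData n c₁ M) : D.wt₁ 0 ≤ 1 + M := by
  have := D.le
  have := ckNorm_mono D.x (show 2 ≤ 3 by norm_num)
  have := ckNorm_mono D.v (show 1 ≤ 2 by norm_num)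
  have := ckNorm_nonneg 1 D.w
  simp only [wt₁, zero_add] at *
  linarith

lemma wt₂_zero_le (D : PressureData n c₁ M) : D.wt₂ 0 ≤ 1 + M := by
  have := D.le
  simp only [wt₂, zero_add]
  linarith

lemma logCvx_wt₁ (D : PressureData n c₁ M) : LogCvx 1200 D.wt₁ := by
  have h := ((logCvx_one.add (by norm_num) (logCvx_ckNorm D.hx 2)).add (by norm_num)
    ((logCvx_ckNorm D.hv 1).of_le (by norm_num)))
  exact h.of_le (by norm_num)

lemma goodW₁ : GoodW (wt₁ (n := n) (c₁ := c₁) (M := M)) :=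
  goodW_of_logCvx (C := 1200) (by norm_num) (fun D => D.logCvx_wt₁)
    (fun D k => by
      have := ckNorm_nonneg (k + 2) D.x
      have := ckNorm_nonneg (k + 1) D.v
      rw [wt₁]; linarith) wt₁_zero_le

lemma goodW₂ : GoodW (wt₂ (n := n) (c₁ := c₁) (M := M)) :=
  goodW_of_logCvx (C := 2400) (by norm_num)
    (fun D => by
      have h := ((((logCvx_one.add (by norm_num) (logCvx_ckNorm D.hx 3)).add (by norm_num)
        ((logCvx_ckNorm D.hv 2).of_le (by norm_num)))).add (by norm_num)
        ((logCvx_ckNorm D.hw 1).of_le (by norm_num)))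
      exact h.of_le (by norm_num))
    (fun D k => by
      have := ckNorm_nonneg (k + 3) D.x
      have := ckNorm_nonneg (k + 2) D.v
      have := ckNorm_nonneg (k + 1) D.w
      rw [wt₂]; linarith) wt₂_zero_le

lemma le_wt₁ (D : PressureData n c₁ M) (k : ℕ) :
    ckNorm (k + 2) D.x ≤ D.wt₁ k ∧ ckNorm (k + 1) D.v ≤ D.wt₁ k := by
  have := ckNorm_nonneg (k + 2) D.x
  have := ckNorm_nonneg (k + 1) D.v
  rw [wt₁]
  constructor <;> linarith

lemma wt₁_succ_le (D : PressureData n c₁ M) (k : ℕ) : D.wt₁ (k + 1) ≤ D.wt₂ k :=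
  le_add_of_nonneg_right (ckNorm_nonneg (k + 1) D.w)

lemma wt₁_le (D : PressureData n c₁ M) (k : ℕ) : D.wt₁ k ≤ D.wt₂ k :=
  (goodW₁.mono D (Nat.le_succ k)).trans (D.wt₁_succ_le k)

lemma le_wt₂ (D : PressureData n c₁ M) (k : ℕ) :
    ckNorm (k + 2) D.v ≤ D.wt₂ k ∧ ckNorm (k + 1) D.w ≤ D.wt₂ k := by
  have := ckNorm_nonneg (k + 3) D.x
  have := ckNorm_nonneg (k + 2) D.v
  have := ckNorm_nonneg (k + 1) D.w
  rw [wt₂]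
  constructor <;> linarith

lemma coordFam₁ : CoordFam (wt₁ (n := n) (c₁ := c₁) (M := M)) (fun D => D.x) c₁ where
  good := goodW₁
  bdd_zero := ⟨_, wt₁_zero_le⟩
  smooth D := D.hx
  det_ne D := D.det_ne
  cond D := D.cond
  tame_hsx k c a := tame_of_ckNorm (fun D => ContDiff.pd (jac_smooth D.hx k a) c) fun D j _ hy =>
    (norm_iteratedFDeriv_hsx_le D.hx k c a le_rfl hy).trans (D.le_wt₁ j).1

lemma _root_.Tame.mono_weight {ι : Type} {W W' : ι → ℕ → ℝ} {u : ι → E' n → ℝ} (h : Tame W u)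
    (hW : ∀ ω k, W ω k ≤ W' ω k) : Tame W' u := fun k => (h k).mono_one fun ω j _ => hW ω j

lemma coordFam₂ : CoordFam (wt₂ (n := n) (c₁ := c₁) (M := M)) (fun D => D.x) c₁ where
  good := goodW₂
  bdd_zero := ⟨_, wt₂_zero_le⟩
  smooth D := D.hx
  det_ne D := D.det_ne
  cond D := D.cond
  tame_hsx k c a := (coordFam₁.tame_hsx k c a).mono_weight wt₁_le

lemma tame_pd_v (a k : Fin n) : Tame (wt₁ (n := n) (c₁ := c₁) (M := M))
    (fun D => pd a (fun z => D.v z k)) :=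
  tame_of_ckNorm (fun D => jac_smooth D.hv k a) fun D j _ hy =>
    (norm_iteratedFDeriv_jac_le D.hv k a le_rfl hy).trans (D.le_wt₁ j).2

lemma tame_evg (i k : Fin n) : Tame (wt₁ (n := n) (c₁ := c₁) (M := M))
    (fun D => evg D.x D.v i k) :=
  Tame.sum fun a _ => (coordFam₁.tame_sg a i).mul goodW₁ (tame_pd_v a k)

lemma tame_p (hn : 0 < n) :
    (∀ a, Tame (wt₁ (n := n) (c₁ := c₁) (M := M)) (fun D => pd a D.p)) ∧
      Tame (wt₁ (n := n) (c₁ := c₁) (M := M)) (fun D => D.p) :=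
  coordFam₁.tame_solution hn (fun D => D.hp) (fun D => D.p_zero) (f := fun D => psrc D.x D.v)
    (Tame.neg (Tame.sum fun i _ => Tame.sum fun k _ => (tame_evg i k).mul goodW₁ (tame_evg k i)))
    fun D => D.eq_p

lemma tame_sgd (a i : Fin n) : Tame (wt₂ (n := n) (c₁ := c₁) (M := M))
    (fun D => sgd D.x D.v a i) :=
  Tame.neg (Tame.sum fun k _ => Tame.sum fun d _ =>
    ((coordFam₂.tame_sg a k).mul goodW₂ ((tame_pd_v d k).mono_weight wt₁_le)).mul goodW₂
      (coordFam₂.tame_sg d i))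

lemma tame_Asgd (a c : Fin n) : Tame (wt₂ (n := n) (c₁ := c₁) (M := M))
    (fun D => Asgd D.x D.v a c) :=
  Tame.sum fun i _ => ((tame_sgd a i).mul goodW₂ (coordFam₂.tame_sg c i)).add
    ((coordFam₂.tame_sg a i).mul goodW₂ (tame_sgd c i))

lemma tame_hsx_v (k c a : Fin n) : Tame (wt₂ (n := n) (c₁ := c₁) (M := M))
    (fun D => hsx D.v k c a) :=
  tame_of_ckNorm (fun D => ContDiff.pd (jac_smooth D.hv k a) c) fun D j _ hy =>
    (norm_iteratedFDeriv_hsx_le D.hv k c a le_rfl hy).trans (D.le_wt₂ j).1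

lemma tame_pd_w (a k : Fin n) : Tame (wt₂ (n := n) (c₁ := c₁) (M := M))
    (fun D => pd a (fun z => D.w z k)) :=
  tame_of_ckNorm (fun D => jac_smooth D.hw k a) fun D j _ hy =>
    (norm_iteratedFDeriv_jac_le D.hw k a le_rfl hy).trans (D.le_wt₂ j).2

lemma tame_bsgd (d : Fin n) : Tame (wt₂ (n := n) (c₁ := c₁) (M := M))
    (fun D => bsgd D.x D.v d) :=
  Tame.neg (Tame.sum fun a _ => Tame.sum fun c _ => Tame.sum fun k _ =>
    ((((tame_Asgd a c).mul goodW₂ (coordFam₂.tame_sg d k)).add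
      ((coordFam₂.tame_Asg a c).mul goodW₂ (tame_sgd d k))).mul goodW₂
        (coordFam₂.tame_hsx k a c)).add
    (((coordFam₂.tame_Asg a c).mul goodW₂ (coordFam₂.tame_sg d k)).mul goodW₂
      (tame_hsx_v k a c)))

lemma tame_evgd (i k : Fin n) : Tame (wt₂ (n := n) (c₁ := c₁) (M := M))
    (fun D => evgd D.x D.v D.w i k) :=
  Tame.sum fun a _ =>
    ((tame_sgd a i).mul goodW₂ ((tame_pd_v a k).mono_weight wt₁_le)).add
      ((coordFam₂.tame_sg a i).mul goodW₂ (tame_pd_w a k))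

lemma tame_pd_pd_p (hn : 0 < n) (a c : Fin n) : Tame (wt₂ (n := n) (c₁ := c₁) (M := M))
    (fun D => pd a (pd c D.p)) := fun k =>
  (((tame_p hn).1 c (k + 1)).pd a).mono_one fun D j _ => D.wt₁_succ_le j

lemma tame_psrcd (hn : 0 < n) : Tame (wt₂ (n := n) (c₁ := c₁) (M := M))
    (fun D => psrcd D.x D.v D.w D.p) :=
  (Tame.neg (Tame.sum fun i _ => Tame.sum fun k _ =>
    ((tame_evgd i k).mul goodW₂ ((tame_evg k i).mono_weight wt₁_le)).add
      (((tame_evg i k).mono_weight wt₁_le).mul goodW₂ (tame_evgd k i)))).sub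
  ((Tame.sum fun a _ => Tame.sum fun c _ =>
      (tame_Asgd a c).mul goodW₂ (tame_pd_pd_p hn a c)).add
    (Tame.sum fun a _ => (tame_bsgd a).mul goodW₂ (((tame_p hn).1 a).mono_weight wt₁_le)))

lemma tame_q (hn : 0 < n) :
    (∀ a, Tame (wt₂ (n := n) (c₁ := c₁) (M := M)) (fun D => pd a D.q)) ∧
      Tame (wt₂ (n := n) (c₁ := c₁) (M := M)) (fun D => D.q) :=
  coordFam₂.tame_solution hn (fun D => D.hq) (fun D => D.q_zero) (tame_psrcd hn)
    fun D => D.eq_q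

/-- The coordinate condition bounds the derivative of the coordinates from below. -/
lemma one_le (hn : 0 < n) (D : PressureData n c₁ M) {m : ℕ} (hm : 1 ≤ m) :
    1 ≤ n * |c₁| * ckNorm m D.x := by
  have h := sg_mul_jac (D.det_ne 0 zero_mem_ball) ⟨0, hn⟩ ⟨0, hn⟩
  rw [if_pos rfl] at h
  rw [← h]
  have hle : ∀ i, sg D.x ⟨0, hn⟩ i 0 * pd ⟨0, hn⟩ (fun z => D.x z i) 0 ≤ |c₁| * ckNorm m D.x := by
    intro i
    refine (le_abs_self _).trans ?_
    rw [abs_mul]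
    refine mul_le_mul (abs_sg_le_of_coordCond (D.cond 0 zero_mem_ball) _ i) ?_ (abs_nonneg _)
      (abs_nonneg _)
    have := norm_iteratedFDeriv_jac_le D.hx i ⟨0, hn⟩ (j := 0) hm zero_mem_ball
    rwa [norm_iteratedFDeriv_zero] at this
  refine (Finset.sum_le_sum fun i _ => hle i).trans ?_
  simp [mul_assoc]

lemma _root_.mul_le_of_le_weight {A C C' N S w : ℝ} (hA : 0 ≤ A) (hC : 0 ≤ C) (hC' : 0 ≤ C')
    (hS : 0 ≤ S) (hw : w ≤ (A + 1) * S) (h : N ≤ C * w) : N ≤ ((C + C') * (A + 1) + 1) * S := by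
  have h3 := mul_le_mul_of_nonneg_left hw hC
  have h4 : 0 ≤ C' * ((A + 1) * S) := by positivity
  linarith

/-- The estimates for the pressure and its time derivative. -/
lemma estimate (hn : 0 < n) (r : ℕ) : ∃ K > 0, ∀ D : PressureData n c₁ M,
    ckNorm (r + 1) D.p ≤ K * (ckNorm (r + 1) D.v + ckNorm (r + 2) D.x) ∧
    ckNorm (r + 1) D.q ≤
      K * (ckNorm (r + 1) D.w + ckNorm (r + 2) D.v + ckNorm (r + 3) D.x) := by
  obtain ⟨C, hC, h1⟩ := (tame_p (c₁ := c₁) (M := M) hn).2.ckNorm_le goodW₁ (fun D => D.hp)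
    (tame_p hn).1 r
  obtain ⟨C', hC', h2⟩ := (tame_q (c₁ := c₁) (M := M) hn).2.ckNorm_le goodW₂ (fun D => D.hq)
    (tame_q hn).1 r
  have hA : (0 : ℝ) ≤ n * |c₁| := by positivity
  refine ⟨(C + C') * (n * |c₁| + 1) + 1, by positivity, fun D => ⟨?_, ?_⟩⟩
  · have e := D.one_le hn (m := r + 2) (by omega)
    have n1 := ckNorm_nonneg (r + 2) D.x
    have n2 := ckNorm_nonneg (r + 1) D.v
    refine mul_le_of_le_weight hA hC hC' (add_nonneg n2 n1) ?_ (h1 D)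
    have := mul_nonneg hA n2
    rw [wt₁]; linarith
  · have e := D.one_le hn (m := r + 3) (by omega)
    have n1 := ckNorm_nonneg (r + 3) D.x
    have n2 := ckNorm_nonneg (r + 2) D.v
    have n3 := ckNorm_nonneg (r + 1) D.w
    rw [add_comm C C']
    refine mul_le_of_le_weight hA hC' hC (add_nonneg (add_nonneg n3 n2) n1) ?_ (h2 D)
    have := mul_nonneg hA n2
    have := mul_nonneg hA n3
    rw [wt₂]; linarith

end PressureData

/-- Hölder estimates for the pressure and its time derivative
(Lemma 6.4). -/
theorem stmt10 (n : ℕ) (hn : 2 ≤ n) (r : ℕ) (hr : 1 ≤ r) (c₁ M : ℝ) :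
    ∃ K > 0, ∀ (T : ℝ) (x : ℝ → E' n → E' n) (p : ℝ → E' n → ℝ),
      0 < T → SmoothST x → SmoothST p →
      (∀ t ∈ Icc (0:ℝ) T, ∀ y ∈ Ball n, (jacM (x t) y).det ≠ 0) →
      (∀ t ∈ Icc (0:ℝ) T, ∀ y ∈ Ball n, coordCond (x t) c₁ y) →
      (∀ t ∈ Icc (0:ℝ) T, ∀ y ∈ Sphere' n, p t y = 0) →
      (∀ t ∈ Icc (0:ℝ) T, ∀ y ∈ Ball n,
        lapl (x t) (p t) y =
          -∑ i, ∑ k, epd (x t) i (fun z => Dt x t z k) y * epd (x t) k (fun z => Dt x t z i) y) →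
      ∀ t ∈ Icc (0:ℝ) T,
        ckNorm 3 (x t) + ckNorm 2 (Dt x t) + ckNorm 1 (Dts 2 x t) ≤ M →
        ckNorm r (p t) ≤ K * (ckNorm r (Dt x t) + ckNorm (r + 1) (x t)) ∧
        ckNorm r (Dt p t) ≤
          K * (ckNorm r (Dts 2 x t) + ckNorm (r + 1) (Dt x t) + ckNorm (r + 2) (x t)) := by
  obtain ⟨s, rfl⟩ : ∃ s, r = s + 1 := ⟨r - 1, by omega⟩
  obtain ⟨K, hK, h⟩ := PressureData.estimate (c₁ := c₁) (M := M) (by omega : 0 < n) s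
  refine ⟨K, hK, fun T x p hT hx hp hdet hc hp0 heq t ht hM => ?_⟩
  have hsrc : ∀ y ∈ Ball n, ∀ τ ∈ Icc 0 T,
      psrc (x τ) (Dt x τ) y = Lop (Asg (x τ)) (bsg (x τ)) (p τ) y := fun y hy τ hτ =>
    (heq τ hτ y hy).symm.trans (lapl_eq_Lop (hx.at_time τ) (hdet τ hτ) (hp.at_time τ) hy)
  exact h
    { x := x t
      v := Dt x t
      w := Dt (Dt x) t
      p := p t
      q := Dt p t
      hx := hx.at_time t
      hv := hx.Dt.at_time t
      hw := hx.Dt.Dt.at_time t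
      hp := hp.at_time t
      hq := hp.Dt.at_time t
      det_ne := hdet t ht
      cond := hc t ht
      p_zero := hp0 t ht
      q_zero := fun y hy =>
        hasDerivAt_eq_zero_of_Icc hT ht (hp.hasDerivAt t y) fun τ hτ => hp0 τ hτ y hy
      eq_p := fun y hy => hsrc y hy t ht
      eq_q := fun y hy => Lop_Dt hx hp hT ht (hdet t ht y hy) (hsrc y hy)
      le := hM }

end
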